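/- Let g satisfy (H) and be strictly increasing, and let c > c_* (encoded as: χ₀(·;c) has two distinct positive real zeros λ₁(c) < λ₂(c), and equation (*) admits wavefronts both with speed c and with some speed c' < c). Let φ be a wavefront with speed c. Suppose w₀ satisfies (IC1), (IC2) and sup_{s∈[−h,0]} |φ(·+cs) − w₀(s,·)|_μ < ∞ for some μ > λ₁(c). Then every classical solution u of (*) with initial datum w₀ satisfies lim_{t→∞} sup_{x∈ℝ} |φ(x+ct) − u(t,x)| / η_{λ₁(c)}(x+ct) = 0. -/

import Mathlib

open Set Filter

noncomputable section

/-- The weight function `η_λ(t) = min{e^{λt}, 1}`. -/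
def eta (lam t : ℝ) : ℝ := min (Real.exp (lam * t)) 1

/-- The characteristic function `χ₀(λ) = λ² − cλ − 1 + g0·e^{−λch}` (with `g0 = g'(0)`). -/
def chi (g0 c h lam : ℝ) : ℝ := lam ^ 2 - c * lam - 1 + g0 * Real.exp (-(lam * c * h))

/-- Hypothesis (H) on the birth function `g` (extended linearly and C¹-smoothly to `(−∞,0]`). -/
structure HypH (g : ℝ → ℝ) (kap del0 Lg : ℝ) : Prop where
  cont : Continuous g
  nonneg : ∀ x : ℝ, 0 ≤ x → 0 ≤ g x
  kap_pos : 0 < kap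
  del0_pos : 0 < del0
  fixed_points : ∀ x : ℝ, 0 ≤ x → (g x = x ↔ x = 0 ∨ x = kap)
  smooth0 : ContDiffOn ℝ 1 g (Set.Ioo (-del0) del0)
  smooth_kap : ContDiffOn ℝ 1 g (Set.Ioo (kap - del0) (kap + del0))
  deriv0_gt : 1 < deriv g 0
  deriv_kap_lt : deriv g kap < 1
  lipschitz : ∀ u v : ℝ, 0 ≤ u → 0 ≤ v → |g u - g v| ≤ Lg * |u - v|
  holder : ∃ C > (0:ℝ), ∃ θ ∈ Set.Ioc (0:ℝ) 1,
      ∀ u ∈ Set.Ioc (0:ℝ) del0, |deriv g u - deriv g 0| ≤ C * u ^ θ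
  ext_linear : ∀ x : ℝ, x ≤ 0 → g x = deriv g 0 * x

/-- (IC1): `0 ≤ w₀ ≤ sup w₀ < ∞` on `Π₀ = [−h,0]×ℝ`. -/
def IC1 (h : ℝ) (w0 : ℝ → ℝ → ℝ) : Prop :=
  ∃ M : ℝ, ∀ s ∈ Set.Icc (-h) 0, ∀ x : ℝ, 0 ≤ w0 s x ∧ w0 s x ≤ M

/-- (IC2): `liminf_{x→+∞} min_{s∈[−h,0]} w₀(s,x) > 0`. -/
def IC2 (h : ℝ) (w0 : ℝ → ℝ → ℝ) : Prop :=
  ∃ m > (0:ℝ), ∃ X : ℝ, ∀ x ≥ X, ∀ s ∈ Set.Icc (-h) 0, m ≤ w0 s x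

/-- `w₀` is locally Hölder continuous in `x`, uniformly in `s ∈ [−h,0]`. -/
def LocHolder (h : ℝ) (w0 : ℝ → ℝ → ℝ) : Prop :=
  ∀ R > (0:ℝ), ∃ K > (0:ℝ), ∃ β ∈ Set.Ioc (0:ℝ) 1,
    ∀ s ∈ Set.Icc (-h) 0, ∀ x ∈ Set.Icc (-R) R, ∀ y ∈ Set.Icc (-R) R,
      |w0 s x - w0 s y| ≤ K * |x - y| ^ β

/-- A classical solution of the equation (*):
`u_t(t,x) = u_{xx}(t,x) − u(t,x) + g(u(t−h,x))` for `t > 0`, `x ∈ ℝ`. -/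
def SolvesStar (g : ℝ → ℝ) (h : ℝ) (u : ℝ → ℝ → ℝ) : Prop :=
  ContinuousOn (fun p : ℝ × ℝ => u p.1 p.2) {p : ℝ × ℝ | -h ≤ p.1} ∧
  (∀ T : ℝ, ∃ M : ℝ, ∀ t ∈ Set.Icc (-h) T, ∀ x : ℝ, |u t x| ≤ M) ∧
  (∀ t : ℝ, 0 < t → ∀ x : ℝ,
      DifferentiableAt ℝ (fun τ => u τ x) t ∧
      DifferentiableAt ℝ (fun y => u t y) x ∧
      DifferentiableAt ℝ (deriv (fun y => u t y)) x ∧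
      deriv (fun τ => u τ x) t =
        deriv (deriv (fun y => u t y)) x - u t x + g (u (t - h) x)) ∧
  ContinuousOn (fun p : ℝ × ℝ => deriv (fun τ => u τ p.2) p.1) {p : ℝ × ℝ | 0 < p.1} ∧
  ContinuousOn (fun p : ℝ × ℝ => deriv (fun y => u p.1 y) p.2) {p : ℝ × ℝ | 0 < p.1} ∧
  ContinuousOn (fun p : ℝ × ℝ => deriv (deriv (fun y => u p.1 y)) p.2) {p : ℝ × ℝ | 0 < p.1}

/-- A classical solution of equation (E1):
`w_t = w_{zz} − c w_z − w + g(w(t−h, z−ch))` for `t > 0`, `z ∈ ℝ`. -/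
def SolvesE1 (g : ℝ → ℝ) (h c : ℝ) (w : ℝ → ℝ → ℝ) : Prop :=
  ContinuousOn (fun p : ℝ × ℝ => w p.1 p.2) {p : ℝ × ℝ | -h ≤ p.1} ∧
  (∀ T : ℝ, ∃ M : ℝ, ∀ t ∈ Set.Icc (-h) T, ∀ z : ℝ, |w t z| ≤ M) ∧
  (∀ t : ℝ, 0 < t → ∀ z : ℝ,
      DifferentiableAt ℝ (fun τ => w τ z) t ∧
      DifferentiableAt ℝ (fun y => w t y) z ∧
      DifferentiableAt ℝ (deriv (fun y => w t y)) z ∧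
      deriv (fun τ => w τ z) t =
        deriv (deriv (fun y => w t y)) z - c * deriv (fun y => w t y) z
          - w t z + g (w (t - h) (z - c * h))) ∧
  ContinuousOn (fun p : ℝ × ℝ => deriv (fun τ => w τ p.2) p.1) {p : ℝ × ℝ | 0 < p.1} ∧
  ContinuousOn (fun p : ℝ × ℝ => deriv (fun y => w p.1 y) p.2) {p : ℝ × ℝ | 0 < p.1} ∧
  ContinuousOn (fun p : ℝ × ℝ => deriv (deriv (fun y => w p.1 y)) p.2) {p : ℝ × ℝ | 0 < p.1}

/-- A wavefront with speed `c`: a positive bounded C² solution of the profile equation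
with `φ(−∞) = 0`, `φ(+∞) = κ`. -/
def IsWavefront (g : ℝ → ℝ) (h c kap : ℝ) (φ : ℝ → ℝ) : Prop :=
  (∀ z : ℝ, 0 < φ z) ∧ (∃ M : ℝ, ∀ z : ℝ, φ z ≤ M) ∧ ContDiff ℝ 2 φ ∧
  (∀ z : ℝ, deriv (deriv φ) z - c * deriv φ z - φ z + g (φ (z - c * h)) = 0) ∧
  Filter.Tendsto φ Filter.atBot (nhds 0) ∧ Filter.Tendsto φ Filter.atTop (nhds kap)

/-- A semi-wavefront with speed `c`: as a wavefront, but at `+∞` only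
`liminf_{z→+∞} φ(z) > 0` is required. -/
def IsSemiWavefront (g : ℝ → ℝ) (h c : ℝ) (φ : ℝ → ℝ) : Prop :=
  (∀ z : ℝ, 0 < φ z) ∧ (∃ M : ℝ, ∀ z : ℝ, φ z ≤ M) ∧ ContDiff ℝ 2 φ ∧
  (∀ z : ℝ, deriv (deriv φ) z - c * deriv φ z - φ z + g (φ (z - c * h)) = 0) ∧
  Filter.Tendsto φ Filter.atBot (nhds 0) ∧
  (∃ m > (0:ℝ), ∀ᶠ z in Filter.atTop, m ≤ φ z)

/-- The nonlinear operator `𝒩` associated with (E1). -/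
def Nop (g : ℝ → ℝ) (h c : ℝ) (w : ℝ → ℝ → ℝ) (t z : ℝ) : ℝ :=
  deriv (fun τ => w τ z) t - deriv (deriv (fun y => w t y)) z
    + c * deriv (fun y => w t y) z + w t z - g (w (t - h) (z - c * h))

/-- A super-solution of (E1) with break point `zs`. -/
def IsSuperSolution (g : ℝ → ℝ) (h c : ℝ) (w : ℝ → ℝ → ℝ) (zs : ℝ) : Prop :=
  ContinuousOn (fun p : ℝ × ℝ => w p.1 p.2) {p : ℝ × ℝ | -h ≤ p.1} ∧
  (∀ t : ℝ, -h < t → ∀ z : ℝ, DifferentiableAt ℝ (fun τ => w τ z) t) ∧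
  (∀ t : ℝ, -h ≤ t → ∀ z : ℝ, z ≠ zs →
      DifferentiableAt ℝ (fun y => w t y) z ∧
      DifferentiableAt ℝ (deriv (fun y => w t y)) z) ∧
  (∀ t : ℝ, 0 < t → ∀ z : ℝ, z ≠ zs → 0 ≤ Nop g h c w t z) ∧
  (∀ t : ℝ, 0 < t →
      derivWithin (fun y => w t y) (Set.Iic zs) zs
        > derivWithin (fun y => w t y) (Set.Ici zs) zs)

/-- A sub-solution of (E1) with break point `zs` (all inequalities reversed). -/
def IsSubSolution (g : ℝ → ℝ) (h c : ℝ) (w : ℝ → ℝ → ℝ) (zs : ℝ) : Prop :=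
  ContinuousOn (fun p : ℝ × ℝ => w p.1 p.2) {p : ℝ × ℝ | -h ≤ p.1} ∧
  (∀ t : ℝ, -h < t → ∀ z : ℝ, DifferentiableAt ℝ (fun τ => w τ z) t) ∧
  (∀ t : ℝ, -h ≤ t → ∀ z : ℝ, z ≠ zs →
      DifferentiableAt ℝ (fun y => w t y) z ∧
      DifferentiableAt ℝ (deriv (fun y => w t y)) z) ∧
  (∀ t : ℝ, 0 < t → ∀ z : ℝ, z ≠ zs → Nop g h c w t z ≤ 0) ∧
  (∀ t : ℝ, 0 < t →
      derivWithin (fun y => w t y) (Set.Iic zs) zs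
        < derivWithin (fun y => w t y) (Set.Ici zs) zs)

/-- The consequences of (H) and strict monotonicity of `g` that the stability argument uses. -/
structure MonostableMap (g : ℝ → ℝ) (kap g0 L : ℝ) : Prop where
  mono : StrictMono g
  map_zero : g 0 = 0
  kap_pos : 0 < kap
  map_kap : g kap = kap
  lt_map : ∀ x, 0 < x → x < kap → x < g x
  map_lt : ∀ x, kap < x → g x < x
  one_lt : 1 < g0
  lip_pos : 0 < L
  lip : ∀ x y, |g x - g y| ≤ L * |x - y|
  lin_zero : ∀ ε > 0, ∃ δ > 0, ∀ x y, |x| ≤ δ → |y| ≤ δ →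
    |g x - g y - g0 * (x - y)| ≤ ε * |x - y|
  contr_kap : ∃ ρ δ : ℝ, 0 ≤ ρ ∧ ρ < 1 ∧ 0 < δ ∧ ∀ x y, |x - kap| ≤ δ → |y - kap| ≤ δ →
    |g x - g y| ≤ ρ * |x - y|

/-- Strict differentiability in `ε`-`δ` form. -/
lemma exists_linearization_of_contDiffOn {g : ℝ → ℝ} {a r : ℝ} (hr : 0 < r)
    (hg : ContDiffOn ℝ 1 g (Ioo (a - r) (a + r))) {ε : ℝ} (hε : 0 < ε) :
    ∃ δ > 0, ∀ x y, |x - a| ≤ δ → |y - a| ≤ δ →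
      |g x - g y - deriv g a * (x - y)| ≤ ε * |x - y| := by
  have hat : ContDiffAt ℝ 1 g a :=
    hg.contDiffAt (Ioo_mem_nhds (by linarith) (by linarith))
  have hs := hat.hasStrictDerivAt (by norm_num)
  have h1 := hs.isLittleO.def hε
  rw [Metric.eventually_nhds_iff] at h1
  obtain ⟨δ, hδ, h2⟩ := h1
  refine ⟨δ / 2, by positivity, fun x y hx hy => ?_⟩
  have h3 := h2 (y := (x, y)) (by
    rw [Prod.dist_eq, max_lt_iff, Real.dist_eq, Real.dist_eq]
    constructor <;> dsimp only <;> linarith)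
  simpa [mul_comm] using h3

lemma HypH.monostableMap {g : ℝ → ℝ} {kap del0 Lg : ℝ} (hH : HypH g kap del0 Lg)
    (hmono : StrictMono g) : ∃ L, MonostableMap g kap (deriv g 0) L := by
  have h0 : g 0 = 0 := (hH.fixed_points 0 le_rfl).2 (Or.inl rfl)
  have hk : g kap = kap := (hH.fixed_points kap hH.kap_pos.le).2 (Or.inr rfl)
  have hkp := hH.kap_pos
  have hg0 := hH.deriv0_gt
  have lin0 : ∀ ε > 0, ∃ δ > 0, ∀ x y, |x| ≤ δ → |y| ≤ δ →
      |g x - g y - deriv g 0 * (x - y)| ≤ ε * |x - y| := by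
    intro ε hε
    have := exists_linearization_of_contDiffOn (g := g) (a := 0) hH.del0_pos
      (by simpa using hH.smooth0) hε
    simpa using this
  have hdk : 0 ≤ deriv g kap := hmono.monotone.deriv_nonneg
  have hkl := hH.deriv_kap_lt
  obtain ⟨δ, hδ, hlink⟩ := exists_linearization_of_contDiffOn hH.del0_pos hH.smooth_kap
    (ε := (1 - deriv g kap) / 2) (by linarith)
  have hcontr : ∀ x y, |x - kap| ≤ δ → |y - kap| ≤ δ →
      |g x - g y| ≤ ((1 + deriv g kap) / 2) * |x - y| := by
    intro x y hx hy
    have h1 := hlink x y hx hy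
    have h2 : |deriv g kap * (x - y)| = deriv g kap * |x - y| := by
      rw [abs_mul, abs_of_nonneg hdk]
    have h3 := abs_add_le (g x - g y - deriv g kap * (x - y)) (deriv g kap * (x - y))
    rw [sub_add_cancel, h2] at h3
    nlinarith
  have hcont := hH.cont
  refine ⟨max Lg (deriv g 0), hmono, h0, hkp, hk, ?_, ?_, hg0,
    lt_of_lt_of_le (by linarith) (le_max_right _ _), ?_, lin0,
    ⟨(1 + deriv g kap) / 2, δ, by linarith, by linarith, hδ, hcontr⟩⟩
  · intro x hx hxk
    by_contra! hle
    obtain ⟨d, hd, hl⟩ := lin0 ((deriv g 0 - 1) / 2) (by linarith)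
    set y := min d (x / 2) with hy
    have hy0 : 0 < y := lt_min hd (by linarith)
    have hyx : y ≤ x := (min_le_right _ _).trans (by linarith)
    have h1 := hl y 0 (by rw [abs_of_pos hy0]; exact min_le_left _ _) (by simpa using hd.le)
    simp only [h0, sub_zero, abs_of_pos hy0] at h1
    have h2 : y < g y := by nlinarith [(abs_le.1 h1).1]
    have : (0:ℝ) ∈ (fun s => g s - s) '' Icc y x := by
      apply intermediate_value_Icc' hyx (hcont.sub continuous_id).continuousOn
      constructor
      · simpa using hle
      · simpa using h2.le
    obtain ⟨s, hs, hs0⟩ := this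
    rcases (hH.fixed_points s (by linarith [hs.1])).1 (by simpa [sub_eq_zero] using hs0) with h | h
    · linarith [hs.1]
    · linarith [hs.2]
  · intro x hx
    by_contra! hle
    set y := min (kap + δ) ((x + kap) / 2) with hy
    have hy0 : kap < y := lt_min (by linarith) (by linarith)
    have hyx : y ≤ x := (min_le_right _ _).trans (by linarith)
    have h1 := hcontr y kap (by rw [abs_of_pos (by linarith)]; linarith [min_le_left (kap + δ) ((x + kap) / 2)])
      (by simpa using hδ.le)
    rw [hk, abs_of_pos (show 0 < y - kap by linarith)] at h1
    have h2 : g y < y := by nlinarith [(abs_le.1 h1).2]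
    have : (0:ℝ) ∈ (fun s => g s - s) '' Icc y x := by
      apply intermediate_value_Icc hyx (hcont.sub continuous_id).continuousOn
      constructor
      · simpa using h2.le
      · simpa using hle
    obtain ⟨s, hs, hs0⟩ := this
    rcases (hH.fixed_points s (by linarith [hs.1])).1 (by simpa [sub_eq_zero] using hs0) with h | h
    · linarith [hs.1]
    · linarith [hs.1]
  · have key : ∀ x y, y ≤ x → |g x - g y| ≤ max Lg (deriv g 0) * |x - y| := by
      intro x y hxy
      have hm : ∀ t : ℝ, 0 ≤ t → Lg * t ≤ max Lg (deriv g 0) * t ∧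
          deriv g 0 * t ≤ max Lg (deriv g 0) * t := fun t ht =>
        ⟨mul_le_mul_of_nonneg_right (le_max_left _ _) ht,
          mul_le_mul_of_nonneg_right (le_max_right _ _) ht⟩
      rcases le_total 0 y with hy | hy
      · exact (hH.lipschitz x y (hy.trans hxy) hy).trans (hm _ (abs_nonneg _)).1
      · rcases le_total x 0 with hx | hx
        · rw [hH.ext_linear x hx, hH.ext_linear y hy, ← mul_sub, abs_mul,
            abs_of_pos (show 0 < deriv g 0 by linarith)]
          exact (hm _ (abs_nonneg _)).2
        · have h1 := hH.lipschitz x 0 hx le_rfl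
          rw [h0, sub_zero, sub_zero, abs_of_nonneg (hH.nonneg x hx), abs_of_nonneg hx] at h1
          rw [abs_of_nonneg (sub_nonneg.2 (hmono.monotone hxy)), abs_of_nonneg (sub_nonneg.2 hxy),
            hH.ext_linear y hy]
          have h2 := (hm x hx).1
          have h3 := (hm (-y) (by linarith)).2
          linarith
    intro x y
    rcases le_total y x with hxy | hxy
    · exact key x y hxy
    · rw [abs_sub_comm, abs_sub_comm x]; exact key y x hxy

lemma le_of_hasDerivAt_nonneg {f f' : ℝ → ℝ} {a b : ℝ} (hab : a ≤ b)
    (hf : ∀ x ∈ Icc a b, HasDerivAt f (f' x) x) (h0 : ∀ x ∈ Icc a b, 0 ≤ f' x) :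
    f a ≤ f b := by
  have := monotoneOn_of_hasDerivWithinAt_nonneg (convex_Icc a b) (f := f) (f' := f')
    (fun x hx => (hf x hx).continuousAt.continuousWithinAt)
    (fun x hx => (hf x (interior_subset hx)).hasDerivWithinAt)
    (fun x hx => h0 x (interior_subset hx))
  exact this (left_mem_Icc.2 hab) (right_mem_Icc.2 hab) hab

lemma hasDerivAt_exp_mul (a z : ℝ) :
    HasDerivAt (fun y => Real.exp (a * y)) (a * Real.exp (a * z)) z := by
  have := ((hasDerivAt_id z).const_mul a).exp
  simpa [mul_comm] using this

/-- First and second order conditions at a global maximum. -/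
lemma deriv_conditions_of_isMax {f f1 : ℝ → ℝ} {f2 x : ℝ}
    (h1 : ∀ y, HasDerivAt f (f1 y) y) (h2 : HasDerivAt f1 f2 x) (hmax : ∀ y, f y ≤ f x) :
    f1 x = 0 ∧ f2 ≤ 0 := by
  have hz : f1 x = 0 :=
    IsLocalMax.hasDerivAt_eq_zero (Eventually.of_forall hmax) (h1 x)
  refine ⟨hz, ?_⟩
  by_contra! hpos
  have hd : deriv f = f1 := funext fun y => (h1 y).deriv
  have hmin : IsLocalMin f x := isLocalMin_of_deriv_deriv_pos
    (by rw [hd, h2.deriv]; exact hpos) (by rw [hd, hz]) (h1 x).continuousAt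
  have hconst : f =ᶠ[nhds x] fun _ => f x := by
    filter_upwards [hmin] with y hy
    exact le_antisymm (hmax y) hy
  have hd0 : deriv f =ᶠ[nhds x] fun _ => 0 := by
    have := hconst.deriv
    simpa using this
  have : deriv (deriv f) x = 0 := by
    rw [hd0.deriv_eq]; simp
  rw [hd, h2.deriv] at this
  linarith

lemma deriv_le_of_nonneg_supersol {c : ℝ} {v v1 v2 : ℝ → ℝ}
    (d1 : ∀ z, HasDerivAt v (v1 z) z) (d2 : ∀ z, HasDerivAt v1 (v2 z) z)
    (h0 : ∀ z, 0 ≤ v z) (hs : ∀ z, v2 z - c * v1 z - v z ≤ 0) (z0 : ℝ) :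
    v1 z0 ≤ (|c| + 1) * v z0 := by
  set s := Real.sqrt (c ^ 2 + 4) with hsdef
  have hs2 : s ^ 2 = c ^ 2 + 4 := Real.sq_sqrt (by positivity)
  have hs0 : 0 ≤ s := Real.sqrt_nonneg _
  have hca : |c| ^ 2 = c ^ 2 := sq_abs c
  have hsl : |c| < s := by nlinarith [abs_nonneg c]
  have hsu : s ≤ |c| + 2 := by nlinarith [abs_nonneg c]
  have hc1 := le_abs_self c
  have hc2 := neg_abs_le c
  set β := (c + s) / 2 with hβ
  set α := (c - s) / 2 with hα
  have hβp : 0 < β := by rw [hβ]; linarith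
  have hαn : α < 0 := by rw [hα]; linarith
  have hβK : β ≤ |c| + 1 := by rw [hβ]; linarith
  have hsum : α + β = c := by rw [hα, hβ]; ring
  have hprod : α * β = -1 := by rw [hα, hβ]; nlinarith
  by_contra! hcon
  have hq0 : 0 < v1 z0 - β * v z0 := by nlinarith [h0 z0]
  set q0 := v1 z0 - β * v z0 with hq0d
  have hq : ∀ z ≤ z0, q0 ≤ v1 z - β * v z := by
    intro z hz
    have h1 := le_of_hasDerivAt_nonneg (f := fun y => -(Real.exp (-α * y) * (v1 y - β * v y)))
      (f' := fun y => -(-α * Real.exp (-α * y) * (v1 y - β * v y)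
        + Real.exp (-α * y) * (v2 y - β * v1 y))) hz
      (fun y _ => ((hasDerivAt_exp_mul (-α) y).mul ((d2 y).sub ((d1 y).const_mul β))).neg)
      (fun y _ => by
        have e : -(-α * Real.exp (-α * y) * (v1 y - β * v y)
            + Real.exp (-α * y) * (v2 y - β * v1 y))
            = Real.exp (-α * y) * -(v2 y - (α + β) * v1 y + (α * β) * v y) := by ring
        rw [e, hsum, hprod]
        apply mul_nonneg (Real.exp_pos _).le
        have := hs y
        linarith)
    have h2 : Real.exp (-α * z) ≤ Real.exp (-α * z0) := Real.exp_le_exp.2 (by nlinarith)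
    have h3 := Real.exp_pos (-α * z)
    rw [← hq0d] at h1
    have h4 : Real.exp (-α * z) * q0 ≤ Real.exp (-α * z0) * q0 :=
      mul_le_mul_of_nonneg_right h2 hq0.le
    have h5 : Real.exp (-α * z) * q0 ≤ Real.exp (-α * z) * (v1 z - β * v z) := by linarith
    exact le_of_mul_le_mul_left h5 h3
  have hbound : ∀ z ≤ z0, Real.exp (-β * z) * (q0 / β)
      ≤ Real.exp (-β * z0) * (v z0 + q0 / β) := by
    intro z hz
    have h1 := le_of_hasDerivAt_nonneg (f := fun y => Real.exp (-β * y) * (v y + q0 / β))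
      (f' := fun y => -β * Real.exp (-β * y) * (v y + q0 / β) + Real.exp (-β * y) * v1 y) hz
      (fun y _ => (hasDerivAt_exp_mul (-β) y).mul ((d1 y).add_const _))
      (fun y hy => by
        have e : -β * Real.exp (-β * y) * (v y + q0 / β) + Real.exp (-β * y) * v1 y
          = Real.exp (-β * y) * ((v1 y - β * v y) - q0) := by field_simp; ring
        rw [e]
        exact mul_nonneg (Real.exp_pos _).le (by linarith [hq y hy.2]))
    refine le_trans ?_ h1
    exact mul_le_mul_of_nonneg_left (by linarith [h0 z]) (Real.exp_pos _).le
  have ht : Tendsto (fun z : ℝ => Real.exp (-β * z) * (q0 / β)) atBot atTop := by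
    apply Tendsto.atTop_mul_const (by positivity)
    exact Real.tendsto_exp_atTop.comp (tendsto_id.const_mul_atBot_of_neg (by linarith))
  have h6 := (ht.eventually_gt_atTop (Real.exp (-β * z0) * (v z0 + q0 / β))).and
    (eventually_le_atBot z0)
  obtain ⟨z, hz1, hz2⟩ := h6.exists
  linarith [hbound z hz2]

/-- Harnack inequality for nonnegative supersolutions of `v'' - c v' - v = 0`. -/
lemma abs_deriv_le_of_nonneg_supersol {c : ℝ} {v v1 v2 : ℝ → ℝ}
    (d1 : ∀ z, HasDerivAt v (v1 z) z) (d2 : ∀ z, HasDerivAt v1 (v2 z) z)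
    (h0 : ∀ z, 0 ≤ v z) (hs : ∀ z, v2 z - c * v1 z - v z ≤ 0) (z : ℝ) :
    |v1 z| ≤ (|c| + 1) * v z := by
  rw [abs_le]
  refine ⟨?_, deriv_le_of_nonneg_supersol d1 d2 h0 hs z⟩
  have r1 : ∀ z, HasDerivAt (fun y => v (-y)) (-v1 (-z)) z := fun z => by
    simpa [Function.comp_def] using (d1 (-z)).comp z (hasDerivAt_neg z)
  have r2 : ∀ z, HasDerivAt (fun y => -v1 (-y)) (v2 (-z)) z := fun z => by
    simpa [Function.comp_def] using ((d2 (-z)).comp z (hasDerivAt_neg z)).fun_neg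
  have := deriv_le_of_nonneg_supersol (c := -c) r1 r2 (fun z => h0 _)
    (fun z => by have := hs (-z); linarith) (-z)
  simp only [neg_neg, abs_neg] at this
  linarith

lemma le_exp_mul_of_abs_deriv_le {K : ℝ} {v v1 : ℝ → ℝ}
    (d1 : ∀ z, HasDerivAt v (v1 z) z) (hb : ∀ z, |v1 z| ≤ K * v z) (x y : ℝ) :
    v x ≤ Real.exp (K * |x - y|) * v y := by
  rcases le_total x y with hxy | hxy
  · have h1 := le_of_hasDerivAt_nonneg (f := fun t => Real.exp (K * t) * v t)
      (f' := fun t => K * Real.exp (K * t) * v t + Real.exp (K * t) * v1 t) hxy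
      (fun t _ => (hasDerivAt_exp_mul K t).mul (d1 t))
      (fun t _ => by
        have := (abs_le.1 (hb t)).1
        have e : K * Real.exp (K * t) * v t + Real.exp (K * t) * v1 t
          = Real.exp (K * t) * (K * v t + v1 t) := by ring
        rw [e]
        exact mul_nonneg (Real.exp_pos _).le (by linarith))
    have e : |x - y| = y - x := by rw [abs_of_nonpos (by linarith)]; ring
    rw [e, mul_sub, Real.exp_sub, div_mul_eq_mul_div, le_div_iff₀ (Real.exp_pos _)]
    linarith
  · have h1 := le_of_hasDerivAt_nonneg (f := fun t => -(Real.exp (-K * t) * v t))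
      (f' := fun t => -(-K * Real.exp (-K * t) * v t + Real.exp (-K * t) * v1 t)) hxy
      (fun t _ => ((hasDerivAt_exp_mul (-K) t).mul (d1 t)).neg)
      (fun t _ => by
        have := (abs_le.1 (hb t)).2
        have e : -(-K * Real.exp (-K * t) * v t + Real.exp (-K * t) * v1 t)
          = Real.exp (-K * t) * (K * v t - v1 t) := by ring
        rw [e]
        exact mul_nonneg (Real.exp_pos _).le (by linarith))
    have e : |x - y| = x - y := abs_of_nonneg (by linarith)
    simp only [neg_mul, Real.exp_neg] at h1
    have hx := Real.exp_pos (K * x)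
    have hy := Real.exp_pos (K * y)
    have h2 : (Real.exp (K * x))⁻¹ * v x ≤ (Real.exp (K * y))⁻¹ * v y := by linarith
    rw [e, mul_sub, Real.exp_sub]
    rw [inv_mul_le_iff₀ hx] at h2
    calc v x ≤ _ := h2
      _ = _ := by field_simp

lemma exists_isMax_of_tails {f : ℝ → ℝ} (hf : Continuous f) {x₀ : ℝ}
    (hb : ∀ᶠ z in atBot, f z ≤ f x₀) (ht : ∀ᶠ z in atTop, f z ≤ f x₀) :
    ∃ x, ∀ y, f y ≤ f x := by
  apply hf.exists_forall_ge' x₀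
  rw [cocompact_eq_atBot_atTop]
  exact eventually_sup.2 ⟨hb, ht⟩

/-- A wavefront profile together with its first two derivatives. -/
structure Profile (g : ℝ → ℝ) (h c kap : ℝ) (v v1 v2 : ℝ → ℝ) : Prop where
  pos : ∀ z, 0 < v z
  d1 : ∀ z, HasDerivAt v (v1 z) z
  d2 : ∀ z, HasDerivAt v1 (v2 z) z
  eq : ∀ z, v2 z = c * v1 z + v z - g (v (z - c * h))
  bot : Tendsto v atBot (nhds 0)
  top : Tendsto v atTop (nhds kap)

lemma IsWavefront.profile {g : ℝ → ℝ} {h c kap : ℝ} {φ : ℝ → ℝ} (hφ : IsWavefront g h c kap φ) :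
    Profile g h c kap φ (deriv φ) (deriv (deriv φ)) := by
  obtain ⟨h1, -, h3, h4, h5, h6⟩ := hφ
  have h7 : ContDiff ℝ 1 (deriv φ) := by
    have : ContDiff ℝ (1 + 1) φ := by simpa [one_add_one_eq_two] using h3
    exact (contDiff_succ_iff_deriv.1 this).2.2
  exact ⟨h1, fun z => (h3.differentiable (by norm_num) z).hasDerivAt,
    fun z => (h7.differentiable (by norm_num) z).hasDerivAt, fun z => by linarith [h4 z], h5, h6⟩

section Profile
variable {g : ℝ → ℝ} {h c kap g0 L : ℝ} {v v1 v2 : ℝ → ℝ}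

lemma MonostableMap.pos_of_pos (hg : MonostableMap g kap g0 L) {x : ℝ} (hx : 0 < x) : 0 < g x := by
  have := hg.mono hx; rwa [hg.map_zero] at this

lemma MonostableMap.continuous (hg : MonostableMap g kap g0 L) : Continuous g := by
  have : LipschitzWith (Real.toNNReal L) g := by
    apply LipschitzWith.of_dist_le_mul
    intro x y
    rw [Real.dist_eq, Real.dist_eq, Real.coe_toNNReal _ hg.lip_pos.le]
    exact hg.lip x y
  exact this.continuous

lemma Profile.continuous (hv : Profile g h c kap v v1 v2) : Continuous v :=
  continuous_iff_continuousAt.2 fun z => (hv.d1 z).continuousAt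

lemma Profile.shift (hv : Profile g h c kap v v1 v2) (a : ℝ) :
    Profile g h c kap (fun z => v (z + a)) (fun z => v1 (z + a)) (fun z => v2 (z + a)) where
  pos z := hv.pos _
  d1 z := by simpa using (hv.d1 (z + a)).comp_add_const z a
  d2 z := by simpa using (hv.d2 (z + a)).comp_add_const z a
  eq z := by rw [hv.eq, show z + a - c * h = z - c * h + a by ring]
  bot := hv.bot.comp (tendsto_atBot_add_const_right _ a tendsto_id)
  top := hv.top.comp (tendsto_atTop_add_const_right _ a tendsto_id)

lemma Profile.abs_deriv_le (hg : MonostableMap g kap g0 L) (hv : Profile g h c kap v v1 v2)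
    (z : ℝ) : |v1 z| ≤ (|c| + 1) * v z :=
  abs_deriv_le_of_nonneg_supersol hv.d1 hv.d2 (fun z => (hv.pos z).le)
    (fun z => by rw [hv.eq]; linarith [hg.pos_of_pos (hv.pos (z - c * h))]) z

lemma Profile.le_exp_mul (hg : MonostableMap g kap g0 L) (hv : Profile g h c kap v v1 v2)
    (x y : ℝ) : v x ≤ Real.exp ((|c| + 1) * |x - y|) * v y :=
  le_exp_mul_of_abs_deriv_le hv.d1 (hv.abs_deriv_le hg) x y

lemma Profile.le_kap (hg : MonostableMap g kap g0 L) (hv : Profile g h c kap v v1 v2)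
    (z : ℝ) : v z ≤ kap := by
  by_contra! hz
  obtain ⟨x, hx⟩ := exists_isMax_of_tails hv.continuous (x₀ := z)
    ((hv.bot.eventually_lt_const (hv.pos z)).mono fun _ h => h.le)
    ((hv.top.eventually_lt_const hz).mono fun _ h => h.le)
  obtain ⟨e1, e2⟩ := deriv_conditions_of_isMax hv.d1 (hv.d2 x) hx
  rw [hv.eq, e1] at e2
  have h1 := hg.mono.monotone (hx (x - c * h))
  have h2 := hg.map_lt (v x) (lt_of_lt_of_le hz (hx z))
  linarith

/-- Sliding lemma: a profile lying below a supersolution on a left half-line stays below it. -/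
lemma Profile.le_of_le_left (hg : MonostableMap g kap g0 L)
    (hA : Profile g h c kap v v1 v2)
    {B B1 B2 : ℝ → ℝ} (b1 : ∀ z, HasDerivAt B (B1 z) z) (b2 : ∀ z, HasDerivAt B1 (B2 z) z)
    (hB : ∀ z, B2 z - c * B1 z - B z + g (B (z - c * h)) ≤ 0)
    (hBtop : Tendsto B atTop (nhds kap)) {ρ δ Z : ℝ} (hρ : ρ < 1)
    (hcontr : ∀ x y, |x - kap| ≤ δ → |y - kap| ≤ δ → |g x - g y| ≤ ρ * |x - y|)
    (hleft : ∀ z ≤ Z, v z ≤ B z) (hright : ∀ z ≥ Z, kap - δ ≤ B z) (z : ℝ) : v z ≤ B z := by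
  by_contra! hz
  have hBc : Continuous B := continuous_iff_continuousAt.2 fun z => (b1 z).continuousAt
  have hlim : Tendsto (fun z => v z - B z) atTop (nhds 0) := by
    simpa using hA.top.sub hBtop
  obtain ⟨x, hx⟩ := exists_isMax_of_tails (hA.continuous.sub hBc) (x₀ := z)
    ((eventually_le_atBot Z).mono fun y hy => by
      have := hleft y hy; simp only [Pi.sub_apply]; linarith)
    ((hlim.eventually_lt_const (show 0 < v z - B z by linarith)).mono fun _ h => h.le)
  simp only [Pi.sub_apply] at hx
  obtain ⟨e1, e2⟩ := deriv_conditions_of_isMax (f := fun y => v y - B y)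
    (fun y => (hA.d1 y).sub (b1 y)) ((hA.d2 x).sub (b2 x)) hx
  rw [hA.eq] at e2
  have h1 := hB x
  have e1' : v1 x = B1 x := by linarith
  have hpos : 0 < v x - B x := by linarith [hx z]
  have h2 : v x - B x ≤ g (v (x - c * h)) - g (B (x - c * h)) := by
    rw [e1'] at e2; linarith
  have h3 : B (x - c * h) < v (x - c * h) := by
    by_contra! hle
    linarith [hg.mono.monotone hle]
  have h4 : Z < x - c * h := by
    by_contra! hle
    linarith [hleft _ hle]
  have h5 := hA.le_kap hg (x - c * h)
  have h6 := hright _ h4.le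
  have h7 := hcontr (v (x - c * h)) (B (x - c * h))
    (by rw [abs_le]; constructor <;> linarith) (by rw [abs_le]; constructor <;> linarith)
  rw [abs_of_pos (show 0 < v (x - c * h) - B (x - c * h) by linarith)] at h7
  have h8 := hx (x - c * h)
  have h9 := le_abs_self (g (v (x - c * h)) - g (B (x - c * h)))
  nlinarith

lemma exists_antideriv {y : ℝ → ℝ} (hy : Continuous y) : ∃ V : ℝ → ℝ, ∀ z, HasDerivAt V (y z) z :=
  ⟨fun z => ∫ t in (0:ℝ)..z, y t, fun _ => intervalIntegral.integral_hasDerivAt_right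
    (hy.intervalIntegrable _ _) (hy.stronglyMeasurableAtFilter _ _) hy.continuousAt⟩

lemma growth_dichotomy {y Q Q' : ℝ → ℝ} {d C k0 Z : ℝ} (hd : 0 < d) (hC : 0 < C) (hk0 : 0 < k0)
    (hQ : ∀ z, HasDerivAt Q (Q' z) z) (hQ' : ∀ z ≤ Z, d * y z ≤ Q' z)
    (hQy : ∀ z ≤ Z, |Q z| ≤ C * y z) (hyk : ∀ z, ∀ ξ ∈ Icc (z - 1) z, k0 * y z ≤ y ξ) :
    ∃ d' > 0, (∃ k > 0, ∃ Z', ∀ z ≤ Z', k * Real.exp (-(d' * z)) ≤ y z) ∨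
      (∃ C' > 0, ∀ z ≤ Z, ∀ s ≥ 0, y (z - s) ≤ C' * Real.exp (-(d' * s)) * y z) := by
  have hdC : d / C * C = d := by field_simp
  refine ⟨d / C, by positivity, ?_⟩
  by_cases hneg : ∃ z1 ≤ Z, Q z1 < 0
  · left
    obtain ⟨z1, hz1, hq1⟩ := hneg
    refine ⟨-Q z1 * Real.exp (d / C * z1) / C, by have := Real.exp_pos (d / C * z1); apply div_pos _ hC; nlinarith, z1, fun z hz => ?_⟩
    have h1 := le_of_hasDerivAt_nonneg (f := fun t => Real.exp (d / C * t) * Q t)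
      (f' := fun t => d / C * Real.exp (d / C * t) * Q t + Real.exp (d / C * t) * Q' t) hz
      (fun t _ => (hasDerivAt_exp_mul (d / C) t).mul (hQ t))
      (fun t ht => by
        have h2 := (abs_le.1 (hQy t (ht.2.trans hz1))).1
        have h3 := hQ' t (ht.2.trans hz1)
        have e : d / C * Real.exp (d / C * t) * Q t + Real.exp (d / C * t) * Q' t
          = Real.exp (d / C * t) * (d / C * Q t + Q' t) := by ring
        rw [e]
        refine mul_nonneg (Real.exp_pos _).le ?_
        have : d / C * -(C * y t) ≤ d / C * Q t := mul_le_mul_of_nonneg_left h2 (by positivity)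
        have e2 : d / C * -(C * y t) = -(d * y t) := by field_simp
        linarith)
    have h2 := (abs_le.1 (hQy z (hz.trans hz1))).1
    have h3 := Real.exp_pos (d / C * z)
    rw [Real.exp_neg, div_mul_eq_mul_div, div_le_iff₀ hC, ← div_eq_mul_inv, div_le_iff₀ h3]
    nlinarith
  · right
    push Not at hneg
    refine ⟨C / (d * k0), by positivity, fun z hz s hs => ?_⟩
    have h1 := le_of_hasDerivAt_nonneg (f := fun t => Real.exp (-(d / C) * t) * Q t)
      (f' := fun t => -(d / C) * Real.exp (-(d / C) * t) * Q t + Real.exp (-(d / C) * t) * Q' t)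
      (show z - s - 1 + 1 ≤ z by linarith)
      (fun t _ => (hasDerivAt_exp_mul (-(d / C)) t).mul (hQ t))
      (fun t ht => by
        have h2 := (abs_le.1 (hQy t (ht.2.trans hz))).2
        have h3 := hQ' t (ht.2.trans hz)
        have e : -(d / C) * Real.exp (-(d / C) * t) * Q t + Real.exp (-(d / C) * t) * Q' t
          = Real.exp (-(d / C) * t) * (Q' t - d / C * Q t) := by ring
        rw [e]
        refine mul_nonneg (Real.exp_pos _).le ?_
        have : d / C * Q t ≤ d / C * (C * y t) := mul_le_mul_of_nonneg_left h2 (by positivity)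
        have e2 : d / C * (C * y t) = d * y t := by field_simp
        linarith)
    have h2 := (abs_le.1 (hQy z hz)).2
    have h3 := le_of_hasDerivAt_nonneg (f := fun t => Q t - d * k0 * y (z - s) * t)
      (f' := fun t => Q' t - d * k0 * y (z - s) * 1) (show z - s - 1 ≤ z - s by linarith)
      (fun t _ => (hQ t).sub ((hasDerivAt_id t).const_mul _))
      (fun t ht => by
        have h4 := hQ' t (by linarith [ht.2])
        have h5 := hyk (z - s) t ht
        nlinarith)
    have h4 := hneg (z - s - 1) (by linarith)
    have h5 : d * k0 * y (z - s) ≤ Q (z - s) := by nlinarith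
    have h6 : Real.exp (-(d / C) * (z - s)) * (d * k0 * y (z - s))
        ≤ Real.exp (-(d / C) * z) * (C * y z) := by
      rw [show z - s - 1 + 1 = z - s by ring] at h1
      calc _ ≤ _ := mul_le_mul_of_nonneg_left h5 (Real.exp_pos _).le
        _ ≤ _ := h1
        _ ≤ _ := mul_le_mul_of_nonneg_left h2 (Real.exp_pos _).le
    have e3 : Real.exp (-(d / C) * z) = Real.exp (-(d / C) * (z - s)) * Real.exp (-(d / C * s)) := by
      rw [← Real.exp_add]; ring_nf
    rw [e3, mul_assoc (Real.exp _) (Real.exp _)] at h6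
    have h7 := le_of_mul_le_mul_left h6 (Real.exp_pos _)
    rw [div_mul_eq_mul_div, div_mul_eq_mul_div, le_div_iff₀ (by positivity)]
    nlinarith

/-- Exponential dichotomy for profiles at `-∞` for exponents that are not characteristic values. -/
lemma Profile.dichotomy (hg : MonostableMap g kap g0 L) (hc : 0 ≤ c * h)
    (hv : Profile g h c kap v v1 v2) {ν : ℝ} (hν : chi g0 c h ν ≠ 0) :
    ∃ d > 0, (∃ k > 0, ∃ Z, ∀ z ≤ Z, k * Real.exp ((ν - d) * z) ≤ v z) ∨
      (∃ C > 0, ∃ Z, ∀ z ≤ Z, ∀ s ≥ 0, v (z - s) ≤ C * Real.exp (-((ν + d) * s)) * v z) := by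
  set K := |c| + 1 with hK
  have hKp : 0 < K := by positivity
  set y : ℝ → ℝ := fun z => Real.exp (-ν * z) * v z with hydef
  have hyp : ∀ z, 0 < y z := fun z => mul_pos (Real.exp_pos _) (hv.pos z)
  have hyc : Continuous y := by
    have := hv.continuous; simp only [hydef]; fun_prop
  obtain ⟨V, hV⟩ := exists_antideriv hyc
  set ch := c * h with hch
  set Q : ℝ → ℝ := fun z => Real.exp (-ν * z) * (v1 z + (ν - c) * v z)
    - g0 * Real.exp (-ν * ch) * (V z - V (z - ch)) with hQdef
  have hQ : ∀ z, HasDerivAt Q (Real.exp (-ν * z) * (g0 * v (z - ch) - g (v (z - ch)))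
      - chi g0 c h ν * y z) z := by
    intro z
    have h1 := ((hasDerivAt_exp_mul (-ν) z).mul ((hv.d2 z).add ((hv.d1 z).const_mul (ν - c)))).sub
      (((hV z).sub ((hV (z - ch)).comp_sub_const z ch)).const_mul (g0 * Real.exp (-ν * ch)))
    refine h1.congr_deriv ?_
    rw [hv.eq z]
    simp only [hydef, chi, Pi.add_apply]
    have e1 : Real.exp (-ν * (z - ch)) = Real.exp (-ν * z) * (Real.exp (-ν * ch))⁻¹ := by
      rw [← Real.exp_neg, ← Real.exp_add]; ring_nf
    have e2 : Real.exp (-(ν * c * h)) = Real.exp (-ν * ch) := by rw [hch]; ring_nf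
    rw [e1, e2]
    have := (Real.exp_pos (-ν * ch)).ne'
    field_simp
    ring
  have hyH : ∀ x z, y x ≤ Real.exp ((|ν| + K) * |x - z|) * y z := by
    intro x z
    have h1 := hv.le_exp_mul hg x z
    have h2 : Real.exp (-ν * x) ≤ Real.exp (|ν| * |x - z|) * Real.exp (-ν * z) := by
      rw [← Real.exp_add]
      apply Real.exp_le_exp.2
      have := neg_abs_le (ν * (x - z))
      rw [abs_mul] at this
      linarith
    calc y x ≤ (Real.exp (|ν| * |x - z|) * Real.exp (-ν * z)) *
          (Real.exp (K * |x - z|) * v z) :=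
          mul_le_mul h2 h1 (hv.pos x).le (by positivity)
      _ = _ := by rw [add_mul |ν|, Real.exp_add]; simp only [hydef]; ring
  set R := Real.exp ((|ν| + K) * ch) with hR
  have hR0 : 0 < R := Real.exp_pos _
  have hg0 : 0 < g0 := by linarith [hg.one_lt]
  set C := K + |ν - c| + g0 * Real.exp (-ν * ch) * (R * ch) with hCdef
  have hCp : 0 < C := by positivity
  have hQb : ∀ z, |Q z| ≤ C * y z := by
    intro z
    have h1 : |Real.exp (-ν * z) * (v1 z + (ν - c) * v z)| ≤ (K + |ν - c|) * y z := by
      rw [abs_mul, abs_of_pos (Real.exp_pos _)]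
      have h2 : |v1 z + (ν - c) * v z| ≤ (K + |ν - c|) * v z := by
        calc _ ≤ _ := abs_add_le _ _
          _ ≤ K * v z + |ν - c| * v z := by
            rw [abs_mul, abs_of_pos (hv.pos z)]
            gcongr
            exact hv.abs_deriv_le hg z
          _ = _ := by ring
      calc _ ≤ Real.exp (-ν * z) * ((K + |ν - c|) * v z) := by gcongr
        _ = _ := by simp only [hydef]; ring
    have h3 : V (z - ch) ≤ V z := le_of_hasDerivAt_nonneg (by linarith) (fun t _ => hV t)
      (fun t _ => (hyp t).le)
    have h4 : V z - V (z - ch) ≤ R * ch * y z := by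
      have := le_of_hasDerivAt_nonneg (f := fun t => R * y z * t - V t)
        (f' := fun t => R * y z * 1 - y t) (show z - ch ≤ z by linarith)
        (fun t _ => ((hasDerivAt_id t).const_mul _).sub (hV t))
        (fun t ht => by
          have h5 := hyH t z
          have h6 : Real.exp ((|ν| + K) * |t - z|) ≤ R := by
            apply Real.exp_le_exp.2
            apply mul_le_mul_of_nonneg_left _ (by positivity)
            rw [abs_of_nonpos (by linarith [ht.2])]; linarith [ht.1]
          have := mul_le_mul_of_nonneg_right h6 (hyp z).le
          linarith)
      linarith
    calc |Q z| ≤ _ := abs_sub _ _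
      _ ≤ (K + |ν - c|) * y z + g0 * Real.exp (-ν * ch) * (R * ch * y z) := by
        apply add_le_add h1
        rw [abs_mul, abs_of_nonneg (show 0 ≤ V z - V (z - ch) by linarith),
          abs_of_pos (by positivity)]
        gcongr
      _ = C * y z := by rw [hCdef]; ring
  set X := |chi g0 c h ν| with hX
  have hX0 : 0 < X := abs_pos.2 hν
  obtain ⟨δ, hδ, hlin⟩ := hg.lin_zero (X / (2 * Real.exp (K * ch))) (by positivity)
  have hev : ∀ᶠ z in atBot, v z ≤ δ := (hv.bot.eventually_lt_const hδ).mono fun _ h => h.le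
  obtain ⟨Z, hZ⟩ := eventually_atBot.1 hev
  have hL : ∀ z ≤ Z, Real.exp (-ν * z) * |g0 * v (z - ch) - g (v (z - ch))| ≤ X / 2 * y z := by
    intro z hz
    have h1 := hlin (v (z - ch)) 0 (by rw [abs_of_pos (hv.pos _)]; exact hZ _ (by linarith))
      (by simpa using hδ.le)
    rw [hg.map_zero, sub_zero, sub_zero, abs_of_pos (hv.pos (z - ch)), abs_sub_comm] at h1
    have h2 := hv.le_exp_mul hg (z - ch) z
    rw [show |z - ch - z| = ch by rw [abs_of_nonpos (by linarith)]; ring] at h2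
    have h3 : X / (2 * Real.exp (K * ch)) * v (z - ch) ≤ X / 2 * v z := by
      calc _ ≤ X / (2 * Real.exp (K * ch)) * (Real.exp (K * ch) * v z) := by gcongr
        _ = _ := by field_simp
    calc _ ≤ Real.exp (-ν * z) * (X / 2 * v z) := by gcongr; linarith
      _ = _ := by simp only [hydef]; ring
  have hyk : ∀ z, ∀ ξ ∈ Icc (z - 1) z, Real.exp (-(|ν| + K)) * y z ≤ y ξ := by
    intro z ξ hξ
    have h1 := hyH z ξ
    have h2 : Real.exp ((|ν| + K) * |z - ξ|) ≤ Real.exp (|ν| + K) := by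
      apply Real.exp_le_exp.2
      have : |z - ξ| ≤ 1 := by rw [abs_le]; constructor <;> linarith [hξ.1, hξ.2]
      have h3 : 0 ≤ |ν| + K := by positivity
      nlinarith
    rw [Real.exp_neg, inv_mul_le_iff₀ (Real.exp_pos _)]
    exact h1.trans (mul_le_mul_of_nonneg_right h2 (hyp _).le)
  have key : ∃ d' > 0, (∃ k > 0, ∃ Z', ∀ z ≤ Z', k * Real.exp (-(d' * z)) ≤ y z) ∨
      (∃ C' > 0, ∀ z ≤ Z, ∀ s ≥ 0, y (z - s) ≤ C' * Real.exp (-(d' * s)) * y z) := by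
    rcases lt_or_gt_of_ne hν with hneg | hpos
    · refine growth_dichotomy (Q := Q) (half_pos hX0) hCp (Real.exp_pos (-(|ν| + K))) hQ
        (fun z hz => ?_) (fun z _ => hQb z) hyk
      have h1 := hL z hz
      have h2 := neg_abs_le (Real.exp (-ν * z) * (g0 * v (z - ch) - g (v (z - ch))))
      rw [abs_mul, abs_of_pos (Real.exp_pos _)] at h2
      have h3 : chi g0 c h ν = -X := by rw [hX, abs_of_neg hneg]; ring
      rw [h3]; linarith
    · refine growth_dichotomy (Q := fun z => -Q z) (half_pos hX0) hCp
        (Real.exp_pos (-(|ν| + K))) (fun z => (hQ z).neg)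
        (fun z hz => ?_) (fun z _ => by rw [abs_neg]; exact hQb z) hyk
      have h1 := hL z hz
      have h2 := le_abs_self (Real.exp (-ν * z) * (g0 * v (z - ch) - g (v (z - ch))))
      rw [abs_mul, abs_of_pos (Real.exp_pos _)] at h2
      have h3 : chi g0 c h ν = X := by rw [hX, abs_of_pos hpos]
      rw [h3]; linarith
  obtain ⟨d, hd, h1 | h1⟩ := key
  · refine ⟨d, hd, Or.inl ?_⟩
    obtain ⟨k, hk, Z', h2⟩ := h1
    refine ⟨k, hk, Z', fun z hz => ?_⟩
    have h3 := h2 z hz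
    simp only [hydef] at h3
    have e : Real.exp ((ν - d) * z) = Real.exp (-(d * z)) / Real.exp (-ν * z) := by
      rw [← Real.exp_sub]; ring_nf
    rw [e, ← mul_div_assoc, div_le_iff₀ (Real.exp_pos _)]
    linarith
  · refine ⟨d, hd, Or.inr ?_⟩
    obtain ⟨C', hC', h2⟩ := h1
    refine ⟨C', hC', Z, fun z hz s hs => ?_⟩
    have h3 := h2 z hz s hs
    simp only [hydef] at h3
    have e : Real.exp (-ν * (z - s)) = Real.exp (-ν * z) * Real.exp (ν * s) := by
      rw [← Real.exp_add]; ring_nf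
    have e2 : Real.exp (-((ν + d) * s)) = Real.exp (-(d * s)) * (Real.exp (ν * s))⁻¹ := by
      rw [← Real.exp_neg, ← Real.exp_add]; ring_nf
    rw [e] at h3
    rw [e2]
    have p1 := Real.exp_pos (-ν * z)
    have p2 := Real.exp_pos (ν * s)
    have h4 : Real.exp (-ν * z) * (Real.exp (ν * s) * v (z - s))
        ≤ Real.exp (-ν * z) * (C' * Real.exp (-(d * s)) * v z) := by linarith
    have h5 := le_of_mul_le_mul_left h4 p1
    calc v (z - s) = (Real.exp (ν * s))⁻¹ * (Real.exp (ν * s) * v (z - s)) := by field_simp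
      _ ≤ (Real.exp (ν * s))⁻¹ * (C' * Real.exp (-(d * s)) * v z) := by gcongr
      _ = _ := by ring

end Profile

section Profile
variable {g : ℝ → ℝ} {h c kap g0 L : ℝ} {v v1 v2 : ℝ → ℝ}

lemma exists_exp_neg_mul_le {d ε : ℝ} (C : ℝ) (hd : 0 < d) (hε : 0 < ε) :
    ∃ S > 0, ∀ s ≥ S, C * Real.exp (-(d * s)) ≤ ε := by
  have h1 : Tendsto (fun s : ℝ => C * Real.exp (-(d * s))) atTop (nhds (C * 0)) :=
    (Real.tendsto_exp_neg_atTop_nhds_zero.comp (tendsto_id.const_mul_atTop hd)).const_mul C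
  rw [mul_zero] at h1
  obtain ⟨S, hS⟩ := eventually_atTop.1 (h1.eventually_lt_const hε)
  exact ⟨max S 1, by positivity, fun s hs => (hS s (le_of_max_le_left hs)).le⟩

lemma Profile.decay (hg : MonostableMap g kap g0 L) (hc : 0 ≤ c * h)
    (hv : Profile g h c kap v v1 v2) :
    ∃ d > 0, ∃ C > 0, ∃ Z, ∀ z ≤ Z, ∀ s ≥ 0, v (z - s) ≤ C * Real.exp (-(d * s)) * v z := by
  have hchi : chi g0 c h 0 ≠ 0 := by simp only [chi]; norm_num; linarith [hg.one_lt]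
  obtain ⟨d, hd, ⟨k, hk, Z, h1⟩ | ⟨C, hC, Z, h1⟩⟩ := hv.dichotomy hg hc hchi
  · exfalso
    obtain ⟨z, hz1, hz2, hz3⟩ := ((hv.bot.eventually_lt_const hk).and
      ((eventually_le_atBot Z).and (eventually_le_atBot 0))).exists
    have h2 := h1 z hz2
    have h3 : 1 ≤ Real.exp ((0 - d) * z) := Real.one_le_exp (by nlinarith)
    nlinarith
  · exact ⟨d, hd, C, hC, Z, fun z hz s hs => by simpa using h1 z hz s hs⟩

lemma Profile.exists_lower (hg : MonostableMap g kap g0 L) (hv : Profile g h c kap v v1 v2)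
    (Z : ℝ) : ∃ m > 0, ∀ z ≥ Z, m ≤ v z := by
  obtain ⟨Z2, hZ2⟩ := eventually_atTop.1 (hv.top.eventually_const_lt (half_lt_self hg.kap_pos))
  obtain ⟨x, -, hx⟩ := isCompact_Icc.exists_isMinOn (nonempty_Icc.2 (le_max_left Z Z2))
    hv.continuous.continuousOn
  refine ⟨min (v x) (kap / 2), lt_min (hv.pos x) (half_pos hg.kap_pos), fun z hz => ?_⟩
  rcases le_total z (max Z Z2) with h1 | h1
  · exact (min_le_left _ _).trans (hx ⟨hz, h1⟩)
  · exact (min_le_right _ _).trans (hZ2 z ((le_max_right _ _).trans h1)).le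

lemma Profile.increment_harnack (hg : MonostableMap g kap g0 L) (hv : Profile g h c kap v v1 v2)
    {b : ℝ} (hD : ∀ z, v z ≤ v (z + b)) (x y : ℝ) :
    v (x + b) - v x ≤ Real.exp ((|c| + 1) * |x - y|) * (v (y + b) - v y) := by
  have hb := hv.shift b
  have e1 : ∀ z, HasDerivAt (fun z => v (z + b) - v z) (v1 (z + b) - v1 z) z :=
    fun z => (hb.d1 z).sub (hv.d1 z)
  have e2 : ∀ z, HasDerivAt (fun z => v1 (z + b) - v1 z) (v2 (z + b) - v2 z) z :=
    fun z => (hb.d2 z).sub (hv.d2 z)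
  refine le_exp_mul_of_abs_deriv_le (v := fun z => v (z + b) - v z) e1
    (abs_deriv_le_of_nonneg_supersol e1 e2 (fun z => sub_nonneg.2 (hD z)) fun z => ?_) x y
  have h1 := hb.eq z
  have h2 := hv.eq z
  have h3 := hg.mono.monotone (hD (z - c * h))
  linarith

lemma Profile.increment_ge (hg : MonostableMap g kap g0 L) (hc : 0 ≤ c * h)
    (hv : Profile g h c kap v v1 v2) {b : ℝ} (hb : 0 < b) (hD : ∀ z, v z ≤ v (z + b)) :
    ∃ k > 0, ∃ Z, ∀ z ≤ Z, (1 + k) * v z ≤ v (z + b) := by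
  obtain ⟨d, hd, C, hC, Z, hdec⟩ := hv.decay hg hc
  obtain ⟨S, hS, hS2⟩ := exists_exp_neg_mul_le C hd one_half_pos
  obtain ⟨N, hN⟩ := exists_nat_gt (S / b)
  rw [div_lt_iff₀ hb] at hN
  set E := Real.exp ((|c| + 1) * (N * b)) with hE
  have hEp : 0 < E := Real.exp_pos _
  have hN0 : (0:ℝ) < N := by
    by_contra! hle
    have := mul_nonpos_of_nonpos_of_nonneg hle hb.le
    linarith
  have hsum : ∀ z, ∀ n : ℕ, n ≤ N → v z - v (z - n * b) ≤ n * (E * (v (z + b) - v z)) := by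
    intro z n
    induction n with
    | zero => simp
    | succ n ih =>
      intro hn
      have h1 := ih (by omega)
      have h2 := hv.increment_harnack hg hD (z - (n + 1) * b) z
      have h3 : Real.exp ((|c| + 1) * |z - (n + 1) * b - z|) ≤ E := by
        apply Real.exp_le_exp.2
        apply mul_le_mul_of_nonneg_left _ (by positivity)
        have h4 : ((n:ℝ) + 1) ≤ N := by exact_mod_cast hn
        rw [abs_of_nonpos (by nlinarith [show (0:ℝ) ≤ n from Nat.cast_nonneg n])]
        nlinarith
      have h5 := mul_le_mul_of_nonneg_right h3 (sub_nonneg.2 (hD z))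
      rw [show z - (n + 1) * b + b = z - n * b by ring] at h2
      push_cast
      linarith
  refine ⟨1 / (2 * (N * E)), by positivity, Z, fun z hz => ?_⟩
  have h1 := hsum z N le_rfl
  have h2 := hdec z hz (N * b) (by positivity)
  have h3 := mul_le_mul_of_nonneg_right (hS2 (N * b) hN.le) (hv.pos z).le
  have h4 : v z / 2 ≤ N * E * (v (z + b) - v z) := by linarith
  have h5 : 1 / (2 * (N * E)) * v z ≤ v (z + b) - v z := by
    rw [div_mul_eq_mul_div, div_le_iff₀ (by positivity)]
    linarith
  linarith

lemma Profile.lt_add_of_le (hg : MonostableMap g kap g0 L) (hc : 0 ≤ c * h)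
    (hv : Profile g h c kap v v1 v2) {b : ℝ} (hb : 0 < b) (hD : ∀ z, v z ≤ v (z + b)) (z : ℝ) :
    v z < v (z + b) := by
  obtain ⟨k, hk, Z, hZ⟩ := hv.increment_ge hg hc hb hD
  have h1 := hv.increment_harnack hg hD Z z
  have h2 := hZ Z le_rfl
  have h3 := mul_pos hk (hv.pos Z)
  have h4 : 0 < Real.exp ((|c| + 1) * |Z - z|) * (v (z + b) - v z) := by linarith
  have := (mul_pos_iff_of_pos_left (Real.exp_pos _)).1 h4
  linarith

lemma Profile.exists_shift_le (hg : MonostableMap g kap g0 L) (hc : 0 ≤ c * h)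
    (hv : Profile g h c kap v v1 v2) : ∃ b₀ > 0, ∀ b ≥ b₀, ∀ z, v z ≤ v (z + b) := by
  obtain ⟨ρ, δ, -, hρ, hδ, hcontr⟩ := hg.contr_kap
  obtain ⟨Z1, hZ1⟩ := eventually_atTop.1 (hv.top.eventually_const_lt
    (show kap - δ < kap by linarith))
  obtain ⟨d, hd, C, hC, Z, hdec⟩ := hv.decay hg hc
  obtain ⟨m, hm, hmv⟩ := hv.exists_lower hg Z
  obtain ⟨Z0, hZ0⟩ := eventually_atBot.1 (hv.bot.eventually_lt_const hm)
  obtain ⟨S, hS, hS2⟩ := exists_exp_neg_mul_le C hd one_pos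
  refine ⟨max S (Z1 - Z0), by positivity, fun b hb => ?_⟩
  have hb1 := le_of_max_le_left hb
  have hb2 := le_of_max_le_right hb
  have hs := hv.shift b
  refine hv.le_of_le_left hg hs.d1 hs.d2 (fun z => ?_) hs.top hρ hcontr
    (Z := Z0) (fun z hz => ?_) (fun z hz => (hZ1 _ (by linarith)).le)
  · have := hs.eq z
    linarith
  · rcases le_total (z + b) Z with h1 | h1
    · have h2 := hdec (z + b) h1 b (by linarith)
      rw [add_sub_cancel_right] at h2
      have h3 := mul_le_mul_of_nonneg_right (hS2 b hb1) (hv.pos (z + b)).le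
      linarith
    · exact (hZ0 z hz).le.trans (hmv _ h1)

lemma Profile.le_add (hg : MonostableMap g kap g0 L) (hc : 0 ≤ c * h)
    (hv : Profile g h c kap v v1 v2) {b : ℝ} (hb : 0 < b) (z : ℝ) : v z ≤ v (z + b) := by
  set S : Set ℝ := {b | 0 ≤ b ∧ ∀ b' ≥ b, ∀ z, v z ≤ v (z + b')} with hS
  obtain ⟨b₀, hb₀, hb₀'⟩ := hv.exists_shift_le hg hc
  have hSne : S.Nonempty := ⟨b₀, hb₀.le, hb₀'⟩
  have hSbd : BddBelow S := ⟨0, fun b hb => hb.1⟩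
  set bs := sInf S with hbs
  have hbs0 : 0 ≤ bs := le_csInf hSne fun b hb => hb.1
  have hgt : ∀ b' > bs, ∀ z, v z ≤ v (z + b') := by
    intro b' hb' z
    obtain ⟨b, hbS, hlt⟩ := (csInf_lt_iff hSbd hSne).1 hb'
    exact hbS.2 b' hlt.le z
  by_contra! hlt
  have hbsb : b ≤ bs := by
    by_contra! h1
    exact absurd (hgt b h1 z) (not_le.2 hlt)
  have hbspos : 0 < bs := hb.trans_le hbsb
  have hle : ∀ z, v z ≤ v (z + bs) := by
    intro z
    have h1 : Tendsto (fun b => v (z + b)) (nhdsWithin bs (Ioi bs)) (nhds (v (z + bs))) := by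
      have : Continuous fun b => v (z + b) := hv.continuous.comp (continuous_const.add continuous_id)
      exact this.continuousAt.tendsto.mono_left nhdsWithin_le_nhds
    exact ge_of_tendsto h1 (eventually_nhdsWithin_of_forall fun b hb => hgt b hb z)
  obtain ⟨k, hk, Z, hZ⟩ := hv.increment_ge hg hc hbspos hle
  obtain ⟨ρ, δ, -, hρ, hδ, hcontr⟩ := hg.contr_kap
  obtain ⟨Z1, hZ1⟩ := eventually_atTop.1 (hv.top.eventually_const_lt
    (show kap - δ < kap by linarith))
  have hcont : Continuous fun z => v (z + bs) - v z := (hv.shift bs).continuous.sub hv.continuous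
  obtain ⟨x, -, hx⟩ := isCompact_Icc.exists_isMinOn (nonempty_Icc.2 (le_max_left Z Z1))
    hcont.continuousOn
  set θ := v (x + bs) - v x with hθ
  have hθp : 0 < θ := sub_pos.2 (hv.lt_add_of_le hg hc hbspos hle x)
  set r := min k (θ / kap) with hr
  have hrp : 0 < r := lt_min hk (div_pos hθp hg.kap_pos)
  set K := |c| + 1
  have hK : 0 < K := by positivity
  set σ := min bs (Real.log (1 + r) / K) with hσ
  have hσp : 0 < σ := lt_min hbspos (div_pos (Real.log_pos (by linarith)) hK)
  have hσE : Real.exp (K * σ) ≤ 1 + r := by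
    have h1 : K * σ ≤ Real.log (1 + r) := by
      have := min_le_right bs (Real.log (1 + r) / K)
      rw [← hσ, le_div_iff₀ hK] at this
      linarith
    calc _ ≤ Real.exp (Real.log (1 + r)) := Real.exp_le_exp.2 h1
      _ = _ := Real.exp_log (by linarith)
  have hmem : bs - σ ∈ S := by
    refine ⟨by linarith [min_le_left bs (Real.log (1 + r) / K)], fun b' hb' => ?_⟩
    rcases lt_or_ge bs b' with h1 | h1
    · exact hgt b' h1
    have hs := hv.shift b'
    have hb'0 : 0 ≤ b' := by linarith [min_le_left bs (Real.log (1 + r) / K)]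
    refine hv.le_of_le_left hg hs.d1 hs.d2 (fun z => ?_) hs.top hρ hcontr
      (Z := max Z Z1) (fun z hz => ?_)
      (fun z hz => (hZ1 _ (by linarith [le_of_max_le_right hz])).le)
    · have := hs.eq z
      linarith
    · have h2 := hv.le_exp_mul hg (z + bs) (z + b')
      have h3 : Real.exp (K * |z + bs - (z + b')|) ≤ 1 + r := by
        refine le_trans (Real.exp_le_exp.2 ?_) hσE
        apply mul_le_mul_of_nonneg_left _ hK.le
        rw [abs_le]; constructor <;> linarith
      have h4 : v (z + bs) ≤ (1 + r) * v (z + b') :=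
        h2.trans (mul_le_mul_of_nonneg_right h3 (hv.pos _).le)
      have h5 : (1 + r) * v z ≤ v (z + bs) := by
        rcases le_total z Z with h6 | h6
        · refine le_trans ?_ (hZ z h6)
          exact mul_le_mul_of_nonneg_right (by linarith [min_le_left k (θ / kap)]) (hv.pos z).le
        · have h7 : θ ≤ v (z + bs) - v z := hx ⟨h6, hz⟩
          have h8 : r * v z ≤ θ := by
            calc r * v z ≤ θ / kap * kap :=
                  mul_le_mul (min_le_right _ _) (hv.le_kap hg z) (hv.pos z).le
                    (div_pos hθp hg.kap_pos).le
              _ = θ := div_mul_cancel₀ _ hg.kap_pos.ne'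
          linarith
      exact le_of_mul_le_mul_left (h5.trans h4) (by linarith)
  have := csInf_le hSbd hmem
  linarith

lemma Profile.strictMono (hg : MonostableMap g kap g0 L) (hc : 0 ≤ c * h)
    (hv : Profile g h c kap v v1 v2) : StrictMono v := by
  intro x y hxy
  have := hv.lt_add_of_le hg hc (sub_pos.2 hxy) (hv.le_add hg hc (sub_pos.2 hxy)) x
  rwa [add_sub_cancel] at this

lemma Profile.lt_kap (hg : MonostableMap g kap g0 L) (hc : 0 ≤ c * h)
    (hv : Profile g h c kap v v1 v2) (z : ℝ) : v z < kap :=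
  (hv.strictMono hg hc (lt_add_one z)).trans_le (hv.le_kap hg _)

lemma Profile.deriv_pos (hg : MonostableMap g kap g0 L) (hc : 0 ≤ c * h)
    (hv : Profile g h c kap v v1 v2) (z : ℝ) : 0 < v1 z := by
  have hmono := hv.strictMono hg hc
  by_contra! hz
  have hle : ∀ x, v1 x ≤ 0 := by
    intro x
    set E := Real.exp ((|c| + 1) * |x - z|)
    have hw : Monotone fun b => E * v (b + z) - v (b + x) := by
      intro b b' hbb
      rcases hbb.eq_or_lt with h1 | h1
      · rw [h1]
      have h2 := hv.increment_harnack hg (hv.le_add hg hc (sub_pos.2 h1)) (b + x) (b + z)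
      rw [show b + x - (b + z) = x - z by ring, show b + x + (b' - b) = b' + x by ring,
        show b + z + (b' - b) = b' + z by ring] at h2
      simp only
      linarith
    have hd : HasDerivAt (fun b => E * v (b + z) - v (b + x)) (E * v1 z - v1 x) 0 := by
      have h1 := (hv.d1 (0 + z)).comp_add_const 0 z
      have h2 := (hv.d1 (0 + x)).comp_add_const 0 x
      rw [zero_add] at h1 h2
      exact (h1.const_mul E).sub h2
    have h3 := hw.deriv_nonneg (x := 0)
    rw [hd.deriv] at h3
    have : E * v1 z ≤ 0 := mul_nonpos_of_nonneg_of_nonpos (Real.exp_pos _).le hz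
    linarith
  have := antitone_of_hasDerivAt_nonpos hv.d1 hle
  exact absurd (this (zero_le_one' ℝ)) (not_le.2 (hmono zero_lt_one))

end Profile

section Profile
variable {g : ℝ → ℝ} {h c kap g0 L : ℝ} {v v1 v2 : ℝ → ℝ}

lemma Profile.abs_sub_le (hg : MonostableMap g kap g0 L) (hv : Profile g h c kap v v1 v2)
    (x y : ℝ) : |v x - v y| ≤ (|c| + 1) * kap * |x - y| := by
  have := Convex.norm_image_sub_le_of_norm_hasDerivWithin_le (f := v) (f' := v1)
    (C := (|c| + 1) * kap) (s := univ) (x := y) (y := x)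
    (fun z _ => (hv.d1 z).hasDerivWithinAt) (fun z _ => by
      rw [Real.norm_eq_abs]
      refine (hv.abs_deriv_le hg z).trans ?_
      gcongr
      exact hv.le_kap hg z) convex_univ (mem_univ _) (mem_univ _)
  simpa [Real.norm_eq_abs] using this

/-- Wavefronts do not have negative speed. -/
lemma Profile.speed_nonneg (hg : MonostableMap g kap g0 L) (hh : 0 < h)
    (hv : Profile g h c kap v v1 v2) : 0 ≤ c := by
  by_contra! hc
  have hch : c * h ≤ 0 := by nlinarith
  have hgc : Continuous fun z => g (v z) := hg.continuous.comp hv.continuous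
  obtain ⟨G, hG⟩ := exists_antideriv hgc
  have hgp : ∀ z, 0 < g (v z) := fun z => hg.pos_of_pos (hv.pos z)
  set J : ℝ → ℝ := fun z => c * v z - v1 z + (G z - G (z - c * h)) with hJ
  have hJd : ∀ z, HasDerivAt J (g (v z) - v z) z := by
    intro z
    refine ((((hv.d1 z).const_mul c).sub (hv.d2 z)).add
      ((hG z).sub ((hG (z - c * h)).comp_sub_const z (c * h)))).congr_deriv ?_
    rw [hv.eq z]; ring
  have hJ0 : ∀ z, 0 ≤ g (v z) - v z := by
    intro z
    rcases (hv.le_kap hg z).eq_or_lt with h1 | h1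
    · rw [h1, hg.map_kap, sub_self]
    · linarith [hg.lt_map _ (hv.pos z) h1]
  have hJmono : Monotone J := monotone_of_hasDerivAt_nonneg hJd hJ0
  have hGmono : Monotone G := monotone_of_hasDerivAt_nonneg hG fun z => (hgp z).le
  set K := |c| + 1 with hK
  set R := L * Real.exp (K * -(c * h)) with hR
  have hGle : ∀ z, G (z - c * h) - G z ≤ R * -(c * h) * v z := by
    intro z
    have := le_of_hasDerivAt_nonneg (f := fun t => R * v z * t - G t)
      (f' := fun t => R * v z * 1 - g (v t)) (show z ≤ z - c * h by linarith)
      (fun t _ => ((hasDerivAt_id t).const_mul _).sub (hG t))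
      (fun t ht => by
        have h1 := hv.le_exp_mul hg t z
        have h2 : Real.exp (K * |t - z|) ≤ Real.exp (K * -(c * h)) := by
          apply Real.exp_le_exp.2
          apply mul_le_mul_of_nonneg_left _ (by positivity)
          rw [abs_of_nonneg (by linarith [ht.1])]; linarith [ht.2]
        have h3 := hg.lip (v t) 0
        rw [hg.map_zero, sub_zero, sub_zero, abs_of_pos (hgp t), abs_of_pos (hv.pos t)] at h3
        have h4 : g (v t) ≤ L * (Real.exp (K * -(c * h)) * v z) :=
          h3.trans (mul_le_mul_of_nonneg_left
            (h1.trans (mul_le_mul_of_nonneg_right h2 (hv.pos z).le)) hg.lip_pos.le)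
        rw [hR]; linarith)
    linarith
  have hlow : ∀ z, -((|c| + K + R * -(c * h)) * v z) ≤ J z := by
    intro z
    have h1 := hGle z
    have h2 := (abs_le.1 (hv.abs_deriv_le hg z)).2
    have h3 := mul_le_mul_of_nonneg_right (neg_abs_le c) (hv.pos z).le
    simp only [hJ]
    linarith
  have hJnn : ∀ z, 0 ≤ J z := by
    intro z
    have h1 : Tendsto (fun y => -((|c| + K + R * -(c * h)) * v y)) atBot (nhds 0) := by
      simpa using (hv.bot.const_mul (|c| + K + R * -(c * h))).neg
    exact le_of_tendsto h1 ((eventually_le_atBot z).mono fun y hy => (hlow y).trans (hJmono hy))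
  obtain ⟨z0, hz0⟩ := eventually_atBot.1 (hv.bot.eventually_lt_const hg.kap_pos)
  have hJpos : 0 < J z0 := by
    obtain ⟨ξ, hξ, hξe⟩ := exists_hasDerivAt_eq_slope J (fun z => g (v z) - v z)
      (show z0 - 1 < z0 by linarith) (fun z _ => (hJd z).continuousAt.continuousWithinAt)
      (fun z _ => hJd z)
    have h1 := hg.lt_map _ (hv.pos ξ) (hz0 ξ hξ.2.le)
    rw [show z0 - (z0 - 1) = 1 by ring, div_one] at hξe
    linarith [hJnn (z0 - 1)]
  have hd : ∀ z ≥ z0, v1 z ≤ -J z0 := by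
    intro z hz
    have h1 := hJmono hz
    have h2 : G z ≤ G (z - c * h) := hGmono (by linarith)
    have h3 := mul_neg_of_neg_of_pos hc (hv.pos z)
    simp only [hJ] at h1 ⊢
    linarith
  have hz1 : z0 ≤ z0 + v z0 / J z0 := by
    have := div_pos (hv.pos z0) hJpos; linarith
  have := le_of_hasDerivAt_nonneg (f := fun t => -J z0 * t - v t)
    (f' := fun t => -J z0 * 1 - v1 t) hz1
    (fun t _ => ((hasDerivAt_id t).const_mul _).sub (hv.d1 t))
    (fun t ht => by linarith [hd t ht.1])
  have h3 := hv.pos (z0 + v z0 / J z0)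
  have h4 : J z0 * (v z0 / J z0) = v z0 := by field_simp
  linarith

lemma chi_convex (hg0 : 0 ≤ g0) {a b s t : ℝ} (hs : 0 ≤ s) (ht : 0 ≤ t) (hst : s + t = 1) :
    chi g0 c h (s * a + t * b) ≤ s * chi g0 c h a + t * chi g0 c h b - s * t * (a - b) ^ 2 := by
  have h1 := convexOn_exp.2 (mem_univ (-(a * c * h))) (mem_univ (-(b * c * h))) hs ht hst
  simp only [smul_eq_mul] at h1
  rw [show s * -(a * c * h) + t * -(b * c * h) = -((s * a + t * b) * c * h) by ring] at h1
  have h2 := mul_le_mul_of_nonneg_left h1 hg0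
  simp only [chi]
  obtain rfl : t = 1 - s := by linarith
  nlinarith

lemma chi_neg_of_mem_Ioo (hg0 : 0 ≤ g0) {a b x : ℝ} (ha : chi g0 c h a = 0)
    (hb : chi g0 c h b = 0) (hx : x ∈ Ioo a b) : chi g0 c h x < 0 := by
  have hab : 0 < b - a := by linarith [hx.1, hx.2]
  have hs : 0 < (b - x) / (b - a) := div_pos (by linarith [hx.2]) hab
  have ht : 0 < (x - a) / (b - a) := div_pos (by linarith [hx.1]) hab
  have h1 := chi_convex (c := c) (h := h) hg0 (a := a) (b := b) hs.le ht.le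
    (by field_simp; ring)
  rw [ha, hb, show (b - x) / (b - a) * a + (x - a) / (b - a) * b = x by field_simp; ring] at h1
  have h2 : 0 < (b - x) / (b - a) * ((x - a) / (b - a)) * (a - b) ^ 2 :=
    mul_pos (mul_pos hs ht) (by nlinarith)
  linarith

lemma chi_pos_of_gt (hg0 : 0 ≤ g0) {a b x : ℝ} (hab : a < b) (ha : chi g0 c h a = 0)
    (hb : chi g0 c h b = 0) (hx : b < x) : 0 < chi g0 c h x := by
  have hax : 0 < x - a := by linarith
  have hs : 0 < (x - b) / (x - a) := div_pos (by linarith) hax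
  have ht : 0 < (b - a) / (x - a) := div_pos (by linarith) hax
  have h1 := chi_convex (c := c) (h := h) hg0 (a := a) (b := x) hs.le ht.le
    (by field_simp; ring)
  rw [ha, show (x - b) / (x - a) * a + (b - a) / (x - a) * x = b by field_simp; ring, hb] at h1
  have h2 : 0 < (x - b) / (x - a) * ((b - a) / (x - a)) * (a - x) ^ 2 :=
    mul_pos (mul_pos hs ht) (by nlinarith)
  have h3 : 0 < (b - a) / (x - a) * chi g0 c h x := by linarith
  exact (mul_pos_iff_of_pos_left ht).1 h3

lemma chi_lt_of_speed_lt (hg0 : 0 ≤ g0) (hh : 0 < h) {c' x : ℝ} (hx : 0 < x) (hc : c' < c) :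
    chi g0 c h x < chi g0 c' h x := by
  have h1 : Real.exp (-(x * c * h)) ≤ Real.exp (-(x * c' * h)) := by
    apply Real.exp_le_exp.2
    have := mul_pos (mul_pos hx hh) (sub_pos.2 hc)
    nlinarith
  have h2 := mul_le_mul_of_nonneg_left h1 hg0
  simp only [chi]
  nlinarith

lemma continuous_chi : Continuous (chi g0 c h) := by
  unfold chi; fun_prop

/-- If `v` has exponential order `a` at `-∞` then it has every larger order that can be reached
without crossing a characteristic value. -/
lemma Profile.exp_bound_climb (hg : MonostableMap g kap g0 L) (hc : 0 ≤ c * h)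
    (hv : Profile g h c kap v v1 v2) {a b : ℝ} (hab : a ≤ b)
    (hchi : ∀ ν ∈ Icc a b, chi g0 c h ν ≠ 0)
    (ha : ∃ C Z, ∀ z ≤ Z, v z ≤ C * Real.exp (a * z)) :
    ∃ C Z, ∀ z ≤ Z, v z ≤ C * Real.exp (b * z) := by
  set S : Set ℝ := {ν | ν ∈ Icc a b ∧ ∃ C Z, ∀ z ≤ Z, v z ≤ C * Real.exp (ν * z)} with hS
  have haS : a ∈ S := ⟨left_mem_Icc.2 hab, ha⟩
  have hbd : BddAbove S := ⟨b, fun ν hν => hν.1.2⟩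
  set s := sSup S with hs
  have hsI : s ∈ Icc a b := ⟨le_csSup hbd haS, csSup_le ⟨a, haS⟩ fun ν hν => hν.1.2⟩
  obtain ⟨d, hd, ⟨k, hk, Z, h1⟩ | ⟨C, hC, Z, h1⟩⟩ := hv.dichotomy hg hc (hchi s hsI)
  · exfalso
    obtain ⟨ν, hνS, hν⟩ := exists_lt_of_lt_csSup ⟨a, haS⟩ (show s - d < s by linarith)
    obtain ⟨-, C, Z', h2⟩ := hνS
    obtain ⟨S', hS', h3⟩ := exists_exp_neg_mul_le C (show 0 < ν - (s - d) by linarith) (half_pos hk)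
    set z := min (-S') (min Z Z') with hz
    have h4 := h1 z ((min_le_right _ _).trans (min_le_left _ _))
    have h5 := h2 z ((min_le_right _ _).trans (min_le_right _ _))
    have h6 := h3 (-z) (by linarith [min_le_left (-S') (min Z Z')])
    have e : Real.exp (ν * z) = Real.exp (-((ν - (s - d)) * -z)) * Real.exp ((s - d) * z) := by
      rw [← Real.exp_add]; ring_nf
    rw [e] at h5
    have h7 := Real.exp_pos ((s - d) * z)
    have h8 := mul_le_mul_of_nonneg_right h6 h7.le
    nlinarith
  · have hor : ∃ C Z, ∀ z ≤ Z, v z ≤ C * Real.exp ((s + d) * z) := by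
      refine ⟨C * v Z * Real.exp (-((s + d) * Z)), Z, fun z hz => ?_⟩
      have h2 := h1 Z le_rfl (Z - z) (by linarith)
      rw [sub_sub_cancel] at h2
      refine h2.trans (le_of_eq ?_)
      rw [mul_assoc (C * v Z), ← Real.exp_add]
      ring_nf
    have hdown : ∀ ν ≤ s + d, ∃ C Z, ∀ z ≤ Z, v z ≤ C * Real.exp (ν * z) := by
      intro ν hν
      obtain ⟨C, Z, h2⟩ := hor
      refine ⟨|C|, min Z 0, fun z hz => ?_⟩
      calc v z ≤ _ := h2 z (hz.trans (min_le_left _ _))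
        _ ≤ |C| * Real.exp ((s + d) * z) :=
          mul_le_mul_of_nonneg_right (le_abs_self _) (Real.exp_pos _).le
        _ ≤ _ := by
          gcongr |C| * ?_
          apply Real.exp_le_exp.2
          nlinarith [hz.trans (min_le_right _ _)]
    rcases le_total b (s + d) with h2 | h2
    · exact hdown b h2
    · have : s + d ∈ S := ⟨⟨by linarith [hsI.1], h2⟩, hor⟩
      linarith [le_csSup hbd this]

/-- A wavefront with supercritical speed is not of fast exponential decay. -/
lemma Profile.exp_lower_bound (hg : MonostableMap g kap g0 L) (hh : 0 < h) (hc : 0 < c)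
    {lam1 lam2 : ℝ} (hlam1 : 0 < lam1) (hlam : lam1 < lam2) (hchi1 : chi g0 c h lam1 = 0)
    (hchi2 : chi g0 c h lam2 = 0)
    (hv : Profile g h c kap v v1 v2) {c' : ℝ} (hc' : c' < c) {w w1 w2 : ℝ → ℝ}
    (hw : Profile g h c' kap w w1 w2) {μ : ℝ} (hμ : μ ∈ Ioo lam1 lam2) :
    ∃ k > 0, ∃ Z, ∀ z ≤ Z, k * Real.exp (μ * z) ≤ v z := by
  have hg0 : 0 ≤ g0 := by linarith [hg.one_lt]
  have hch : 0 ≤ c * h := by positivity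
  have hc'0 := hw.speed_nonneg hg hh
  have hc'h : 0 ≤ c' * h := by positivity
  have hdown : ∀ {f : ℝ → ℝ} {ν d : ℝ}, 0 < d →
      (∃ k > 0, ∃ Z, ∀ z ≤ Z, k * Real.exp ((ν - d) * z) ≤ f z) →
      ∃ k > 0, ∃ Z, ∀ z ≤ Z, k * Real.exp (ν * z) ≤ f z := by
    rintro f ν d hd ⟨k, hk, Z, h1⟩
    refine ⟨k, hk, min Z 0, fun z hz => le_trans ?_ (h1 z (hz.trans (min_le_left _ _)))⟩
    gcongr k * ?_
    apply Real.exp_le_exp.2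
    nlinarith [hz.trans (min_le_right _ _)]
  have hup : ∀ {f : ℝ → ℝ} {ν d : ℝ}, 0 < d → (∀ z, 0 < f z) →
      (∃ C > 0, ∃ Z, ∀ z ≤ Z, ∀ s ≥ 0, f (z - s) ≤ C * Real.exp (-((ν + d) * s)) * f z) →
      ∃ C Z, ∀ z ≤ Z, f z ≤ C * Real.exp (ν * z) := by
    rintro f ν d hd hf ⟨C, hC, Z, h1⟩
    refine ⟨C * f Z * Real.exp (-(ν * Z)), Z, fun z hz => ?_⟩
    have h2 := h1 Z le_rfl (Z - z) (by linarith)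
    rw [sub_sub_cancel] at h2
    have h3 : Real.exp (-((ν + d) * (Z - z))) ≤ Real.exp (-(ν * (Z - z))) := by
      apply Real.exp_le_exp.2; nlinarith
    have h4 := hf Z
    calc f z ≤ _ := h2
      _ ≤ C * Real.exp (-(ν * (Z - z))) * f Z := by gcongr
      _ = _ := by
        rw [mul_assoc (C * f Z), ← Real.exp_add]
        ring_nf
  obtain ⟨d, hd, h1 | h1⟩ := hv.dichotomy hg hch (chi_neg_of_mem_Ioo hg0 hchi1 hchi2 hμ).ne
  · exact hdown hd h1
  exfalso
  have hvμ := hup hd hv.pos h1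
  have hchi2' : 0 < chi g0 c' h lam2 :=
    hchi2 ▸ chi_lt_of_speed_lt hg0 hh (hlam1.trans hlam) hc'
  obtain ⟨ν0, hν0, hν0'⟩ : ∃ ν0 ∈ Ioo lam1 lam2, ∀ ν ≥ ν0, 0 < chi g0 c' h ν := by
    have h2 : ∀ᶠ x in nhds lam2, 0 < chi g0 c' h x :=
      continuous_chi.continuousAt.eventually_const_lt hchi2'
    obtain ⟨r, hr, h3⟩ := Metric.eventually_nhds_iff.1 h2
    refine ⟨max (lam2 - r / 2) ((lam1 + lam2) / 2),
      ⟨lt_of_lt_of_le (by linarith) (le_max_right _ _), max_lt (by linarith) (by linarith)⟩,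
      fun ν hν => ?_⟩
    rcases le_or_gt ν lam2 with h4 | h4
    · apply h3
      have := (le_max_left _ _).trans hν
      rw [Real.dist_eq, abs_lt]; constructor <;> linarith
    · exact (chi_pos_of_gt hg0 hlam hchi1 hchi2 h4).trans
        (chi_lt_of_speed_lt hg0 hh (by linarith) hc')
  -- lower bound for the slower front
  obtain ⟨k, hk, Zw, hwlow⟩ : ∃ k > 0, ∃ Z, ∀ z ≤ Z, k * Real.exp (ν0 * z) ≤ w z := by
    obtain ⟨d', hd', h2 | h2⟩ := hw.dichotomy hg hc'h (hν0' ν0 le_rfl).ne'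
    · exact hdown hd' h2
    exfalso
    set K := |c'| + 1 with hK
    obtain ⟨C, Z, h3⟩ := hw.exp_bound_climb hg hc'h (le_max_left ν0 (K + 1))
      (fun ν hν => (hν0' ν hν.1).ne') (hup hd' hw.pos h2)
    set b := max ν0 (K + 1) with hb
    have hbK : 0 < b - K := by linarith [le_max_right ν0 (K + 1)]
    obtain ⟨S', hS', h4⟩ := exists_exp_neg_mul_le C hbK (half_pos (hw.pos 0))
    set z := min (-S') Z
    have hzS : z ≤ -S' := min_le_left _ _
    have h5 := h3 z (min_le_right _ _)
    have h6 := h4 (-z) (by linarith)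
    have h7 := hw.le_exp_mul hg 0 z
    rw [show |0 - z| = -z by rw [zero_sub, abs_of_nonneg (by linarith)]] at h7
    have e : Real.exp (K * -z) * Real.exp (b * z) = Real.exp (-((b - K) * -z)) := by
      rw [← Real.exp_add]; ring_nf
    have h8 := mul_le_mul_of_nonneg_left h5 (Real.exp_pos (K * -z)).le
    have h9 : Real.exp (K * -z) * (C * Real.exp (b * z)) = C * Real.exp (-((b - K) * -z)) := by
      rw [← e]; ring
    linarith [hw.pos 0]
  -- faster decay of the front `v`
  obtain ⟨ν1, hν1a, hν1b⟩ : ∃ ν1, max μ ν0 < ν1 ∧ ν1 < lam2 := exists_between (max_lt hμ.2 hν0.2)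
  obtain ⟨C, Zv, hvup⟩ := hv.exp_bound_climb hg hch
    (((le_max_left μ ν0).trans_lt hν1a).le) (fun ν hν => (chi_neg_of_mem_Ioo hg0 hchi1 hchi2
      ⟨hμ.1.trans_le hν.1, hν.2.trans_lt hν1b⟩).ne) hvμ
  have hν01 : 0 < ν1 - ν0 := by linarith [(le_max_right μ ν0).trans_lt hν1a]
  have hsmall : ∀ ε > 0, ∃ Z, ∀ z ≤ Z, v z ≤ ε * w z := by
    intro ε hε
    obtain ⟨S', hS', h2⟩ := exists_exp_neg_mul_le C hν01 (mul_pos hε hk)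
    refine ⟨min (-S') (min Zv Zw), fun z hz => ?_⟩
    have h3 := hvup z (hz.trans ((min_le_right _ _).trans (min_le_left _ _)))
    have h4 := hwlow z (hz.trans ((min_le_right _ _).trans (min_le_right _ _)))
    have h5 := h2 (-z) (by linarith [hz.trans (min_le_left _ _)])
    have e : Real.exp (ν1 * z) = Real.exp (-((ν1 - ν0) * -z)) * Real.exp (ν0 * z) := by
      rw [← Real.exp_add]; ring_nf
    rw [e] at h3
    have h6 := mul_le_mul_of_nonneg_right h5 (Real.exp_pos (ν0 * z)).le
    have h7 := mul_le_mul_of_nonneg_left h4 hε.le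
    linarith
  -- sliding
  obtain ⟨ρ, δ, -, hρ, hδ, hcontr⟩ := hg.contr_kap
  obtain ⟨Z1, hZ1⟩ := eventually_atTop.1 (hw.top.eventually_const_lt
    (show kap - δ < kap by linarith))
  have hwm := hw.strictMono hg hc'h
  have hsuper : ∀ a z, w2 (z + a) - c * w1 (z + a) - w (z + a) + g (w (z - c * h + a)) < 0 := by
    intro a z
    have h2 := (hw.shift a).eq z
    have h3 : g (w (z - c * h + a)) ≤ g (w (z - c' * h + a)) :=
      hg.mono.monotone (hwm.monotone (by nlinarith))
    have h4 := mul_pos (sub_pos.2 hc') (hw.deriv_pos hg hc'h (z + a))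
    linarith
  have slide : ∀ a Z, (∀ z ≤ Z, v z ≤ w (z + a)) → Z1 ≤ Z + a → ∀ z, v z ≤ w (z + a) := by
    intro a Z h2 h3
    have hs := hw.shift a
    exact hv.le_of_le_left hg hs.d1 hs.d2 (fun z => (hsuper a z).le) hs.top hρ hcontr h2
      (fun z hz => (hZ1 _ (by linarith)).le)
  set A : Set ℝ := {a | ∀ z, v z ≤ w (z + a)} with hA
  have hAne : A.Nonempty := by
    obtain ⟨Z, hZ⟩ := hsmall 1 one_pos
    refine ⟨max 0 (Z1 - Z), slide _ Z (fun z hz => ?_) (by linarith [le_max_right 0 (Z1 - Z)])⟩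
    have h2 := hZ z hz
    have h3 := hwm.monotone (show z ≤ z + max 0 (Z1 - Z) by linarith [le_max_left 0 (Z1 - Z)])
    linarith
  have hAbd : BddBelow A := by
    obtain ⟨a1, ha1⟩ := eventually_atBot.1 (hw.bot.eventually_lt_const (hv.pos 0))
    refine ⟨a1, fun a ha => ?_⟩
    by_contra! h2
    have h3 := ha 0
    rw [zero_add] at h3
    linarith [ha1 a h2.le]
  set as := sInf A with has
  have hle : ∀ z, v z ≤ w (z + as) := by
    intro z
    have hcw : Continuous fun b => w (z + b) := hw.continuous.comp (continuous_const.add continuous_id)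
    have h1 : Tendsto (fun b => w (z + b)) (nhdsWithin as (Ioi as)) (nhds (w (z + as))) :=
      hcw.continuousAt.tendsto.mono_left nhdsWithin_le_nhds
    refine ge_of_tendsto h1 (eventually_nhdsWithin_of_forall fun b hb => ?_)
    obtain ⟨b', hb', hlt⟩ := (csInf_lt_iff hAbd hAne).1 hb
    exact (hb' z).trans (hwm.monotone (by linarith))
  have hs := hw.shift as
  have hlt : ∀ z, v z < w (z + as) := by
    intro x
    refine (hle x).lt_of_ne fun heq => ?_
    obtain ⟨e1, e2⟩ := deriv_conditions_of_isMax (f := fun y => v y - w (y + as))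
      (fun y => (hv.d1 y).sub (hs.d1 y)) ((hv.d2 x).sub (hs.d2 x))
      (fun y => by linarith [hle y])
    have h2 := hsuper as x
    have h3 := hg.mono.monotone (hle (x - c * h))
    have h4 := hv.eq x
    have h5 : v1 x = w1 (x + as) := by linarith
    rw [h4, h5] at e2
    linarith
  set K := |c'| + 1 with hK
  have hKp : 0 < K := by positivity
  obtain ⟨Z, hZ⟩ := hsmall (Real.exp (-(K * (|as| + 1)))) (Real.exp_pos _)
  set Z3 := max Z (Z1 - as + 1) with hZ3
  obtain ⟨x, -, hx⟩ := isCompact_Icc.exists_isMinOn (nonempty_Icc.2 (le_max_left Z (Z1 - as + 1)))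
    (hs.continuous.sub hv.continuous).continuousOn
  set θ := w (x + as) - v x with hθ
  have hθp : 0 < θ := sub_pos.2 (hlt x)
  have hkap := hg.kap_pos
  set σ := min 1 (θ / (K * kap)) with hσ
  have hσp : 0 < σ := lt_min one_pos (by positivity)
  have hσ1 : σ ≤ 1 := min_le_left _ _
  have hσθ : K * kap * σ ≤ θ := by
    have := min_le_right 1 (θ / (K * kap))
    rw [← hσ, le_div_iff₀ (by positivity)] at this
    linarith
  have hmem : as - σ ∈ A := by
    refine slide _ Z3 (fun z hz => ?_) (by linarith [le_max_right Z (Z1 - as + 1)])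
    rcases le_total z Z with h2 | h2
    · have h3 := hZ z h2
      have h4 := hw.le_exp_mul hg z (z + (as - σ))
      have h5 : Real.exp (K * |z - (z + (as - σ))|) ≤ Real.exp (K * (|as| + 1)) := by
        apply Real.exp_le_exp.2
        apply mul_le_mul_of_nonneg_left _ hKp.le
        rw [abs_le]
        constructor <;> linarith [neg_abs_le as, le_abs_self as]
      have h6 := h4.trans (mul_le_mul_of_nonneg_right h5 (hw.pos _).le)
      rw [Real.exp_neg] at h3
      refine h3.trans ?_
      rw [inv_mul_le_iff₀ (Real.exp_pos _)]
      exact h6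
    · have h3 : θ ≤ w (z + as) - v z := hx ⟨h2, hz⟩
      have h4 := hw.abs_sub_le hg (z + as) (z + (as - σ))
      rw [show z + as - (z + (as - σ)) = σ by ring, abs_of_pos hσp] at h4
      have h5 := le_abs_self (w (z + as) - w (z + (as - σ)))
      linarith
  have := csInf_le hAbd hmem
  linarith

end Profile

section Profile
variable {g : ℝ → ℝ} {h c kap g0 L : ℝ} {v v1 v2 : ℝ → ℝ}

/-- A perturbation of higher exponential order at `-∞` is absorbed by an arbitrary shift. -/
lemma Profile.add_exp_le_shift (hg : MonostableMap g kap g0 L) (hh : 0 < h) (hc : 0 < c)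
    {lam1 lam2 : ℝ} (hlam1 : 0 < lam1) (hlam : lam1 < lam2) (hchi1 : chi g0 c h lam1 = 0)
    (hchi2 : chi g0 c h lam2 = 0)
    (hv : Profile g h c kap v v1 v2) {c' : ℝ} (hc' : c' < c) {w w1 w2 : ℝ → ℝ}
    (hw : Profile g h c' kap w w1 w2) {μ : ℝ} (hμ : μ ∈ Ioo lam1 lam2) (C : ℝ) {b : ℝ}
    (hb : 0 < b) : ∃ Z, ∀ z ≤ Z, v z + C * Real.exp (μ * z) ≤ v (z + b) := by
  have hch : 0 ≤ c * h := by positivity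
  obtain ⟨ν, hν1, hν2⟩ := exists_between hμ.1
  obtain ⟨k, hk, Z1, h1⟩ := hv.exp_lower_bound hg hh hc hlam1 hlam hchi1 hchi2 hc' hw
    ⟨hν1, hν2.trans hμ.2⟩
  obtain ⟨r, hr, Z2, h2⟩ := hv.increment_ge hg hch hb (hv.le_add hg hch hb)
  obtain ⟨S, hS, h3⟩ := exists_exp_neg_mul_le C (sub_pos.2 hν2) (mul_pos hr hk)
  refine ⟨min (-S) (min Z1 Z2), fun z hz => ?_⟩
  have h4 := h1 z (hz.trans ((min_le_right _ _).trans (min_le_left _ _)))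
  have h5 := h2 z (hz.trans ((min_le_right _ _).trans (min_le_right _ _)))
  have h6 := h3 (-z) (by linarith [hz.trans (min_le_left _ _)])
  have e : Real.exp (μ * z) = Real.exp (-((μ - ν) * -z)) * Real.exp (ν * z) := by
    rw [← Real.exp_add]; ring_nf
  have h7 := mul_le_mul_of_nonneg_right h6 (Real.exp_pos (ν * z)).le
  have h8 := mul_le_mul_of_nonneg_left h4 hr.le
  rw [e]
  linarith

end Profile

/-- The logistic function with rate `μ`. -/
def logistic (μ x : ℝ) : ℝ := Real.exp (μ * x) / (1 + Real.exp (μ * x))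

section logistic
variable {μ : ℝ}

lemma logistic_pos (μ x : ℝ) : 0 < logistic μ x := by unfold logistic; positivity

lemma logistic_lt_one (μ x : ℝ) : logistic μ x < 1 := by
  unfold logistic
  rw [div_lt_one (by positivity)]
  linarith [Real.exp_pos (μ * x)]

lemma logistic_le_exp (μ x : ℝ) : logistic μ x ≤ Real.exp (μ * x) :=
  div_le_self (Real.exp_pos _).le (by linarith [Real.exp_pos (μ * x)])

lemma half_le_logistic (hμ : 0 < μ) {x : ℝ} (hx : 0 ≤ x) : 1 / 2 ≤ logistic μ x := by
  unfold logistic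
  rw [div_le_div_iff₀ (by positivity) (by positivity)]
  linarith [Real.one_le_exp (mul_nonneg hμ.le hx)]

lemma hasDerivAt_logistic (μ x : ℝ) :
    HasDerivAt (logistic μ) (μ * (logistic μ x * (1 - logistic μ x))) x := by
  have h1 := hasDerivAt_exp_mul μ x
  refine (h1.div (h1.const_add 1) (by positivity)).congr_deriv ?_
  unfold logistic
  field_simp

lemma hasDerivAt_deriv_logistic (μ x : ℝ) :
    HasDerivAt (fun y => μ * (logistic μ y * (1 - logistic μ y)))
      (μ ^ 2 * (logistic μ x * ((1 - logistic μ x) * (1 - 2 * logistic μ x)))) x := by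
  have h1 := hasDerivAt_logistic μ x
  refine ((h1.mul (h1.const_sub 1)).const_mul μ).congr_deriv ?_
  ring

lemma continuous_logistic (μ : ℝ) : Continuous (logistic μ) :=
  continuous_iff_continuousAt.2 fun x => (hasDerivAt_logistic μ x).continuousAt

lemma logistic_mono (hμ : 0 < μ) : Monotone (logistic μ) :=
  monotone_of_hasDerivAt_nonneg (hasDerivAt_logistic μ) fun x =>
    mul_nonneg hμ.le (mul_nonneg (logistic_pos μ x).le (by linarith [logistic_lt_one μ x]))

lemma logistic_sub_le (μ x s : ℝ) :
    logistic μ (x - s) ≤ Real.exp (-(μ * s)) * (1 + Real.exp (μ * x)) * logistic μ x := by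
  refine (logistic_le_exp _ _).trans (le_of_eq ?_)
  unfold logistic
  rw [show μ * (x - s) = -(μ * s) + μ * x by ring, Real.exp_add]
  field_simp

end logistic

lemma nonneg_of_isMax_left {f : ℝ → ℝ} {f' a t : ℝ} (hat : a < t) (hf : HasDerivAt f f' t)
    (hmax : ∀ s ∈ Icc a t, f s ≤ f t) : 0 ≤ f' := by
  have h1 := (hasDerivWithinAt_iff_tendsto_slope' self_notMem_Iio).1
    (hf.hasDerivWithinAt (s := Iio t))
  refine ge_of_tendsto h1 ?_
  filter_upwards [Ioo_mem_nhdsLT hat] with s hs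
  rw [slope_def_field]
  exact div_nonneg_of_nonpos (sub_nonpos.2 (hmax s ⟨hs.1.le, hs.2.le⟩)) (by linarith [hs.2])

/-- Maximum principle for the delayed parabolic inequality. -/
lemma parabolic_comparison {h T0 : ℝ} (hh : 0 < h) {p : ℝ → ℝ → ℝ}
    (hcont : ContinuousOn (fun q : ℝ × ℝ => p q.1 q.2) {q | T0 - h ≤ q.1})
    (hbdd : ∀ T, ∃ M, ∀ t ∈ Icc T0 T, ∀ x, p t x ≤ M)
    (hinit : ∀ t ∈ Icc (T0 - h) T0, ∀ x, p t x ≤ 0)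
    (hp : ∀ t > T0, ∀ x, 0 < p t x → p (t - h) x ≤ 0 → ∃ (pt pxx : ℝ) (p1 : ℝ → ℝ),
      HasDerivAt (fun τ => p τ x) pt t ∧ (∀ y, HasDerivAt (p t) (p1 y) y) ∧
      HasDerivAt p1 pxx x ∧ pt ≤ pxx - p t x) :
    ∀ t ≥ T0 - h, ∀ x, p t x ≤ 0 := by
  have step : ∀ n : ℕ, ∀ t ∈ Icc (T0 - h) (T0 + n * h), ∀ x, p t x ≤ 0 := by
    intro n
    induction n with
    | zero => simpa using hinit
    | succ n ih =>
      set t0 := T0 + n * h with ht0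
      have ht0T : T0 ≤ t0 := by rw [ht0]; have : 0 ≤ (n:ℝ) * h := by positivity
                                linarith
      obtain ⟨M, hM⟩ := hbdd (t0 + h)
      have key : ∀ ε > 0, ∀ t ∈ Icc t0 (t0 + h), ∀ x,
          p t x - ε * (x ^ 2 + 3 * (t - t0) + 1) ≤ 0 := by
        intro ε hε t ht x
        by_contra! hpos
        set F : ℝ × ℝ → ℝ := fun q => p q.1 q.2 - ε * (q.2 ^ 2 + 3 * (q.1 - t0) + 1) with hF
        set R := max |x| (Real.sqrt (|M| / ε)) with hR
        have hR0 : 0 ≤ R := (abs_nonneg x).trans (le_max_left _ _)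
        have hRM : |M| ≤ ε * R ^ 2 := by
          have h1 : Real.sqrt (|M| / ε) ^ 2 ≤ R ^ 2 :=
            pow_le_pow_left₀ (Real.sqrt_nonneg _) (le_max_right _ _) 2
          rw [Real.sq_sqrt (by positivity), div_le_iff₀ hε] at h1
          linarith
        have hFc : ContinuousOn F (Icc t0 (t0 + h) ×ˢ Icc (-R) R) := by
          apply ContinuousOn.sub
          · exact hcont.mono fun q hq => by
              have := hq.1.1
              change T0 - h ≤ q.1; linarith
          · fun_prop
        have hxR : x ∈ Icc (-R) R := abs_le.1 (le_max_left _ _)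
        obtain ⟨⟨t1, x1⟩, ⟨ht1, hx1⟩, hmax⟩ := (isCompact_Icc.prod isCompact_Icc).exists_isMaxOn
          ⟨(t, x), ⟨ht, hxR⟩⟩ hFc
        simp only at ht1 hx1
        have hF1 : 0 < F (t1, x1) := hpos.trans_le (hmax (a := (t, x)) ⟨ht, hxR⟩)
        have hout : ∀ y, y ∉ Icc (-R) R → F (t1, y) ≤ 0 := by
          intro y hy
          have h1 : R ^ 2 ≤ y ^ 2 := by
            rw [← sq_abs y]
            apply pow_le_pow_left₀ hR0
            by_contra! h2
            exact hy (abs_le.1 h2.le)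
          have h2 := hM t1 ⟨ht0T.trans ht1.1, ht1.2⟩ y
          have h3 := mul_le_mul_of_nonneg_left h1 hε.le
          have h4 : 0 ≤ ε * (3 * (t1 - t0) + 1) := by
            have := ht1.1
            exact mul_nonneg hε.le (by linarith)
          simp only [hF]
          linarith [le_abs_self M]
        have hxmax : ∀ y, F (t1, y) ≤ F (t1, x1) := by
          intro y
          by_cases hy : y ∈ Icc (-R) R
          · exact hmax (a := (t1, y)) ⟨ht1, hy⟩
          · exact (hout y hy).trans hF1.le
        have ht01 : t0 < t1 := by
          refine lt_of_le_of_ne ht1.1 fun heq => ?_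
          have h1 := ih t0 ⟨by linarith, le_rfl⟩ x1
          simp only [hF, ← heq] at hF1
          nlinarith [sq_nonneg x1]
        have hppos : 0 < p t1 x1 := by
          simp only [hF] at hF1
          have : 0 ≤ ε * (x1 ^ 2 + 3 * (t1 - t0) + 1) :=
            mul_nonneg hε.le (by nlinarith [sq_nonneg x1])
          linarith
        have hdel := ih (t1 - h) ⟨by linarith, by linarith [ht1.2]⟩ x1
        obtain ⟨pt, pxx, p1, d1, d2, d3, hle⟩ := hp t1 (by linarith) x1 hppos hdel
        have dt : HasDerivAt (fun τ => F (τ, x1)) (pt - ε * (3 * 1)) t1 := by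
          have h1 := ((((hasDerivAt_id t1).sub_const t0).const_mul 3).const_add
            (x1 ^ 2)).add_const 1
          exact d1.sub (h1.const_mul ε)
        have hpt := nonneg_of_isMax_left ht01 dt
          (fun s hs => hmax (a := (s, x1)) ⟨⟨hs.1, hs.2.trans ht1.2⟩, hx1⟩)
        have dx : ∀ y, HasDerivAt (fun y => F (t1, y)) (p1 y - ε * (2 * y)) y := by
          intro y
          have h1 := ((hasDerivAt_pow 2 y).add_const (3 * (t1 - t0))).add_const 1
          refine ((d2 y).sub (h1.const_mul ε)).congr_deriv ?_
          norm_num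
        have dxx : HasDerivAt (fun y => p1 y - ε * (2 * y)) (pxx - ε * (2 * 1)) x1 :=
          d3.sub (((hasDerivAt_id x1).const_mul 2).const_mul ε)
        have h5 := (deriv_conditions_of_isMax dx dxx hxmax).2
        linarith
      intro t ht x
      rcases le_total t t0 with h1 | h1
      · exact ih t ⟨ht.1, h1⟩ x
      have ht2 : t ≤ t0 + h := by
        have := ht.2
        push_cast at this
        linarith
      have hlim : Tendsto (fun ε : ℝ => p t x - ε * (x ^ 2 + 3 * (t - t0) + 1))
          (nhdsWithin 0 (Ioi 0)) (nhds (p t x - 0 * (x ^ 2 + 3 * (t - t0) + 1))) := by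
        have : Continuous fun ε : ℝ => p t x - ε * (x ^ 2 + 3 * (t - t0) + 1) := by fun_prop
        exact this.continuousAt.tendsto.mono_left nhdsWithin_le_nhds
      rw [zero_mul, sub_zero] at hlim
      exact le_of_tendsto hlim (eventually_nhdsWithin_of_forall fun ε hε => key ε hε t ⟨h1, ht2⟩ x)
  intro t ht x
  obtain ⟨n, hn⟩ := exists_nat_ge ((t - T0) / h)
  rw [div_le_iff₀ hh] at hn
  exact step n t ⟨ht, by linarith⟩ x

/-- A nonnegative-time classical solution of (*) with named derivatives. -/
structure ClassicalSol (g : ℝ → ℝ) (h : ℝ) (u ut u1 u2 : ℝ → ℝ → ℝ) : Prop where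
  cont : ContinuousOn (fun p : ℝ × ℝ => u p.1 p.2) {p : ℝ × ℝ | -h ≤ p.1}
  bdd : ∀ T : ℝ, ∃ M : ℝ, ∀ t ∈ Icc (-h) T, ∀ x : ℝ, |u t x| ≤ M
  dt : ∀ t > 0, ∀ x, HasDerivAt (fun τ => u τ x) (ut t x) t
  d1 : ∀ t > 0, ∀ x, HasDerivAt (u t) (u1 t x) x
  d2 : ∀ t > 0, ∀ x, HasDerivAt (u1 t) (u2 t x) x
  eq : ∀ t > 0, ∀ x, ut t x = u2 t x - u t x + g (u (t - h) x)

lemma SolvesStar.classicalSol {g : ℝ → ℝ} {h : ℝ} {u : ℝ → ℝ → ℝ} (hu : SolvesStar g h u) :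
    ClassicalSol g h u (fun t x => deriv (fun τ => u τ x) t) (fun t => deriv (u t))
      (fun t => deriv (deriv (u t))) where
  cont := hu.1
  bdd := hu.2.1
  dt t ht x := (hu.2.2.1 t ht x).1.hasDerivAt
  d1 t ht x := (hu.2.2.1 t ht x).2.1.hasDerivAt
  d2 t ht x := (hu.2.2.1 t ht x).2.2.1.hasDerivAt
  eq t ht x := (hu.2.2.1 t ht x).2.2.2

/-- Comparison of `σ u` (with `σ = ±1` in applications) with a function `W`. -/
lemma ClassicalSol.comparison {g : ℝ → ℝ} {h : ℝ} {u ut u1 u2 : ℝ → ℝ → ℝ} (hh : 0 < h)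
    (hu : ClassicalSol g h u ut u1 u2) {T0 : ℝ} (hT0 : 0 ≤ T0) (σ : ℝ) {W Wt W1 W2 : ℝ → ℝ → ℝ}
    (hWc : ContinuousOn (fun q : ℝ × ℝ => W q.1 q.2) {q | T0 - h ≤ q.1})
    (hWb : ∀ T, ∃ M, ∀ t ∈ Icc T0 T, ∀ x, M ≤ W t x)
    (hinit : ∀ t ∈ Icc (T0 - h) T0, ∀ x, σ * u t x ≤ W t x)
    (hWt : ∀ t > T0, ∀ x, HasDerivAt (fun τ => W τ x) (Wt t x) t)
    (hW1 : ∀ t > T0, ∀ x, HasDerivAt (W t) (W1 t x) x)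
    (hW2 : ∀ t > T0, ∀ x, HasDerivAt (W1 t) (W2 t x) x)
    (hineq : ∀ t > T0, ∀ x, W t x < σ * u t x → σ * u (t - h) x ≤ W (t - h) x →
      σ * g (u (t - h) x) ≤ Wt t x - W2 t x + W t x) :
    ∀ t ≥ T0 - h, ∀ x, σ * u t x ≤ W t x := by
  have := parabolic_comparison (p := fun t x => σ * u t x - W t x) (T0 := T0) hh
    ((continuousOn_const.mul (hu.cont.mono fun q hq => by
      have hq' : T0 - h ≤ q.1 := hq
      change -h ≤ q.1; linarith)).sub hWc) (fun T => ?_)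
    (fun t ht x => sub_nonpos.2 (hinit t ht x)) (fun t ht x hpos hdel => ?_)
  · intro t ht x
    exact sub_nonpos.1 (this t ht x)
  · obtain ⟨M, hM⟩ := hWb T
    obtain ⟨N, hN⟩ := hu.bdd T
    refine ⟨|σ| * N - M, fun t ht x => ?_⟩
    have h1 := hM t ht x
    have h2 := hN t ⟨by linarith [ht.1], ht.2⟩ x
    have h3 := (le_abs_self (σ * u t x)).trans (abs_mul _ _).le
    have h4 := mul_le_mul_of_nonneg_left h2 (abs_nonneg σ)
    linarith
  · have ht0 : 0 < t := by linarith
    refine ⟨_, _, _, ((hu.dt t ht0 x).const_mul σ).sub (hWt t ht x),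
      fun y => ((hu.d1 t ht0 y).const_mul σ).sub (hW1 t ht y),
      ((hu.d2 t ht0 x).const_mul σ).sub (hW2 t ht x), ?_⟩
    have h1 := hineq t ht x (sub_pos.1 hpos) (sub_nonpos.1 hdel)
    have h2 := congrArg (fun r => σ * r) (hu.eq t ht0 x)
    linarith

section Solution
variable {g : ℝ → ℝ} {h c kap g0 L : ℝ} {v v1 v2 : ℝ → ℝ} {u ut u1 u2 : ℝ → ℝ → ℝ}

lemma MonostableMap.signed_le (hg : MonostableMap g kap g0 L) {σ : ℝ} (hσ : σ = 1 ∨ σ = -1)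
    {a b e r : ℝ} (he : 0 ≤ e) (hr : 0 ≤ r) (hab : σ * a ≤ σ * b + e)
    (hl : |a - b| ≤ e → |g a - g b| ≤ r * |a - b|) : σ * (g a - g b) ≤ r * e := by
  have hre := mul_nonneg hr he
  rcases le_total a b with h1 | h1 <;> have h2 := hg.mono.monotone h1 <;>
    rcases hσ with rfl | rfl
  · linarith
  · rw [abs_of_nonpos (by linarith), abs_of_nonpos (by linarith)] at hl
    linarith [hl (by linarith), mul_le_mul_of_nonneg_left (show b - a ≤ e by linarith) hr]
  · rw [abs_of_nonneg (by linarith), abs_of_nonneg (by linarith)] at hl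
    linarith [hl (by linarith), mul_le_mul_of_nonneg_left (show a - b ≤ e by linarith) hr]
  · linarith

lemma exists_lower_of_continuous {f : ℝ → ℝ} (hf : Continuous f) (T0 T : ℝ) :
    ∃ m, ∀ t ∈ Icc T0 T, m ≤ f t := by
  obtain ⟨m, hm⟩ := isCompact_Icc.bddBelow_image (hf.continuousOn (s := Icc T0 T))
  exact ⟨m, fun t ht => hm (mem_image_of_mem f ht)⟩

/-- Comparison of a solution with a modulated and perturbed front. -/
lemma ClassicalSol.front_comparison (hh : 0 < h) (hu : ClassicalSol g h u ut u1 u2)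
    (hv : Profile g h c kap v v1 v2) (hvk : ∀ z, v z ≤ kap) {T0 : ℝ} (hT0 : 0 ≤ T0) {σ : ℝ}
    (hσ : σ = 1 ∨ σ = -1) {s s' p p' e e' f f1 f2 : ℝ → ℝ} (hs : ∀ t, HasDerivAt s (s' t) t)
    (hp : ∀ t, HasDerivAt p (p' t) t) (he : ∀ t, HasDerivAt e (e' t) t)
    (hf1 : ∀ z, HasDerivAt f (f1 z) z) (hf2 : ∀ z, HasDerivAt f1 (f2 z) z)
    (hp0 : ∀ t, 0 ≤ p t) (hfb : ∃ m, ∀ z, m ≤ f z)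
    (hinit : ∀ t ∈ Icc (T0 - h) T0, ∀ x,
      σ * u t x ≤ σ * v (x + c * t + s t) + p t * f (x + c * t) + e t)
    (hineq : ∀ t > T0, ∀ x,
      σ * v (x + c * t + s t) + p t * f (x + c * t) + e t < σ * u t x →
      σ * u (t - h) x ≤ σ * v (x + c * t - c * h + s (t - h)) +
        p (t - h) * f (x + c * t - c * h) + e (t - h) →
      σ * (g (u (t - h) x) - g (v (x + c * t + s t - c * h))) ≤
        σ * (s' t * v1 (x + c * t + s t)) + p' t * f (x + c * t) +
        p t * (c * f1 (x + c * t) - f2 (x + c * t) + f (x + c * t)) + (e' t + e t)) :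
    ∀ t ≥ T0 - h, ∀ x, σ * u t x ≤ σ * v (x + c * t + s t) + p t * f (x + c * t) + e t := by
  have hsc : Continuous s := continuous_iff_continuousAt.2 fun z => (hs z).continuousAt
  have hpc : Continuous p := continuous_iff_continuousAt.2 fun z => (hp z).continuousAt
  have hec : Continuous e := continuous_iff_continuousAt.2 fun z => (he z).continuousAt
  have hfc : Continuous f := continuous_iff_continuousAt.2 fun z => (hf1 z).continuousAt
  have hvc := hv.continuous
  refine hu.comparison hh hT0 σ
    (W := fun t x => σ * v (x + c * t + s t) + p t * f (x + c * t) + e t)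
    (Wt := fun t x => σ * (v1 (x + c * t + s t) * (c + s' t)) +
      (p' t * f (x + c * t) + p t * (f1 (x + c * t) * c)) + e' t)
    (W1 := fun t x => σ * v1 (x + c * t + s t) + p t * f1 (x + c * t))
    (W2 := fun t x => σ * v2 (x + c * t + s t) + p t * f2 (x + c * t)) ?_ ?_ hinit ?_ ?_ ?_ ?_
  · exact Continuous.continuousOn (by fun_prop)
  · intro T
    obtain ⟨m, hm⟩ := hfb
    obtain ⟨E, hE⟩ := exists_lower_of_continuous hec T0 T
    obtain ⟨P, hP⟩ := exists_lower_of_continuous hpc.neg T0 T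
    refine ⟨-kap + P * |m| + E, fun t ht x => ?_⟩
    have h1 := hE t ht
    have h2 := mul_le_mul_of_nonneg_right (hP t ht) (abs_nonneg m)
    have h3 := mul_le_mul_of_nonneg_left (hm (x + c * t)) (hp0 t)
    have h4 := mul_le_mul_of_nonneg_left (neg_abs_le m) (hp0 t)
    have h5 := hv.pos (x + c * t + s t)
    have h6 := hvk (x + c * t + s t)
    rcases hσ with rfl | rfl <;> simp only [Pi.neg_apply] at h2 <;> linarith
  · intro t _ x
    have h0 : HasDerivAt (fun τ => x + c * τ) c t := by
      simpa using ((hasDerivAt_id t).const_mul c).const_add x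
    have h1 : HasDerivAt (fun τ => v (x + c * τ + s τ)) (v1 (x + c * t + s t) * (c + s' t)) t :=
      (hv.d1 (x + c * t + s t)).comp t (h0.add (hs t))
    have h2 : HasDerivAt (fun τ => f (x + c * τ)) (f1 (x + c * t) * c) t :=
      (hf1 (x + c * t)).comp t h0
    exact ((h1.const_mul σ).add ((hp t).mul h2)).add (he t)
  · intro t _ x
    have h1 : HasDerivAt (fun y => v (y + c * t + s t)) (v1 (x + c * t + s t)) x := by
      simpa [add_assoc] using (hv.d1 (x + (c * t + s t))).comp_add_const x (c * t + s t)
    have h2 := (hf1 (x + c * t)).comp_add_const x (c * t)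
    exact ((h1.const_mul σ).add (h2.const_mul (p t))).add_const (e t)
  · intro t _ x
    have h1 : HasDerivAt (fun y => v1 (y + c * t + s t)) (v2 (x + c * t + s t)) x := by
      simpa [add_assoc] using (hv.d2 (x + (c * t + s t))).comp_add_const x (c * t + s t)
    have h2 := (hf2 (x + c * t)).comp_add_const x (c * t)
    exact (h1.const_mul σ).add (h2.const_mul (p t))
  · intro t ht x hlt hle
    have h0 : x + c * (t - h) = x + c * t - c * h := by ring
    rw [h0] at hle
    have h1 := hineq t ht x hlt hle
    rw [hv.eq (x + c * t + s t)]
    linarith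

lemma ClassicalSol.nonneg (hg : MonostableMap g kap g0 L) (hh : 0 < h)
    (hu : ClassicalSol g h u ut u1 u2) (h0 : ∀ t ∈ Icc (-h) 0, ∀ x, 0 ≤ u t x) :
    ∀ t ≥ -h, ∀ x, 0 ≤ u t x := by
  have := hu.comparison hh le_rfl (-1) (W := fun _ _ => 0) (Wt := fun _ _ => 0)
    (W1 := fun _ _ => 0) (W2 := fun _ _ => 0) continuousOn_const
    (fun T => ⟨0, fun _ _ _ => le_rfl⟩) (fun t ht x => by
      rw [zero_sub] at ht; linarith [h0 t ht x])
    (fun t _ x => hasDerivAt_const _ _) (fun t _ x => hasDerivAt_const _ _)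
    (fun t _ x => hasDerivAt_const _ _) (fun t _ x _ hle => by
      have h1 := hg.mono.monotone (show 0 ≤ u (t - h) x by linarith)
      rw [hg.map_zero] at h1
      linarith)
  intro t ht x
  have := this t (by linarith) x
  linarith

lemma exists_relaxation_rate (h D : ℝ) {ε : ℝ} (hε : 0 < ε) :
    ∃ γ, 0 < γ ∧ γ < 1 ∧ D * (Real.exp (γ * h) - 1 + γ) ≤ ε ∧ D * (Real.exp (γ * h) - 1) ≤ ε := by
  have hc1 : Continuous fun γ : ℝ => D * (Real.exp (γ * h) - 1 + γ) := by fun_prop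
  have hc2 : Continuous fun γ : ℝ => D * (Real.exp (γ * h) - 1) := by fun_prop
  have e1 := (hc1.tendsto 0).eventually_lt_const (u := ε) (by simpa using hε)
  have e2 := (hc2.tendsto 0).eventually_lt_const (u := ε) (by simpa using hε)
  have e3 : ∀ᶠ γ : ℝ in nhdsWithin 0 (Ioi 0), γ ∈ Ioo (0:ℝ) 1 := Ioo_mem_nhdsGT one_pos
  obtain ⟨γ, ⟨h1, h2⟩, h3⟩ := (((e1.and e2).filter_mono nhdsWithin_le_nhds).and e3).exists
  exact ⟨γ, h3.1, h3.2, h1.le, h2.le⟩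

lemma exists_pos_le_of_compact {f : ℝ → ℝ} (hf : Continuous f) {a b : ℝ} (hab : a ≤ b)
    (hpos : ∀ x ∈ Icc a b, 0 < f x) : ∃ m > 0, ∀ x ∈ Icc a b, m ≤ f x := by
  obtain ⟨x, hx, hmin⟩ := isCompact_Icc.exists_isMinOn (nonempty_Icc.2 hab) hf.continuousOn
  exact ⟨f x, hpos x hx, fun y hy => hmin hy⟩

lemma hasDerivAt_relax (A D γ t : ℝ) : HasDerivAt (fun τ => A + D * Real.exp (-(γ * τ)))
    (-(γ * (D * Real.exp (-(γ * t))))) t := by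
  have h1 := hasDerivAt_exp_mul (-γ) t
  simp only [neg_mul] at h1
  refine ((h1.const_mul D).const_add A).congr_deriv ?_
  ring

/-- Upper relaxation towards `κ`. -/
lemma ClassicalSol.upper_relax (hg : MonostableMap g kap g0 L) (hh : 0 < h)
    (hu : ClassicalSol g h u ut u1 u2) {M : ℝ} (hM : ∀ t ∈ Icc (-h) 0, ∀ x, u t x ≤ M)
    {δ : ℝ} (hδ : 0 < δ) : ∃ D γ, 0 ≤ D ∧ 0 < γ ∧ γ < 1 ∧
      ∀ t ≥ -h, ∀ x, u t x ≤ kap + δ + D * Real.exp (-(γ * t)) := by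
  set A := kap + δ with hA
  set D := max (M - A) 0 with hD
  have hD0 : 0 ≤ D := le_max_right _ _
  have hDM : M ≤ A + D := by linarith [le_max_left (M - A) 0]
  have hE0 : 0 ≤ D * Real.exp h := by positivity
  obtain ⟨η, hη, hηg⟩ := exists_pos_le_of_compact (f := fun x => x - g x)
    (continuous_id.sub hg.continuous) (a := A) (b := A + D * Real.exp h) (by linarith)
    (fun x hx => by have := hg.map_lt x (by linarith [hx.1]); linarith)
  obtain ⟨γ, hγ, hγ1, hγ2, -⟩ := exists_relaxation_rate h D hη
  have hexp : ∀ t ≤ 0, 1 ≤ Real.exp (-(γ * t)) := fun t ht =>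
    Real.one_le_exp (by nlinarith)
  refine ⟨D, γ, hD0, hγ, hγ1, ?_⟩
  have := hu.comparison hh le_rfl 1 (W := fun t _ => A + D * Real.exp (-(γ * t)))
    (Wt := fun t _ => -(γ * (D * Real.exp (-(γ * t))))) (W1 := fun _ _ => 0) (W2 := fun _ _ => 0)
    (Continuous.continuousOn (by fun_prop))
    (fun T => ⟨A, fun t _ _ => by have : 0 ≤ D * Real.exp (-(γ * t)) := by positivity
                                  linarith⟩)
    (fun t ht x => by
      rw [zero_sub] at ht
      have h1 := mul_le_mul_of_nonneg_left (hexp t ht.2) hD0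
      linarith [hM t ht x])
    (fun t _ x => hasDerivAt_relax _ _ _ _) (fun t _ x => hasDerivAt_const _ _)
    (fun t _ x => hasDerivAt_const _ _) (fun t ht x _ hle => by
      rw [one_mul] at hle ⊢
      have h1 := hg.mono.monotone hle
      have h2 : Real.exp (-(γ * (t - h))) = Real.exp (γ * h) * Real.exp (-(γ * t)) := by
        rw [← Real.exp_add]; ring_nf
      have h3 : Real.exp (-(γ * t)) ≤ 1 := Real.exp_le_one_iff.2 (by nlinarith)
      have h4 : Real.exp (-(γ * (t - h))) ≤ Real.exp h :=
        Real.exp_le_exp.2 (by nlinarith)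
      have h5 : 0 ≤ D * Real.exp (-(γ * (t - h))) := by positivity
      have h6 := hηg (A + D * Real.exp (-(γ * (t - h))))
        ⟨by linarith, by linarith [mul_le_mul_of_nonneg_left h4 hD0]⟩
      have h7 : 0 ≤ D * (Real.exp (γ * h) - 1 + γ) := by
        have : 1 ≤ Real.exp (γ * h) := Real.one_le_exp (by positivity)
        exact mul_nonneg hD0 (by linarith)
      have h8 := mul_le_mul_of_nonneg_left h3 h7
      rw [h2] at h1 h6
      linarith)
  intro t ht x
  have := this t (by linarith) x
  linarith

lemma ClassicalSol.bounded (hg : MonostableMap g kap g0 L) (hh : 0 < h)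
    (hu : ClassicalSol g h u ut u1 u2) {M : ℝ} (hM : ∀ t ∈ Icc (-h) 0, ∀ x, u t x ≤ M) :
    ∃ B, ∀ t ≥ -h, ∀ x, u t x ≤ B := by
  obtain ⟨D, γ, hD, hγ, hγ1, hb⟩ := hu.upper_relax hg hh hM one_pos
  refine ⟨kap + 1 + D * Real.exp h, fun t ht x => (hb t ht x).trans ?_⟩
  have : Real.exp (-(γ * t)) ≤ Real.exp h := Real.exp_le_exp.2 (by nlinarith)
  linarith [mul_le_mul_of_nonneg_left this hD]

lemma ClassicalSol.eventually_le (hg : MonostableMap g kap g0 L) (hh : 0 < h)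
    (hu : ClassicalSol g h u ut u1 u2) {M : ℝ} (hM : ∀ t ∈ Icc (-h) 0, ∀ x, u t x ≤ M)
    {δ : ℝ} (hδ : 0 < δ) : ∃ T > 0, ∀ t ≥ T, ∀ x, u t x ≤ kap + δ := by
  obtain ⟨D, γ, hD, hγ, hγ1, hb⟩ := hu.upper_relax hg hh hM (half_pos hδ)
  obtain ⟨T, hT, hT2⟩ := exists_exp_neg_mul_le D hγ (half_pos hδ)
  refine ⟨T, hT, fun t ht x => ?_⟩
  linarith [hb t (by linarith) x, hT2 t ht]

/-- Lower relaxation towards `κ` ahead of a moving point. -/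
lemma ClassicalSol.lower_relax (hg : MonostableMap g kap g0 L) (hh : 0 < h)
    (hu : ClassicalSol g h u ut u1 u2) (h0 : ∀ t ∈ Icc (-h) 0, ∀ x, 0 ≤ u t x) {m X : ℝ}
    (hm : 0 < m) (hmX : ∀ t ∈ Icc (-h) 0, ∀ x ≥ X, m ≤ u t x) {δ : ℝ} (hδ : 0 < δ)
    (hδk : δ < kap) : ∃ D γ K C m', 0 < γ ∧ 0 ≤ K ∧ 0 ≤ C ∧ 0 < m' ∧ ∀ t ≥ -h, ∀ x,
      kap - δ - D * Real.exp (-(γ * t)) - C * Real.exp (K * t - x) ≤ u t x ∧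
      m' - C * Real.exp (K * t - x) ≤ u t x := by
  set A := kap - δ with hA
  wlog hmA : m ≤ A generalizing m
  · exact this (m := A) (by linarith) (fun t ht x hx => by linarith [hmX t ht x hx]) le_rfl
  set D := A - m with hD
  have hD0 : 0 ≤ D := by linarith
  obtain ⟨η, hη, hηg⟩ := exists_pos_le_of_compact (f := fun x => g x - x)
    (hg.continuous.sub continuous_id) (a := m / 2) (b := A) (by linarith)
    (fun x hx => by have := hg.lt_map x (by linarith [hx.1]) (by linarith [hx.2]); linarith)
  obtain ⟨γ, hγ, hγ1, hγ2, hγ3⟩ := exists_relaxation_rate h D (lt_min hη (half_pos hm))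
  have hγ4 := hγ2.trans (min_le_left _ _)
  have hγ5 := hγ3.trans (min_le_right _ _)
  have hL := hg.lip_pos
  set C := m * Real.exp (L * h + X) with hC
  have hC0 : 0 < C := by positivity
  have hvlow : ∀ t ≥ -h, m / 2 ≤ A - D * Real.exp (-(γ * t)) := by
    intro t ht
    have h1 : Real.exp (-(γ * t)) ≤ Real.exp (γ * h) := Real.exp_le_exp.2 (by nlinarith)
    linarith [mul_le_mul_of_nonneg_left h1 hD0]
  have hexp : ∀ t ≤ 0, 1 ≤ Real.exp (-(γ * t)) := fun t ht =>
    Real.one_le_exp (by nlinarith)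
  have key : ∀ t ≥ -h, ∀ x, A - D * Real.exp (-(γ * t)) - C * Real.exp (L * t - x) ≤ u t x := by
    have := hu.comparison hh le_rfl (-1)
      (W := fun t x => -A + D * Real.exp (-(γ * t)) + C * Real.exp (L * t - x))
      (Wt := fun t x => -(γ * (D * Real.exp (-(γ * t)))) + C * (Real.exp (L * t - x) * L))
      (W1 := fun t x => C * -Real.exp (L * t - x)) (W2 := fun t x => C * Real.exp (L * t - x))
      (Continuous.continuousOn (by fun_prop))
      (fun T => ⟨-A, fun t _ x => by
        have : 0 ≤ D * Real.exp (-(γ * t)) := by positivity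
        have : 0 ≤ C * Real.exp (L * t - x) := by positivity
        linarith⟩)
      (fun t ht x => by
        rw [zero_sub] at ht
        have h1 := mul_le_mul_of_nonneg_left (hexp t ht.2) hD0
        have h2 : 0 ≤ C * Real.exp (L * t - x) := by positivity
        rcases le_total X x with hx | hx
        · linarith [hmX t ht x hx]
        · have h3 : m ≤ C * Real.exp (L * t - x) := by
            rw [hC, mul_assoc, ← Real.exp_add]
            refine le_mul_of_one_le_right hm.le (Real.one_le_exp ?_)
            nlinarith [ht.1]
          linarith [h0 t ht x])
      (fun t _ x => by
        have h1 : HasDerivAt (fun τ => L * τ - x) L t := by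
          simpa using ((hasDerivAt_id t).const_mul L).sub_const x
        exact (hasDerivAt_relax (-A) D γ t).add (h1.exp.const_mul C))
      (fun t _ x => by
        have h1 : HasDerivAt (fun y => L * t - y) (-1) x := by
          simpa using (hasDerivAt_id x).const_sub (L * t)
        refine ((h1.exp.const_mul C).const_add _).congr_deriv ?_
        ring)
      (fun t _ x => by
        have h1 : HasDerivAt (fun y => L * t - y) (-1) x := by
          simpa using (hasDerivAt_id x).const_sub (L * t)
        refine (h1.exp.fun_neg.const_mul C).congr_deriv ?_
        ring)
      (fun t ht x _ hle => by
        have h2 : Real.exp (-(γ * (t - h))) = Real.exp (γ * h) * Real.exp (-(γ * t)) := by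
          rw [← Real.exp_add]; ring_nf
        have h3 : Real.exp (-(γ * t)) ≤ 1 := Real.exp_le_one_iff.2 (by nlinarith)
        have h4 : Real.exp (L * (t - h) - x) ≤ Real.exp (L * t - x) :=
          Real.exp_le_exp.2 (by nlinarith)
        have h5 : 0 ≤ D * Real.exp (-(γ * (t - h))) := by positivity
        have h6 := hηg (A - D * Real.exp (-(γ * (t - h))))
          ⟨hvlow _ (by linarith), by linarith⟩
        have h7 : 0 ≤ D * (Real.exp (γ * h) - 1 + γ) := by
          have : 1 ≤ Real.exp (γ * h) := Real.one_le_exp (by positivity)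
          exact mul_nonneg hD0 (by linarith)
        have h8 := mul_le_mul_of_nonneg_left h3 h7
        have h9 := hg.signed_le (Or.inr rfl) (a := u (t - h) x)
          (b := A - D * Real.exp (-(γ * (t - h)))) (e := C * Real.exp (L * (t - h) - x))
          (by positivity) hL.le (by linarith) (fun _ => hg.lip _ _)
        have h10 := mul_le_mul_of_nonneg_left (mul_le_mul_of_nonneg_left h4 hC0.le) hL.le
        rw [h2] at h6 h9
        linarith)
    intro t ht x
    have := this t (by linarith) x
    linarith
  refine ⟨D, γ, L, C, m / 2, hγ, hL.le, hC0.le, half_pos hm, fun t ht x => ⟨key t ht x, ?_⟩⟩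
  linarith [key t ht x, hvlow t ht]

lemma ClassicalSol.eventually_ge (hg : MonostableMap g kap g0 L) (hh : 0 < h)
    (hu : ClassicalSol g h u ut u1 u2) (h0 : ∀ t ∈ Icc (-h) 0, ∀ x, 0 ≤ u t x) {m X : ℝ}
    (hm : 0 < m) (hmX : ∀ t ∈ Icc (-h) 0, ∀ x ≥ X, m ≤ u t x) {δ : ℝ} (hδ : 0 < δ)
    (hδk : δ < kap) : ∃ T0 > 0, ∀ T, ∃ Y, ∀ t ∈ Icc T0 T, ∀ x ≥ Y, kap - δ ≤ u t x := by
  obtain ⟨D, γ, K, C, m', hγ, hK, hC, -, hb⟩ := hu.lower_relax hg hh h0 hm hmX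
    (show 0 < δ / 3 by positivity) (by linarith)
  obtain ⟨T0, hT0, hT⟩ := exists_exp_neg_mul_le D hγ (show 0 < δ / 3 by positivity)
  refine ⟨T0, hT0, fun T => ?_⟩
  obtain ⟨Y, hY, hY2⟩ := exists_exp_neg_mul_le (C * Real.exp (K * T)) one_pos
    (show 0 < δ / 3 by positivity)
  refine ⟨Y, fun t ht x hx => ?_⟩
  have h1 := (hb t (by linarith [ht.1]) x).1
  have h2 := hT t ht.1
  have h3 := hY2 x hx
  rw [one_mul, mul_assoc, ← Real.exp_add] at h3
  have h4 : Real.exp (K * t - x) ≤ Real.exp (K * T + -x) :=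
    Real.exp_le_exp.2 (by nlinarith [mul_le_mul_of_nonneg_left ht.2 hK])
  linarith [mul_le_mul_of_nonneg_left h4 hC]

/-- Strict positivity of a nonnegative solution that is positive ahead of a moving point. -/
lemma ClassicalSol.pos (hg : MonostableMap g kap g0 L) (hh : 0 < h)
    (hu : ClassicalSol g h u ut u1 u2) (h0 : ∀ t ∈ Icc (-h) 0, ∀ x, 0 ≤ u t x) {m X : ℝ}
    (hm : 0 < m) (hmX : ∀ t ∈ Icc (-h) 0, ∀ x ≥ X, m ≤ u t x) {t : ℝ} (ht : 0 < t) (x : ℝ) :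
    0 < u t x := by
  obtain ⟨D, γ, K, C, m', -, hK, hC, hm', hb⟩ := hu.lower_relax hg hh h0 hm hmX
    (half_pos hg.kap_pos) (half_lt_self hg.kap_pos)
  have hnn := hu.nonneg hg hh h0
  obtain ⟨Y, hY, hY2⟩ := exists_exp_neg_mul_le C one_pos (half_pos hm')
  set k := m' / 2 with hk
  have hk0 : 0 < k := half_pos hm'
  have hright : ∀ t ≥ -h, ∀ x, Y ≤ x - K * t → k ≤ u t x := by
    intro t ht x hx
    have h1 := hY2 _ hx
    rw [show -(1 * (x - K * t)) = K * t - x by ring] at h1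
    linarith [(hb t ht x).2]
  have hcmp : ∀ ν ≥ 2, ∀ t ≥ -h, ∀ x,
      k * (logistic ν (x - K * t - Y - 2) - Real.exp (-(3 * ν ^ 2 / 8 * t))) ≤ u t x := by
    intro ν hν
    have hν0 : 0 < ν := by linarith
    set β := 3 * ν ^ 2 / 8 with hβ
    have hβ1 : 1 ≤ β := by rw [hβ]; nlinarith
    have := hu.comparison hh le_rfl (-1)
      (W := fun t x => 0 + k * Real.exp (-(β * t)) - k * logistic ν (x - K * t - Y - 2))
      (Wt := fun t x => -(β * (k * Real.exp (-(β * t)))) -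
        k * (ν * (logistic ν (x - K * t - Y - 2) * (1 - logistic ν (x - K * t - Y - 2))) * -K))
      (W1 := fun t x => -(k * (ν * (logistic ν (x - K * t - Y - 2) *
        (1 - logistic ν (x - K * t - Y - 2))))))
      (W2 := fun t x => -(k * (ν ^ 2 * (logistic ν (x - K * t - Y - 2) *
        ((1 - logistic ν (x - K * t - Y - 2)) * (1 - 2 * logistic ν (x - K * t - Y - 2)))))))
      (Continuous.continuousOn (by have := continuous_logistic ν; fun_prop))
      (fun T => ⟨-k, fun t _ x => by
        have : 0 ≤ k * Real.exp (-(β * t)) := by positivity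
        have := mul_le_mul_of_nonneg_left (logistic_lt_one ν (x - K * t - Y - 2)).le hk0.le
        linarith⟩)
      (fun t ht x => by
        rw [zero_sub] at ht
        have h1 : 1 ≤ Real.exp (-(β * t)) := Real.one_le_exp (by nlinarith [ht.2])
        have h2 := mul_le_mul_of_nonneg_left h1 hk0.le
        have h3 := mul_le_mul_of_nonneg_left (logistic_lt_one ν (x - K * t - Y - 2)).le hk0.le
        linarith [h0 t ht x])
      (fun t _ x => by
        have h1 : HasDerivAt (fun τ => x - K * τ - Y - 2) (-K) t := by
          simpa using ((((hasDerivAt_id t).const_mul K).const_sub x).sub_const Y).sub_const 2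
        exact (hasDerivAt_relax 0 k β t).sub
          (((hasDerivAt_logistic ν _).comp t h1).const_mul k))
      (fun t _ x => by
        have h1 := (hasDerivAt_logistic ν (x + (-(K * t) - Y - 2))).comp_add_const
          x (-(K * t) - Y - 2)
        have h2 : ∀ y, y + (-(K * t) - Y - 2) = y - K * t - Y - 2 := fun y => by ring
        simp only [h2] at h1
        exact (h1.const_mul k).const_sub _)
      (fun t _ x => by
        have h1 := (hasDerivAt_deriv_logistic ν (x + (-(K * t) - Y - 2))).comp_add_const
          x (-(K * t) - Y - 2)
        have h2 : ∀ y, y + (-(K * t) - Y - 2) = y - K * t - Y - 2 := fun y => by ring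
        simp only [h2] at h1
        exact (h1.const_mul k).fun_neg)
      (fun t ht x hlt _ => by
        have hg1 := hg.mono.monotone (hnn (t - h) (by linarith) x)
        rw [hg.map_zero] at hg1
        have hu0 := hnn t (by linarith) x
        have hl1 := logistic_lt_one ν (x - K * t - Y - 2)
        have hl0 := logistic_pos ν (x - K * t - Y - 2)
        have hY3 : x - K * t < Y := by
          by_contra! hc
          have := hright t (by linarith) x hc
          have : 0 ≤ k * Real.exp (-(β * t)) := by positivity
          nlinarith
        have hl2 : logistic ν (x - K * t - Y - 2) ≤ 1 / 4 := by
          refine (logistic_mono hν0 (show x - K * t - Y - 2 ≤ -2 by linarith)).trans ?_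
          have h1 : Real.exp (ν * -2) ≤ 1 / 3 := by
            rw [show ν * -2 = -(2 * ν) by ring, Real.exp_neg, one_div]
            exact inv_anti₀ (by norm_num) (by linarith [Real.add_one_le_exp (2 * ν)])
          unfold logistic
          rw [div_le_div_iff₀ (by positivity) (by norm_num)]
          linarith
        set l := logistic ν (x - K * t - Y - 2)
        have h1 : k * Real.exp (-(β * t)) ≤ k * l := by linarith
        have h2 : 3 / 8 ≤ (1 - l) * (1 - 2 * l) := by nlinarith
        have h3 : β * l ≤ ν ^ 2 * (l * ((1 - l) * (1 - 2 * l))) := by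
          have := mul_le_mul_of_nonneg_left h2 (mul_nonneg (sq_nonneg ν) hl0.le)
          rw [hβ]; linarith
        have h4 : 0 ≤ k * (ν * (l * (1 - l)) * K) := by
          have : 0 ≤ 1 - l := by linarith
          positivity
        have h5 := mul_le_mul_of_nonneg_left h1 (show 0 ≤ β - 1 by linarith)
        have h6 := mul_le_mul_of_nonneg_left h3 hk0.le
        linarith)
    intro t ht x
    have := this t (by linarith) x
    linarith
  set y := |x - K * t - Y - 2| with hy
  have hy0 : 0 ≤ y := abs_nonneg _
  set ν := 2 + 8 * (y + 1) / (3 * t) with hν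
  have hν2 : 2 ≤ ν := by rw [hν]; have : 0 ≤ 8 * (y + 1) / (3 * t) := by positivity
                         linarith
  have hlog : Real.exp (-(ν * y)) / 2 ≤ logistic ν (x - K * t - Y - 2) := by
    have h1 : logistic ν (-y) ≤ logistic ν (x - K * t - Y - 2) :=
      logistic_mono (by linarith) (neg_abs_le _)
    refine le_trans ?_ h1
    unfold logistic
    rw [show ν * -y = -(ν * y) by ring]
    have : Real.exp (-(ν * y)) ≤ 1 := Real.exp_le_one_iff.2 (by
      have : 0 ≤ ν * y := by positivity
      linarith)
    exact div_le_div_of_nonneg_left (Real.exp_pos _).le (by positivity) (by linarith)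
  have hexp : Real.exp (-(3 * ν ^ 2 / 8 * t)) < Real.exp (-(ν * y)) / 2 := by
    have h1 : 8 * (y + 1) ≤ ν * (3 * t) := by
      rw [hν, add_mul, div_mul_cancel₀ _ (by positivity)]
      nlinarith
    have h2 : ν * y + ν ≤ 3 * ν ^ 2 / 8 * t := by nlinarith
    have h3 : Real.exp (-(3 * ν ^ 2 / 8 * t)) ≤ Real.exp (-(ν * y)) * Real.exp (-2) := by
      rw [← Real.exp_add]
      exact Real.exp_le_exp.2 (by linarith)
    have h4 : Real.exp (-2) < 1 / 2 := by
      rw [Real.exp_neg, one_div]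
      exact inv_strictAnti₀ (by norm_num) (by linarith [Real.add_one_le_exp (2:ℝ)])
    have h5 := mul_lt_mul_of_pos_left h4 (Real.exp_pos (-(ν * y)))
    linarith
  have h1 := hcmp ν hν2 t (by linarith) x
  have h2 : 0 < k * (logistic ν (x - K * t - Y - 2) - Real.exp (-(3 * ν ^ 2 / 8 * t))) :=
    mul_pos hk0 (by linarith)
  linarith

end Solution

/-- A monotone front with speed `c`, and a solution of the delayed equation whose initial data
approach the front at the exponential rate `μ` in the unstable range. -/
structure FrontProblem (g : ℝ → ℝ) (h c kap g0 L μ : ℝ) (v v1 v2 : ℝ → ℝ)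
    (u ut u1 u2 : ℝ → ℝ → ℝ) : Prop where
  map : MonostableMap g kap g0 L
  h_pos : 0 < h
  c_pos : 0 < c
  rate_pos : 0 < μ
  chi_neg : chi g0 c h μ < 0
  front : Profile g h c kap v v1 v2
  absorb : ∀ C, ∀ b > 0, ∃ Z, ∀ z ≤ Z, v z + C * Real.exp (μ * z) ≤ v (z + b)
  sol : ClassicalSol g h u ut u1 u2
  init_nonneg : ∀ t ∈ Icc (-h) 0, ∀ x, 0 ≤ u t x
  init_le : ∃ M, ∀ t ∈ Icc (-h) 0, ∀ x, u t x ≤ M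
  init_ge : ∃ m > 0, ∃ X, ∀ t ∈ Icc (-h) 0, ∀ x ≥ X, m ≤ u t x
  init_near : ∃ C ≥ 0, ∀ t ∈ Icc (-h) 0, ∀ x, |u t x - v (x + c * t)| ≤ C * Real.exp (μ * (x + c * t))

namespace FrontProblem
variable {g : ℝ → ℝ} {h c kap g0 L μ : ℝ} {v v1 v2 : ℝ → ℝ} {u ut u1 u2 : ℝ → ℝ → ℝ}

lemma delay_nonneg (P : FrontProblem g h c kap g0 L μ v v1 v2 u ut u1 u2) : 0 ≤ c * h :=
  (mul_pos P.c_pos P.h_pos).le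

lemma front_mono (P : FrontProblem g h c kap g0 L μ v v1 v2 u ut u1 u2) : Monotone v :=
  (P.front.strictMono P.map P.delay_nonneg).monotone

lemma signed_mono (P : FrontProblem g h c kap g0 L μ v v1 v2 u ut u1 u2) {σ : ℝ}
    (hσ : σ = 1 ∨ σ = -1) {a b : ℝ} (hab : a ≤ b) (z : ℝ) :
    σ * v (z + σ * a) ≤ σ * v (z + σ * b) := by
  rcases hσ with rfl | rfl
  · have := P.front_mono (show z + 1 * a ≤ z + 1 * b by linarith)
    linarith
  · have := P.front_mono (show z + -1 * b ≤ z + -1 * a by linarith)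
    linarith

lemma front_le (P : FrontProblem g h c kap g0 L μ v v1 v2 u ut u1 u2) (z : ℝ) : v z ≤ kap :=
  P.front.le_kap P.map z

lemma sol_nonneg (P : FrontProblem g h c kap g0 L μ v v1 v2 u ut u1 u2) :
    ∀ t ≥ -h, ∀ x, 0 ≤ u t x :=
  P.sol.nonneg P.map P.h_pos P.init_nonneg

lemma abs_le_of_signed {a b e : ℝ} (hs : ∀ σ : ℝ, σ = 1 ∨ σ = -1 → σ * a ≤ σ * b + e) :
    |a - b| ≤ e := by
  rw [abs_le]
  constructor
  · linarith [hs (-1) (Or.inr rfl)]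
  · linarith [hs 1 (Or.inl rfl)]

lemma signed_of_abs_le {a b e σ : ℝ} (hσ : σ = 1 ∨ σ = -1) (hs : |a - b| ≤ e) :
    σ * a ≤ σ * b + e := by
  rw [abs_le] at hs
  rcases hσ with rfl | rfl <;> linarith [hs.1, hs.2]

lemma near_of_time_le (P : FrontProblem g h c kap g0 L μ v v1 v2 u ut u1 u2) (T : ℝ) :
    ∃ C ≥ 0, ∀ t ∈ Icc (-h) T, ∀ x, |u t x - v (x + c * t)| ≤ C * Real.exp (μ * (x + c * t)) := by
  obtain ⟨C0, hC0, hnear⟩ := P.init_near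
  have hL := P.map.lip_pos
  have hμ := P.rate_pos
  have hh := P.h_pos
  have hc := P.c_pos
  set K := L + μ ^ 2 with hK
  have hK0 : 0 < K := by positivity
  set C := C0 * Real.exp (K * h) with hC
  have hC' : 0 ≤ C := by positivity
  have key : ∀ σ : ℝ, σ = 1 ∨ σ = -1 → ∀ t ≥ -h, ∀ x,
      σ * u t x ≤ σ * v (x + c * t) + C * Real.exp (K * t) * Real.exp (μ * (x + c * t)) := by
    intro σ hσ
    have := P.sol.front_comparison hh P.front P.front_le le_rfl hσ (s := fun _ => 0)
      (s' := fun _ => 0) (p := fun t => C * Real.exp (K * t))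
      (p' := fun t => C * (K * Real.exp (K * t))) (e := fun _ => 0) (e' := fun _ => 0)
      (f := fun z => Real.exp (μ * z)) (f1 := fun z => μ * Real.exp (μ * z))
      (f2 := fun z => μ * (μ * Real.exp (μ * z))) (fun t => hasDerivAt_const _ _)
      (fun t => (hasDerivAt_exp_mul K t).const_mul C) (fun t => hasDerivAt_const _ _)
      (fun z => hasDerivAt_exp_mul μ z) (fun z => (hasDerivAt_exp_mul μ z).const_mul μ)
      (fun t => by positivity) ⟨0, fun z => (Real.exp_pos _).le⟩
      (fun t ht x => by
        rw [zero_sub] at ht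
        have h1 := signed_of_abs_le hσ (hnear t ht x)
        have h2 : 1 ≤ Real.exp (K * h) * Real.exp (K * t) := by
          rw [← Real.exp_add]
          exact Real.one_le_exp (by nlinarith [ht.1])
        have h3 := mul_le_mul_of_nonneg_left h2
          (show 0 ≤ C0 * Real.exp (μ * (x + c * t)) by positivity)
        rw [add_zero, add_zero, hC]
        linarith)
      (fun t ht x _ hle => by
        simp only [add_zero, zero_mul, mul_zero] at hle ⊢
        have h1 := P.map.signed_le hσ (by positivity) hL.le hle (fun _ => P.map.lip _ _)
        have h2 : Real.exp (K * (t - h)) ≤ Real.exp (K * t) := Real.exp_le_exp.2 (by nlinarith)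
        have h3 : Real.exp (μ * (x + c * t - c * h)) ≤ Real.exp (μ * (x + c * t)) :=
          Real.exp_le_exp.2 (by nlinarith [P.delay_nonneg])
        have h4 := mul_le_mul_of_nonneg_left (mul_le_mul (mul_le_mul_of_nonneg_left h2 hC') h3
          (Real.exp_pos _).le (by positivity)) hL.le
        have h5 : 0 ≤ (c * μ + 1) * (C * Real.exp (K * t) * Real.exp (μ * (x + c * t))) := by
          positivity
        rw [hK] at *
        linarith)
    intro t ht x
    have := this t (by linarith) x
    rwa [add_zero, add_zero] at this
  refine ⟨C * Real.exp (K * T), by positivity, fun t ht x => ?_⟩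
  refine (abs_le_of_signed fun σ hσ => key σ hσ t ht.1 x).trans ?_
  have : Real.exp (K * t) ≤ Real.exp (K * T) := Real.exp_le_exp.2 (by nlinarith [ht.2])
  gcongr

lemma init_trap_upper (P : FrontProblem g h c kap g0 L μ v v1 v2 u ut u1 u2) {q : ℝ}
    (hq : 0 < q) : ∃ T ≥ 0, ∃ a ≥ 0, ∀ t ∈ Icc (T - h) T, ∀ x,
      u t x ≤ v (x + c * t + a) + q * logistic μ (x + c * t + a) := by
  obtain ⟨M, hM⟩ := P.init_le
  have hh := P.h_pos
  obtain ⟨T1, hT1, hT2⟩ := P.sol.eventually_le P.map hh hM (δ := q / 4) (by positivity)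
  obtain ⟨C, -, hC⟩ := P.near_of_time_le (T1 + h)
  obtain ⟨Z, hZ⟩ := P.absorb C 1 one_pos
  obtain ⟨Y, hY⟩ := eventually_atTop.1 (P.front.top.eventually_const_le
    (show kap - q / 4 < kap by linarith))
  set a := max 1 (max (-Z) (Y - Z)) with ha
  have ha1 : 1 ≤ a := le_max_left _ _
  have ha2 : -Z ≤ a := (le_max_left _ _).trans (le_max_right _ _)
  have ha3 : Y - Z ≤ a := (le_max_right _ _).trans (le_max_right _ _)
  refine ⟨T1 + h, by linarith, a, by linarith, fun t ht x => ?_⟩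
  rw [add_sub_cancel_right] at ht
  have hl := logistic_pos μ (x + c * t + a)
  rcases le_total (x + c * t) Z with h1 | h1
  · have h2 := (abs_le.1 (hC t ⟨by linarith [ht.1], ht.2⟩ x)).2
    have h3 := P.front_mono (show x + c * t + 1 ≤ x + c * t + a by linarith)
    have := mul_pos hq hl
    linarith [hZ _ h1]
  · have h2 := hY (x + c * t + a) (by linarith)
    have h3 := half_le_logistic P.rate_pos (show 0 ≤ x + c * t + a by linarith)
    have h4 := mul_le_mul_of_nonneg_left h3 hq.le
    linarith [hT2 t ht.1 x]

lemma init_trap_lower (P : FrontProblem g h c kap g0 L μ v v1 v2 u ut u1 u2) {q : ℝ}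
    (hq : 0 < q) : ∃ T ≥ 0, ∃ a ≥ 0, ∀ t ∈ Icc (T - h) T, ∀ x,
      v (x + c * t - a) - q * logistic μ (x + c * t - a) ≤ u t x := by
  obtain ⟨m, hm, X, hmX⟩ := P.init_ge
  have hh := P.h_pos
  have hc := P.c_pos
  have hvk := P.front.lt_kap P.map P.delay_nonneg 0
  have hv0 := P.front.pos 0
  set δ := min (q / 2) (kap - v 0) with hδ
  have hδ0 : 0 < δ := lt_min (by positivity) (by linarith)
  have hδ1 : δ ≤ q / 2 := min_le_left _ _
  have hδ2 : δ ≤ kap - v 0 := min_le_right _ _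
  obtain ⟨T0, hT0, hT1⟩ := P.sol.eventually_ge P.map hh P.init_nonneg hm hmX hδ0 (by linarith)
  set T := T0 + h with hT
  obtain ⟨Y, hY⟩ := hT1 T
  obtain ⟨C, hC0, hC⟩ := P.near_of_time_le T
  obtain ⟨Z, hZ⟩ := P.absorb (C * Real.exp μ) 1 one_pos
  set Xz := max (Y + c * T) (Z + 1) with hXz
  have hposc : ContinuousOn (fun q : ℝ × ℝ => u q.1 (q.2 - c * q.1))
      (Icc T0 T ×ˢ Icc (Z + 1) Xz) := by
    have h1 : ContinuousOn (fun q : ℝ × ℝ => (q.1, q.2 - c * q.1)) (Icc T0 T ×ˢ Icc (Z + 1) Xz) :=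
      Continuous.continuousOn (by fun_prop)
    refine P.sol.cont.comp h1 fun q hq => ?_
    have := hq.1.1
    change -h ≤ q.1
    linarith
  obtain ⟨⟨t1, z1⟩, ⟨ht1, hz1⟩, hmin⟩ := (isCompact_Icc.prod isCompact_Icc).exists_isMinOn
    ⟨(T0, Z + 1), ⟨⟨le_rfl, by linarith⟩, ⟨le_rfl, le_max_right _ _⟩⟩⟩ hposc
  have hm1 : 0 < u t1 (z1 - c * t1) :=
    P.sol.pos P.map hh P.init_nonneg hm hmX (hT0.trans_le ht1.1) _
  obtain ⟨W, hW⟩ := eventually_atBot.1 (P.front.bot.eventually_le_const hm1)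
  set a := max 1 (Xz - W) with ha
  have ha1 : 1 ≤ a := le_max_left _ _
  have ha2 : Xz - W ≤ a := le_max_right _ _
  refine ⟨T, by linarith, a, by linarith, fun t ht x => ?_⟩
  rw [hT, add_sub_cancel_right, ← hT] at ht
  have hl := mul_pos hq (logistic_pos μ (x + c * t - a))
  rcases le_total (x + c * t) (Z + 1) with h1 | h1
  · have h2 := (abs_le.1 (hC t ⟨by linarith [ht.1], ht.2⟩ x)).1
    have h3 := P.front_mono (show x + c * t - a ≤ x + c * t - 1 by linarith)
    have h4 := hZ (x + c * t - 1) (by linarith)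
    rw [mul_assoc, ← Real.exp_add, sub_add_cancel,
      show μ + μ * (x + c * t - 1) = μ * (x + c * t) by ring] at h4
    linarith
  rcases le_total (x + c * t) Xz with h2 | h2
  · have h3 : u t1 (z1 - c * t1) ≤ u t (x + c * t - c * t) :=
      hmin (a := (t, x + c * t)) ⟨ht, h1, h2⟩
    rw [add_sub_cancel_right] at h3
    have h4 := hW (x + c * t - a) (by linarith)
    linarith
  · have h3 := hY t ht x (by nlinarith [le_max_left (Y + c * T) (Z + 1), ht.2])
    rcases le_total 0 (x + c * t - a) with h4 | h4
    · have h5 := mul_le_mul_of_nonneg_left (half_le_logistic P.rate_pos h4) hq.le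
      linarith [P.front_le (x + c * t - a)]
    · linarith [P.front_mono h4]

lemma init_trap (P : FrontProblem g h c kap g0 L μ v v1 v2 u ut u1 u2) {σ : ℝ}
    (hσ : σ = 1 ∨ σ = -1) {q : ℝ} (hq : 0 < q) :
    ∃ T ≥ 0, ∃ a ≥ 0, ∀ t ∈ Icc (T - h) T, ∀ x,
      σ * u t x ≤ σ * v (x + c * t + σ * a) + q * logistic μ (x + c * t + σ * a) := by
  rcases hσ with rfl | rfl
  · obtain ⟨T, hT, a, ha, hb⟩ := P.init_trap_upper hq
    exact ⟨T, hT, a, ha, fun t ht x => by simpa using hb t ht x⟩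
  · obtain ⟨T, hT, a, ha, hb⟩ := P.init_trap_lower hq
    refine ⟨T, hT, a, ha, fun t ht x => ?_⟩
    have := hb t ht x
    rw [show x + c * t + -1 * a = x + c * t - a by ring]
    linarith

end FrontProblem

lemma MonostableMap.lin_zero_lip {g : ℝ → ℝ} {kap g0 L : ℝ} (hg : MonostableMap g kap g0 L) {ε : ℝ} (hε : 0 < ε) :
    ∃ δ > 0, ∀ x y, |x| ≤ δ → |y| ≤ δ → |g x - g y| ≤ (g0 + ε) * |x - y| := by
  obtain ⟨δ, hδ, hlin⟩ := hg.lin_zero ε hε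
  refine ⟨δ, hδ, fun x y hx hy => ?_⟩
  have h1 := abs_add_le (g x - g y - g0 * (x - y)) (g0 * (x - y))
  rw [sub_add_cancel, abs_mul g0, abs_of_pos (show 0 < g0 by linarith [hg.one_lt])] at h1
  linarith [hlin x y hx hy]

section Weight
variable {A L K c μ q τ l e d : ℝ}

lemma weight_ineq_left (hμ : 0 < μ) (hc : 0 < c) (hq : 0 < q) (hl0 : 0 < l) (hl1 : l < 1)
    (hlτ : l ≤ τ) (hA : A ≤ 1 - τ + c * μ * (1 - τ) - μ ^ 2) (he : e ≤ A * (q * l)) :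
    e ≤ q * (-(τ * l) + c * (μ * (l * (1 - l))) - μ ^ 2 * (l * ((1 - l) * (1 - 2 * l))) + l) := by
  have h7 := mul_le_mul_of_nonneg_right hA (mul_pos hq hl0).le
  have h8 : c * μ * (1 - τ) ≤ c * μ * (1 - l) :=
    mul_le_mul_of_nonneg_left (by linarith) (by positivity)
  have h9 := mul_le_mul_of_nonneg_right h8 (mul_pos hq hl0).le
  have h10 : (1 - l) * (1 - 2 * l) ≤ 1 := by nlinarith
  have h11 := mul_le_mul_of_nonneg_left h10 (mul_pos hq (mul_pos (sq_pos_of_pos hμ) hl0)).le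
  linarith

lemma weight_ineq_middle (hμ : 0 < μ) (hc : 0 < c) (hq : 0 < q) (hl0 : 0 < l) (hl1 : l < 1)
    (hτ : τ ≤ 1) (hA : A + μ ^ 2 ≤ d) (he : e ≤ A * q) :
    e ≤ d * q + q * (-(τ * l) + c * (μ * (l * (1 - l))) -
      μ ^ 2 * (l * ((1 - l) * (1 - 2 * l))) + l) := by
  have hdl : 0 ≤ l * (1 - l) := mul_nonneg hl0.le (by linarith)
  have h5 : l * ((1 - l) * (1 - 2 * l)) ≤ 1 := by
    have h6 : (1 - l) * (1 - 2 * l) ≤ 1 := by nlinarith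
    nlinarith
  have h7 := mul_le_mul_of_nonneg_left h5 (mul_pos hq (sq_pos_of_pos hμ)).le
  have h8 := mul_nonneg hq.le (mul_nonneg (mul_pos hc hμ).le hdl)
  have h9 : 0 ≤ q * (l * (1 - τ)) := mul_nonneg hq.le (mul_nonneg hl0.le (by linarith))
  have h10 := mul_le_mul_of_nonneg_right hA hq.le
  linarith

lemma weight_ineq_right (hμ : 0 < μ) (hc : 0 < c) (hq : 0 < q) (hl0 : 1 / 2 ≤ l) (hl1 : l < 1)
    (hA : A ≤ 1 - τ) (he : e ≤ A * (q * l)) :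
    e ≤ q * (-(τ * l) + c * (μ * (l * (1 - l))) - μ ^ 2 * (l * ((1 - l) * (1 - 2 * l))) + l) := by
  have hl : 0 < l := by linarith
  have hdl : 0 ≤ l * (1 - l) := mul_nonneg hl.le (by linarith)
  have h4 := mul_le_mul_of_nonneg_right hA (mul_pos hq hl).le
  have h5 := mul_nonneg hq.le (mul_nonneg (mul_pos hc hμ).le hdl)
  have h6 : 0 ≤ q * (μ ^ 2 * (l * (1 - l) * (2 * l - 1))) := by
    have : 0 ≤ 2 * l - 1 := by linarith
    positivity
  linarith

end Weight

namespace FrontProblem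
variable {g : ℝ → ℝ} {h c kap g0 L μ : ℝ} {v v1 v2 : ℝ → ℝ} {u ut u1 u2 : ℝ → ℝ → ℝ}

lemma exists_contraction_rate (P : FrontProblem g h c kap g0 L μ v v1 v2 u ut u1 u2) {ρ : ℝ}
    (hρ : ρ < 1) : ∃ τ, 0 < τ ∧ τ < 1 ∧
      (g0 + τ) * Real.exp (τ * h) * (Real.exp (-(μ * (c * h))) * (1 + τ)) ≤
        1 - τ + c * μ * (1 - τ) - μ ^ 2 ∧ ρ * Real.exp (τ * h) ≤ 1 - τ := by
  have hc1 : Continuous fun τ : ℝ => (g0 + τ) * Real.exp (τ * h) *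
      (Real.exp (-(μ * (c * h))) * (1 + τ)) - (1 - τ + c * μ * (1 - τ) - μ ^ 2) := by fun_prop
  have hc2 : Continuous fun τ : ℝ => ρ * Real.exp (τ * h) - (1 - τ) := by fun_prop
  have hchi := P.chi_neg
  rw [chi, mul_assoc] at hchi
  have e1 := (hc1.tendsto 0).eventually_lt_const (u := 0) (by simp; linarith)
  have e2 := (hc2.tendsto 0).eventually_lt_const (u := 0) (by simp; linarith)
  have e3 : ∀ᶠ τ : ℝ in nhdsWithin 0 (Ioi 0), τ ∈ Ioo (0:ℝ) 1 := Ioo_mem_nhdsGT one_pos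
  obtain ⟨τ, ⟨h1, h2⟩, h3⟩ := (((e1.and e2).filter_mono nhdsWithin_le_nhds).and e3).exists
  exact ⟨τ, h3.1, h3.2, by linarith, by linarith⟩

/-- The differential inequality behind the trapping of the solution between shifted fronts. -/
lemma exists_trap_ineq (P : FrontProblem g h c kap g0 L μ v v1 v2 u ut u1 u2) {σ : ℝ}
    (hσ : σ = 1 ∨ σ = -1) : ∃ τ > 0, ∃ K > 0, ∃ q0 > 0, ∀ q > 0, q ≤ q0 → ∀ y ζ a : ℝ,
      |ζ - y| ≤ 1 →
      σ * a ≤ σ * v (ζ - c * h) + Real.exp (τ * h) * q * logistic μ (y - c * h) →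
      σ * (g a - g (v (ζ - c * h))) ≤ K * q * v1 ζ + q * (-(τ * logistic μ y) +
        c * (μ * (logistic μ y * (1 - logistic μ y))) -
        μ ^ 2 * (logistic μ y * ((1 - logistic μ y) * (1 - 2 * logistic μ y))) +
        logistic μ y) := by
  have hg := P.map
  have hL := hg.lip_pos
  have hμ := P.rate_pos
  have hh := P.h_pos
  have hc := P.c_pos
  have hch := P.delay_nonneg
  obtain ⟨ρ, δ2, hρ0, hρ1, hδ2, hcontr⟩ := hg.contr_kap
  obtain ⟨τ, hτ, hτ1, hleft, hright⟩ := P.exists_contraction_rate hρ1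
  obtain ⟨δ1, hδ1, hlin⟩ := hg.lin_zero_lip hτ
  set δ := min δ1 δ2 with hδ
  have hδ0 : 0 < δ := lt_min hδ1 hδ2
  have hδ1' : δ ≤ δ1 := min_le_left _ _
  have hδ2' : δ ≤ δ2 := min_le_right _ _
  obtain ⟨Z1, hZ1⟩ := eventually_atBot.1 (P.front.bot.eventually_le_const (half_pos hδ0))
  obtain ⟨Z2, hZ2⟩ := eventually_atTop.1 (P.front.top.eventually_const_le
    (show kap - δ / 2 < kap by linarith))
  obtain ⟨Z3, hZ3⟩ := eventually_atBot.1 ((Real.tendsto_exp_atBot.comp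
    (tendsto_id.const_mul_atBot hμ)).eventually_le_const hτ)
  simp only [Function.comp_apply, id_eq] at hZ3
  set Z := max 0 (max (1 - Z1) (max (Z2 + 1 + c * h) (-Z3))) with hZ
  have hZa : 0 ≤ Z := le_max_left _ _
  have hZb : 1 - Z1 ≤ Z := (le_max_left _ _).trans (le_max_right _ _)
  have hZc : Z2 + 1 + c * h ≤ Z :=
    (le_max_left _ _).trans ((le_max_right _ _).trans (le_max_right _ _))
  have hZd : -Z3 ≤ Z :=
    (le_max_right _ _).trans ((le_max_right _ _).trans (le_max_right _ _))
  have hv1c : Continuous v1 := continuous_iff_continuousAt.2 fun z => (P.front.d2 z).continuousAt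
  obtain ⟨k0, hk0, hk⟩ := exists_pos_le_of_compact hv1c (a := -Z - 1) (b := Z + 1) (by linarith)
    (fun x _ => P.front.deriv_pos hg hch x)
  set E := Real.exp (τ * h) with hE
  have hE0 : 0 < E := Real.exp_pos _
  set K := (L * E + μ ^ 2) / k0 with hK
  have hK0 : 0 < K := by positivity
  have hKk : K * k0 = L * E + μ ^ 2 := div_mul_cancel₀ _ hk0.ne'
  refine ⟨τ, hτ, K, hK0, δ / (2 * E), by positivity, fun q hq hq0 y ζ a hζ hle => ?_⟩
  rw [le_div_iff₀ (by positivity)] at hq0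
  rw [abs_le] at hζ
  have hl0 := logistic_pos μ y
  have hl1 := logistic_lt_one μ y
  have hlh0 := logistic_pos μ (y - c * h)
  have hlh1 := logistic_lt_one μ (y - c * h)
  have hsub := logistic_sub_le μ y (c * h)
  have hlmono := logistic_mono hμ (show y - c * h ≤ y by linarith)
  have hhalf : Z ≤ y → 1 / 2 ≤ logistic μ y := fun hy => half_le_logistic hμ (hZa.trans hy)
  have hv1 := P.front.deriv_pos hg hch ζ
  set l := logistic μ y
  set lh := logistic μ (y - c * h)
  set b := v (ζ - c * h) with hb
  have hb0 : 0 < b := P.front.pos _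
  have hbk : b ≤ kap := P.front_le _
  have he0 : 0 ≤ E * q * lh := by positivity
  have heδ : E * q * lh ≤ δ / 2 := by nlinarith [mul_pos hE0 hq]
  have hKv : 0 ≤ K * q * v1 ζ := by positivity
  rcases le_total y (-Z) with hy | hy
  · have h1 : b ≤ δ / 2 := hZ1 _ (by linarith)
    have h2 : Real.exp (μ * y) ≤ τ := hZ3 y (by linarith)
    have h3 : l ≤ τ := (logistic_le_exp μ y).trans h2
    have h4 := hg.signed_le hσ he0 (show 0 ≤ g0 + τ by linarith [hg.one_lt]) hle (fun hab =>
      hlin _ _ (by rw [abs_le] at hab ⊢; constructor <;> linarith [hab.1, hab.2])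
        (by rw [abs_le]; constructor <;> linarith))
    have h5 : lh ≤ Real.exp (-(μ * (c * h))) * (1 + τ) * l := by
      refine hsub.trans (mul_le_mul_of_nonneg_right ?_ hl0.le)
      exact mul_le_mul_of_nonneg_left (by linarith) (Real.exp_pos _).le
    have h6 : (g0 + τ) * (E * q * lh) ≤
        (g0 + τ) * (E * q * (Real.exp (-(μ * (c * h))) * (1 + τ) * l)) := by
      have : 0 ≤ g0 + τ := by linarith [hg.one_lt]
      gcongr
    have h7 := weight_ineq_left hμ hc hq hl0 hl1 h3 hleft
      (h4.trans (h6.trans_eq (by ring)))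
    linarith
  rcases le_total y Z with hy2 | hy2
  · have h1 := hk ζ ⟨by linarith, by linarith⟩
    have h2 := hg.signed_le hσ he0 hL.le hle (fun _ => hg.lip _ _)
    have h3 := mul_le_mul_of_nonneg_left hlh1.le (mul_pos hL (mul_pos hE0 hq)).le
    have h4 := mul_le_mul_of_nonneg_left h1 hK0.le
    have h5 := weight_ineq_middle (A := L * E) (d := K * v1 ζ) hμ hc hq hl0 hl1 hτ1.le
      (by linarith) (h2.trans (by linarith))
    linarith
  · have h1 : kap - δ / 2 ≤ b := hZ2 _ (by linarith)
    have h2 := hg.signed_le hσ he0 hρ0 hle (fun hab =>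
      hcontr _ _ (by rw [abs_le] at hab ⊢; constructor <;> linarith [hab.1, hab.2])
        (by rw [abs_le]; constructor <;> linarith))
    have h3 := mul_le_mul_of_nonneg_left hlmono (mul_nonneg hρ0 (mul_pos hE0 hq).le)
    have h4 := weight_ineq_right hμ hc hq (hhalf hy2) hl1 hright (h2.trans (by linarith))
    linarith

/-- The solution is trapped between shifted fronts up to an exponentially decaying error. -/
lemma trap (P : FrontProblem g h c kap g0 L μ v v1 v2 u ut u1 u2) {σ : ℝ}
    (hσ : σ = 1 ∨ σ = -1) : ∃ T ≥ 0, ∃ a ≥ 0, ∃ b, ∃ Q ≥ 0, ∃ γ > 0, ∀ t ≥ T, ∀ x,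
      σ * u t x ≤ σ * v (x + c * t + σ * a) +
        Q * Real.exp (-(γ * t)) * logistic μ (x + c * t + b) := by
  have hμ := P.rate_pos
  have hh := P.h_pos
  obtain ⟨γ, hγ, K, hK, q0, hq0, hineq⟩ := P.exists_trap_ineq hσ
  set E := Real.exp (γ * h) with hE
  have hE0 : 0 < E := Real.exp_pos _
  set q1 := min q0 (γ / (K * E)) with hq1
  have hq10 : 0 < q1 := lt_min hq0 (by positivity)
  have hq11 : q1 ≤ q0 := min_le_left _ _
  have hq12 : K * q1 / γ * E ≤ 1 := by
    have : q1 ≤ γ / (K * E) := min_le_right _ _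
    rw [le_div_iff₀ (by positivity)] at this
    rw [div_mul_eq_mul_div, div_le_one hγ]
    linarith
  obtain ⟨T, hT, a, ha, hinit⟩ := P.init_trap hσ hq10
  set Q := q1 * Real.exp (γ * T) with hQ
  have hQ0 : 0 < Q := by positivity
  have hQe : ∀ t, Q * Real.exp (-(γ * t)) = q1 * Real.exp (γ * (T - t)) := by
    intro t
    rw [hQ, mul_assoc, ← Real.exp_add]
    ring_nf
  set ξ : ℝ → ℝ := fun t => K * q1 / γ * E + -(K * Q / γ) * Real.exp (-(γ * t)) with hξ
  have hξd : ∀ t, HasDerivAt ξ (K * (Q * Real.exp (-(γ * t)))) t := by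
    intro t
    refine (hasDerivAt_relax (K * q1 / γ * E) (-(K * Q / γ)) γ t).congr_deriv ?_
    field_simp
  have hξmono : ∀ t, ξ (t - h) ≤ ξ t := by
    intro t
    have h1 : Real.exp (-(γ * t)) ≤ Real.exp (-(γ * (t - h))) := Real.exp_le_exp.2 (by nlinarith)
    have h2 := mul_le_mul_of_nonneg_left h1 (show 0 ≤ K * Q / γ by positivity)
    simp only [hξ]
    linarith
  have hξ1 : ∀ t, ξ t ≤ 1 := by
    intro t
    have : 0 ≤ K * Q / γ * Real.exp (-(γ * t)) := by positivity
    simp only [hξ]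
    linarith
  have hξ0 : ∀ t ≥ T - h, 0 ≤ ξ t := by
    intro t ht
    have h1 : K * Q / γ * Real.exp (-(γ * t)) = K * q1 / γ * Real.exp (γ * (T - t)) := by
      rw [div_mul_eq_mul_div, mul_assoc, hQe]; ring
    have h2 : Real.exp (γ * (T - t)) ≤ E := Real.exp_le_exp.2 (by nlinarith)
    have h3 := mul_le_mul_of_nonneg_left h2 (show 0 ≤ K * q1 / γ by positivity)
    simp only [hξ]
    linarith
  have key := P.sol.front_comparison hh P.front P.front_le hT hσ
    (s := fun t => σ * (a + ξ t)) (s' := fun t => σ * (K * (Q * Real.exp (-(γ * t)))))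
    (p := fun t => 0 + Q * Real.exp (-(γ * t))) (p' := fun t => -(γ * (Q * Real.exp (-(γ * t)))))
    (e := fun _ => 0) (e' := fun _ => 0) (f := fun z => logistic μ (z + σ * a))
    (f1 := fun z => μ * (logistic μ (z + σ * a) * (1 - logistic μ (z + σ * a))))
    (f2 := fun z => μ ^ 2 * (logistic μ (z + σ * a) *
      ((1 - logistic μ (z + σ * a)) * (1 - 2 * logistic μ (z + σ * a)))))
    (fun t => ((hξd t).const_add a).const_mul σ) (fun t => hasDerivAt_relax 0 Q γ t)
    (fun t => hasDerivAt_const _ _)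
    (fun z => (hasDerivAt_logistic μ _).comp_add_const z (σ * a))
    (fun z => (hasDerivAt_deriv_logistic μ _).comp_add_const z (σ * a))
    (fun t => by positivity) ⟨0, fun z => (logistic_pos _ _).le⟩
    (fun t ht x => by
      have h1 := hinit t ht x
      have h2 := P.signed_mono hσ (show a ≤ a + ξ t by linarith [hξ0 t ht.1]) (x + c * t)
      have h3 : 1 ≤ Real.exp (γ * (T - t)) := Real.one_le_exp (by nlinarith [ht.2])
      have h4 := mul_le_mul_of_nonneg_left h3
        (mul_pos hq10 (logistic_pos μ (x + c * t + σ * a))).le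
      rw [add_zero, zero_add, hQe]
      linarith)
    (fun t ht x _ hle => by
      have hq := hQe t
      set q := Q * Real.exp (-(γ * t)) with hqdef
      have hq0' : 0 < q := by positivity
      have hql : q ≤ q0 := by
        have : Real.exp (γ * (T - t)) ≤ 1 := Real.exp_le_one_iff.2 (by nlinarith)
        nlinarith
      have hqh : Q * Real.exp (-(γ * (t - h))) = E * q := by
        rw [hqdef, hE, mul_left_comm, ← Real.exp_add]; ring_nf
      set y := x + c * t + σ * a with hy
      have h1 : x + c * t + σ * (a + ξ t) = y + σ * ξ t := by rw [hy]; ring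
      have h2 := P.signed_mono hσ (show a + ξ (t - h) ≤ a + ξ t by linarith [hξmono t])
        (x + c * t - c * h)
      have h3 : x + c * t - c * h + σ * (a + ξ t) = y + σ * ξ t - c * h := by rw [hy]; ring
      have h4 : x + c * t - c * h + σ * a = y - c * h := by rw [hy]; ring
      rw [h3] at h2
      simp only [add_zero, zero_add, h4, hqh] at hle
      have h5 := hineq q hq0' hql y (y + σ * ξ t) (u (t - h) x) (by
        rw [add_sub_cancel_left, abs_le]
        have := hξ0 t (by linarith)
        have := hξ1 t
        rcases hσ with rfl | rfl <;> constructor <;> linarith) (by linarith)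
      simp only [h1, zero_add, add_zero]
      have hσ2 : σ * (σ * (K * q) * v1 (y + σ * ξ t)) = K * q * v1 (y + σ * ξ t) := by
        rcases hσ with rfl | rfl <;> ring
      rw [hσ2]
      linarith)
  refine ⟨T, hT, a + 1, by linarith, σ * a, Q, hQ0.le, γ, hγ, fun t ht x => ?_⟩
  have h1 := key t (by linarith) x
  have h2 := P.signed_mono hσ (show a + ξ t ≤ a + 1 by linarith [hξ1 t]) (x + c * t)
  rw [add_zero, zero_add] at h1
  linarith

end FrontProblem

namespace FrontProblem
variable {g : ℝ → ℝ} {h c kap g0 L μ : ℝ} {v v1 v2 : ℝ → ℝ} {u ut u1 u2 : ℝ → ℝ → ℝ}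

lemma eventually_small (P : FrontProblem g h c kap g0 L μ v v1 v2 u ut u1 u2) {δ : ℝ}
    (hδ : 0 < δ) : ∃ T ≥ 0, ∃ Z, ∀ t ≥ T, ∀ x, x + c * t ≤ Z → u t x ≤ δ := by
  obtain ⟨T, hT, a, -, b, Q, hQ, γ, hγ, htr⟩ := P.trap (Or.inl rfl)
  have h1 : Tendsto (fun z => v (z + a) + Q * Real.exp (μ * (z + b))) atBot (nhds (0 + Q * 0)) :=
    (P.front.bot.comp (tendsto_atBot_add_const_right _ a tendsto_id)).add
      ((Real.tendsto_exp_atBot.comp ((tendsto_atBot_add_const_right _ b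
        tendsto_id).const_mul_atBot P.rate_pos)).const_mul Q)
  obtain ⟨Z, hZ⟩ := eventually_atBot.1 (h1.eventually_le_const (u := δ) (by simpa using hδ))
  refine ⟨T, hT, Z, fun t ht x hx => ?_⟩
  have h2 := htr t ht x
  have h3 := hZ _ hx
  have h4 : Real.exp (-(γ * t)) ≤ 1 :=
    Real.exp_le_one_iff.2 (by nlinarith [mul_nonneg hγ.le (hT.trans ht)])
  have h5 := mul_le_mul (mul_le_mul_of_nonneg_left h4 hQ) (logistic_le_exp μ (x + c * t + b))
    (logistic_pos _ _).le (by linarith)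
  simp only [one_mul, mul_one] at h2 h5
  linarith

/-- `a` is an asymptotic shift of the solution on the side `σ`. -/
def AsympShift (c : ℝ) (v : ℝ → ℝ) (u : ℝ → ℝ → ℝ) (σ a : ℝ) : Prop :=
  ∀ ε > 0, ∃ T ≥ 0, ∀ t ≥ T, ∀ x, σ * u t x ≤ σ * v (x + c * t + σ * a) + ε

lemma exists_asympShift (P : FrontProblem g h c kap g0 L μ v v1 v2 u ut u1 u2) {σ : ℝ}
    (hσ : σ = 1 ∨ σ = -1) : ∃ a ≥ 0, AsympShift c v u σ a := by
  obtain ⟨T, hT, a, ha, b, Q, hQ, γ, hγ, htr⟩ := P.trap hσ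
  refine ⟨a, ha, fun ε hε => ?_⟩
  obtain ⟨S, hS, hS2⟩ := exists_exp_neg_mul_le Q hγ hε
  refine ⟨max T S, hT.trans (le_max_left _ _), fun t ht x => ?_⟩
  have h1 := htr t ((le_max_left _ _).trans ht) x
  have h2 := hS2 t ((le_max_right _ _).trans ht)
  have h3 := mul_le_mul_of_nonneg_left (logistic_lt_one μ (x + c * t + b)).le
    (show 0 ≤ Q * Real.exp (-(γ * t)) by positivity)
  linarith

lemma eventually_near_kap (P : FrontProblem g h c kap g0 L μ v v1 v2 u ut u1 u2) {δ : ℝ}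
    (hδ : 0 < δ) : ∃ T ≥ 0, ∃ Z, ∀ t ≥ T, ∀ x, Z ≤ x + c * t → |u t x - kap| ≤ δ := by
  obtain ⟨a1, -, h1⟩ := P.exists_asympShift (Or.inl rfl)
  obtain ⟨a2, -, h2⟩ := P.exists_asympShift (Or.inr rfl)
  obtain ⟨T1, hT1, h1⟩ := h1 δ hδ
  obtain ⟨T2, -, h2⟩ := h2 (δ / 2) (half_pos hδ)
  obtain ⟨Y, hY⟩ := eventually_atTop.1 (P.front.top.eventually_const_le
    (show kap - δ / 2 < kap by linarith))
  refine ⟨max T1 T2, hT1.trans (le_max_left _ _), Y + a2, fun t ht x hx => ?_⟩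
  have h3 := h1 t ((le_max_left _ _).trans ht) x
  have h4 := h2 t ((le_max_right _ _).trans ht) x
  have h5 := P.front_le (x + c * t + 1 * a1)
  have h6 := hY (x + c * t + -1 * a2) (by linarith)
  rw [abs_le]
  constructor <;> linarith

lemma near (P : FrontProblem g h c kap g0 L μ v v1 v2 u ut u1 u2) :
    ∃ C ≥ 0, ∃ T ≥ 0, ∀ t ≥ T, ∀ x,
      |u t x - v (x + c * t)| ≤ C * Real.exp (μ * (x + c * t)) := by
  have hg := P.map
  have hμ := P.rate_pos
  have hh := P.h_pos
  have hc := P.c_pos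
  have hch := P.delay_nonneg
  have hg0 := hg.one_lt
  obtain ⟨τ, hτ, hτ1, hrate, -⟩ := P.exists_contraction_rate zero_lt_one
  have hrate' : (g0 + τ) * Real.exp (-(μ * (c * h))) ≤ 1 + c * μ - μ ^ 2 := by
    have h1 : 1 ≤ Real.exp (τ * h) := Real.one_le_exp (by positivity)
    have h2 : 0 ≤ (g0 + τ) * Real.exp (-(μ * (c * h))) := by positivity
    have h3 : 1 ≤ Real.exp (τ * h) * (1 + τ) := by nlinarith
    have h4 := mul_le_mul_of_nonneg_left h3 h2
    have h5 : 0 ≤ c * μ * τ := by positivity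
    linarith
  obtain ⟨δ, hδ, hlin⟩ := hg.lin_zero_lip hτ
  obtain ⟨T, hT, Z1, hsmall⟩ := P.eventually_small hδ
  obtain ⟨Z2, hZ2⟩ := eventually_atBot.1 (P.front.bot.eventually_le_const hδ)
  obtain ⟨M, hM⟩ := P.init_le
  obtain ⟨B, hB⟩ := P.sol.bounded hg hh hM
  obtain ⟨C0, hC0, hnear⟩ := P.near_of_time_le (T + h)
  set Z := min Z1 Z2 with hZ
  have hkap := hg.kap_pos
  set C := max C0 ((|B| + kap) * Real.exp (-(μ * Z))) with hC
  have hC1 : C0 ≤ C := le_max_left _ _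
  have hC2 : (|B| + kap) * Real.exp (-(μ * Z)) ≤ C := le_max_right _ _
  have hC' : 0 ≤ C := hC0.trans hC1
  have hbd : ∀ σ : ℝ, σ = 1 ∨ σ = -1 → ∀ t ≥ 0, ∀ x, σ * u t x ≤ σ * v (x + c * t) + (|B| + kap) := by
    intro σ hσ t ht x
    have h1 := hB t (by linarith) x
    have h2 := P.sol_nonneg t (by linarith) x
    have h3 := P.front.pos (x + c * t)
    have h4 := P.front_le (x + c * t)
    rcases hσ with rfl | rfl <;> linarith [le_abs_self B, abs_nonneg B]
  refine ⟨C, hC', T + h, by linarith, fun t ht x => ?_⟩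
  refine abs_le_of_signed fun σ hσ => ?_
  have key := P.sol.front_comparison hh P.front P.front_le (show 0 ≤ T + h by linarith) hσ
    (s := fun _ => 0) (s' := fun _ => 0) (p := fun _ => C) (p' := fun _ => 0)
    (e := fun _ => 0) (e' := fun _ => 0)
    (f := fun z => Real.exp (μ * z)) (f1 := fun z => μ * Real.exp (μ * z))
    (f2 := fun z => μ * (μ * Real.exp (μ * z))) (fun t => hasDerivAt_const _ _)
    (fun t => hasDerivAt_const _ _) (fun t => hasDerivAt_const _ _)
    (fun z => hasDerivAt_exp_mul μ z) (fun z => (hasDerivAt_exp_mul μ z).const_mul μ)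
    (fun t => hC') ⟨0, fun z => (Real.exp_pos _).le⟩
    (fun t ht x => by
      rw [add_sub_cancel_right] at ht
      have h1 := signed_of_abs_le hσ (hnear t ⟨by linarith [ht.1], ht.2⟩ x)
      have h2 := mul_le_mul_of_nonneg_right hC1 (Real.exp_pos (μ * (x + c * t))).le
      rw [add_zero, add_zero]
      linarith)
    (fun t ht x hlt hle => by
      simp only [add_zero, zero_mul, mul_zero, zero_add] at hlt hle ⊢
      have hzZ : x + c * t < Z := by
        by_contra! hz
        have h1 := hbd σ hσ t (by linarith) x
        have h2 : 1 ≤ Real.exp (-(μ * Z)) * Real.exp (μ * (x + c * t)) := by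
          rw [← Real.exp_add]
          exact Real.one_le_exp (by nlinarith)
        have h3 := mul_le_mul_of_nonneg_left h2 (show 0 ≤ |B| + kap by positivity)
        have h4 := mul_le_mul_of_nonneg_right hC2 (Real.exp_pos (μ * (x + c * t))).le
        linarith
      have h1 : u (t - h) x ≤ δ := hsmall (t - h) (by linarith) x (by
        have := min_le_left Z1 Z2
        nlinarith)
      have h2 : v (x + c * t - c * h) ≤ δ := hZ2 _ (by linarith [min_le_right Z1 Z2])
      have h3 := P.sol_nonneg (t - h) (by linarith) x
      have h4 := P.front.pos (x + c * t - c * h)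
      have h5 := hg.signed_le hσ (by positivity) (show 0 ≤ g0 + τ by linarith) hle
        (fun _ => hlin _ _ (by rw [abs_of_nonneg h3]; exact h1)
          (by rw [abs_of_pos h4]; exact h2))
      have h6 : Real.exp (μ * (x + c * t - c * h)) =
          Real.exp (-(μ * (c * h))) * Real.exp (μ * (x + c * t)) := by
        rw [← Real.exp_add]; ring_nf
      rw [h6] at h5
      have h7 := mul_le_mul_of_nonneg_right hrate'
        (mul_nonneg hC' (Real.exp_pos (μ * (x + c * t))).le)
      linarith)
  have := key t (by linarith) x
  rwa [add_zero, add_zero] at this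

lemma absorb_signed (P : FrontProblem g h c kap g0 L μ v v1 v2 u ut u1 u2) {σ : ℝ}
    (hσ : σ = 1 ∨ σ = -1) (C : ℝ) {b : ℝ} (hb : 0 < b) :
    ∃ Z, ∀ z ≤ Z, σ * v z + C * Real.exp (μ * z) ≤ σ * v (z + σ * b) := by
  rcases hσ with rfl | rfl
  · simpa using P.absorb C b hb
  · obtain ⟨Z, hZ⟩ := P.absorb (C * Real.exp (μ * b)) b hb
    refine ⟨Z, fun z hz => ?_⟩
    have h1 := hZ (z - b) (by linarith)
    rw [mul_assoc, ← Real.exp_add, sub_add_cancel,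
      show μ * b + μ * (z - b) = μ * z by ring] at h1
    rw [show z + -1 * b = z - b by ring]
    linarith

lemma exists_barrier_exponent (hc : 0 < c) :
    ∃ ν > 1, ν ^ 2 + c * ν - 1 ≤ c * Real.exp (ν - 1) := by
  have h1 : Tendsto (fun ν : ℝ => Real.exp ν / ν ^ 2) atTop atTop := Real.tendsto_exp_div_pow_atTop 2
  obtain ⟨ν, hν1, hν⟩ := ((eventually_gt_atTop 1).and
    (h1.eventually_ge_atTop ((1 + c) * Real.exp 1 / c))).exists
  have hν0 : 0 < ν := by linarith
  refine ⟨ν, hν1, ?_⟩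
  rw [div_le_div_iff₀ hc (by positivity)] at hν
  rw [Real.exp_sub, mul_div_assoc', le_div_iff₀ (Real.exp_pos 1)]
  have h2 : ν ^ 2 + c * ν - 1 ≤ (1 + c) * ν ^ 2 := by nlinarith [mul_pos hc (mul_pos hν0 (sub_pos.2 hν1))]
  have := mul_le_mul_of_nonneg_right h2 (Real.exp_pos 1).le
  linarith

lemma barrier_sub {ν y : ℝ} (hν : 1 < ν) (hνc : ν ^ 2 + c * ν - 1 ≤ c * Real.exp (ν - 1))
    (hc : 0 < c) (hy : 1 ≤ y) :
    (ν ^ 2 + c * ν - 1) * Real.exp (-(ν * y)) ≤ c * Real.exp (-y) := by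
  refine (mul_le_mul_of_nonneg_right hνc (Real.exp_pos _).le).trans ?_
  rw [mul_assoc, ← Real.exp_add]
  exact mul_le_mul_of_nonneg_left (Real.exp_le_exp.2 (by nlinarith)) hc.le

/-- A gap on an interval propagates to the right of it. -/
lemma gap_propagation (P : FrontProblem g h c kap g0 L μ v v1 v2 u ut u1 u2) {σ a : ℝ}
    (hσ : σ = 1 ∨ σ = -1) (ha : AsympShift c v u σ a) {k Z T : ℝ} (hk : 0 < k) (hT : 0 ≤ T)
    (hleft : ∀ t ≥ T, ∀ x, x + c * t ≤ Z → σ * u t x ≤ σ * v (x + c * t + σ * a))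
    (hgap : ∀ t ≥ T, ∀ x, x + c * t ∈ Icc (Z - 1) Z →
      σ * u t x + k ≤ σ * v (x + c * t + σ * a)) (Y : ℝ) :
    ∃ θ > 0, ∃ S ≥ 0, ∀ t ≥ S, ∀ x, x + c * t ∈ Icc Z Y →
      σ * u t x + θ ≤ σ * v (x + c * t + σ * a) := by
  have hg := P.map
  have hL := hg.lip_pos
  have hh := P.h_pos
  have hc := P.c_pos
  rcases lt_or_ge Y Z with hYZ | hYZ
  · exact ⟨1, one_pos, 0, le_rfl, fun t _ x hx => absurd (hx.1.trans hx.2) (not_le.2 hYZ)⟩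
  obtain ⟨ν, hν, hνc⟩ := exists_barrier_exponent hc
  have hfle : ∀ y : ℝ, Real.exp (-y) - Real.exp (-(ν * y)) ≤ 1 := by
    intro y
    rcases le_total 0 y with hy | hy
    · have : Real.exp (-y) ≤ 1 := Real.exp_le_one_iff.2 (by linarith)
      linarith [Real.exp_pos (-(ν * y))]
    · have : Real.exp (-y) ≤ Real.exp (-(ν * y)) := Real.exp_le_exp.2 (by nlinarith)
      linarith
  obtain ⟨θ, hθ, hθf⟩ := exists_pos_le_of_compact
    (f := fun z => Real.exp (-(z - Z + 1)) - Real.exp (-(ν * (z - Z + 1)))) (by fun_prop) hYZ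
    (fun z hz => by
      have := Real.exp_lt_exp.2 (show -(ν * (z - Z + 1)) < -(z - Z + 1) by nlinarith [hz.1])
      linarith)
  set ε := k * θ / (4 * (L + 1)) with hε
  have hε0 : 0 < ε := by positivity
  have hεL : (L + 1) * ε = k * θ / 4 := by rw [hε]; field_simp
  obtain ⟨T1, hT1, hT1'⟩ := ha ε hε0
  set T2 := max T T1 + h with hT2
  have hT2a : T + h ≤ T2 := by linarith [le_max_left T T1]
  have hT2b : T1 + h ≤ T2 := by linarith [le_max_right T T1]
  set D := k * Real.exp T2 with hD
  have hDe : ∀ t, D * Real.exp (-(1 * t)) = k * Real.exp (T2 - t) := by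
    intro t
    rw [hD, mul_assoc, ← Real.exp_add]; ring_nf
  have key := P.sol.front_comparison hh P.front P.front_le (show 0 ≤ T2 by linarith) hσ
    (s := fun _ => σ * a) (s' := fun _ => 0) (p := fun _ => k) (p' := fun _ => 0)
    (e := fun t => (L + 1) * ε + D * Real.exp (-(1 * t)))
    (e' := fun t => -(1 * (D * Real.exp (-(1 * t)))))
    (f := fun z => Real.exp (-(ν * (z - Z + 1))) - Real.exp (-(z - Z + 1)))
    (f1 := fun z => Real.exp (-(z - Z + 1)) - ν * Real.exp (-(ν * (z - Z + 1))))
    (f2 := fun z => ν ^ 2 * Real.exp (-(ν * (z - Z + 1))) - Real.exp (-(z - Z + 1)))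
    (fun t => hasDerivAt_const _ _) (fun t => hasDerivAt_const _ _)
    (fun t => hasDerivAt_relax _ _ 1 t)
    (fun z => by
      have h1 : HasDerivAt (fun z => -(z - Z + 1)) (-1) z :=
        (((hasDerivAt_id z).sub_const Z).add_const 1).fun_neg
      have h2 : HasDerivAt (fun z => -(ν * (z - Z + 1))) (-(ν * 1)) z :=
        ((((hasDerivAt_id z).sub_const Z).add_const 1).const_mul ν).fun_neg
      exact (h2.exp.sub h1.exp).congr_deriv (by ring))
    (fun z => by
      have h1 : HasDerivAt (fun z => -(z - Z + 1)) (-1) z :=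
        (((hasDerivAt_id z).sub_const Z).add_const 1).fun_neg
      have h2 : HasDerivAt (fun z => -(ν * (z - Z + 1))) (-(ν * 1)) z :=
        ((((hasDerivAt_id z).sub_const Z).add_const 1).const_mul ν).fun_neg
      exact (h1.exp.sub (h2.exp.const_mul ν)).congr_deriv (by ring))
    (fun _ => hk.le) ⟨-1, fun z => by linarith [hfle (z - Z + 1)]⟩
    (fun t ht x => by
      have h1 := hT1' t (by linarith [ht.1]) x
      have h2 : 1 ≤ Real.exp (T2 - t) := Real.one_le_exp (by linarith [ht.2])
      have h3 := mul_le_mul_of_nonneg_left h2 hk.le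
      have h4 := mul_le_mul_of_nonneg_left (hfle (x + c * t - Z + 1)) hk.le
      have h5 := mul_pos hL hε0
      rw [hDe]
      linarith)
    (fun t ht x hlt hle => by
      have hD0 : 0 ≤ D * Real.exp (-(1 * t)) := by positivity
      have hLε : 0 ≤ (L + 1) * ε := by positivity
      have hzZ : Z < x + c * t := by
        by_contra! hz
        rcases le_total (x + c * t) (Z - 1) with hz2 | hz2
        · have h1 := hleft t (by linarith) x hz
          have h2 := Real.exp_le_exp.2 (show -(x + c * t - Z + 1) ≤ -(ν * (x + c * t - Z + 1)) by
            nlinarith)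
          have h3 := mul_le_mul_of_nonneg_left h2 hk.le
          linarith
        · have h1 := hgap t (by linarith) x ⟨hz2, hz⟩
          have h4 := mul_le_mul_of_nonneg_left (hfle (x + c * t - Z + 1)) hk.le
          linarith
      have h1 := hT1' (t - h) (by linarith) x
      rw [show x + c * (t - h) + σ * a = x + c * t + σ * a - c * h by ring] at h1
      have h2 := hg.signed_le hσ hε0.le hL.le h1 (fun _ => hg.lip _ _)
      have h3 := barrier_sub hν hνc hc (show 1 ≤ x + c * t - Z + 1 by linarith)
      have h4 := mul_le_mul_of_nonneg_left h3 hk.le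
      linarith)
  obtain ⟨S, hS, hS2⟩ := exists_exp_neg_mul_le D one_pos (show 0 < k * θ / 4 by positivity)
  refine ⟨k * θ / 2, by positivity, max S T2, hS.le.trans (le_max_left _ _), fun t ht x hx => ?_⟩
  have h1 := key t (by linarith [(le_max_right S T2).trans ht]) x
  have h2 := hS2 t ((le_max_left S T2).trans ht)
  have h3 := mul_le_mul_of_nonneg_left (hθf _ hx) hk.le
  linarith

/-- A one-sided bound by the shifted front behind a point spreads to the whole line. -/
lemma asympShift_of_left (P : FrontProblem g h c kap g0 L μ v v1 v2 u ut u1 u2) {σ : ℝ}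
    (hσ : σ = 1 ∨ σ = -1) {a : ℝ} (ha : 0 ≤ a) : ∃ Y, ∀ b ∈ Icc 0 a,
      (∃ T ≥ 0, ∀ t ≥ T, ∀ x, x + c * t ≤ Y → σ * u t x ≤ σ * v (x + c * t + σ * b)) →
      AsympShift c v u σ b := by
  have hg := P.map
  have hh := P.h_pos
  have hc := P.c_pos
  have hkap := hg.kap_pos
  obtain ⟨ρ, δ, hρ0, hρ1, hδ, hcontr⟩ := hg.contr_kap
  obtain ⟨γ, hγ, hγ1, -, hγρ⟩ := P.exists_contraction_rate hρ1
  obtain ⟨T1, hT1, Z1, hnear⟩ := P.eventually_near_kap hδ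
  obtain ⟨Z2, hZ2⟩ := eventually_atTop.1 (P.front.top.eventually_const_le
    (show kap - δ < kap by linarith))
  obtain ⟨M, hM⟩ := P.init_le
  obtain ⟨B, hB⟩ := P.sol.bounded hg hh hM
  refine ⟨max (Z1 + c * h) (Z2 + c * h + a), fun b hb => ?_⟩
  rintro ⟨T2, hT2, hleft⟩
  set T := max T1 T2 + h with hT
  have hTa : T1 + h ≤ T := by linarith [le_max_left T1 T2]
  have hTb : T2 + h ≤ T := by linarith [le_max_right T1 T2]
  set D := (|B| + kap) * Real.exp (γ * T) with hD
  have hD0 : 0 ≤ D := by positivity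
  have key := P.sol.front_comparison hh P.front P.front_le (show 0 ≤ T by linarith) hσ
    (s := fun _ => σ * b) (s' := fun _ => 0) (p := fun _ => 0) (p' := fun _ => 0)
    (e := fun t => 0 + D * Real.exp (-(γ * t))) (e' := fun t => -(γ * (D * Real.exp (-(γ * t)))))
    (f := fun _ => 0) (f1 := fun _ => 0) (f2 := fun _ => 0)
    (fun t => hasDerivAt_const _ _) (fun t => hasDerivAt_const _ _)
    (fun t => hasDerivAt_relax _ _ _ t) (fun t => hasDerivAt_const _ _)
    (fun t => hasDerivAt_const _ _) (fun _ => le_rfl) ⟨0, fun _ => le_rfl⟩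
    (fun t ht x => by
      have h1 := hB t (by linarith [ht.1]) x
      have h2 := P.sol_nonneg t (by linarith [ht.1]) x
      have h3 := P.front.pos (x + c * t + σ * b)
      have h4 := P.front_le (x + c * t + σ * b)
      have h5 : 1 ≤ Real.exp (γ * T) * Real.exp (-(γ * t)) := by
        rw [← Real.exp_add]
        exact Real.one_le_exp (by nlinarith [ht.2])
      have h6 := mul_le_mul_of_nonneg_left h5 (show 0 ≤ |B| + kap by positivity)
      rw [hD, zero_mul, zero_add, add_zero]
      rcases hσ with rfl | rfl <;> linarith [le_abs_self B, abs_nonneg B])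
    (fun t ht x hlt hle => by
      simp only [add_zero, zero_mul, mul_zero, zero_add, sub_zero] at hlt hle ⊢
      have hz : max (Z1 + c * h) (Z2 + c * h + a) < x + c * t := by
        by_contra! hz
        have h1 := hleft t (by linarith) x hz
        have : 0 ≤ D * Real.exp (-(γ * t)) := by positivity
        linarith
      have hz1 := (le_max_left _ _).trans_lt hz
      have hz2 := (le_max_right _ _).trans_lt hz
      rw [show x + c * t - c * h + σ * b = x + c * t + σ * b - c * h by ring] at hle
      have h1 := hnear (t - h) (by linarith) x (by linarith)
      have h2 := hZ2 (x + c * t + σ * b - c * h) (by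
        rcases hσ with rfl | rfl <;> linarith [hb.1, hb.2])
      have h3 := P.front_le (x + c * t + σ * b - c * h)
      have h4 := hg.signed_le hσ (by positivity) hρ0 hle
        (fun _ => hcontr _ _ h1 (by rw [abs_le]; constructor <;> linarith))
      have h5 : Real.exp (-(γ * (t - h))) = Real.exp (γ * h) * Real.exp (-(γ * t)) := by
        rw [← Real.exp_add]; ring_nf
      rw [h5] at h4
      have h6 := mul_le_mul_of_nonneg_right hγρ (show 0 ≤ D * Real.exp (-(γ * t)) by positivity)
      linarith)
  intro ε hε
  obtain ⟨S, hS, hS2⟩ := exists_exp_neg_mul_le D hγ hε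
  refine ⟨max S T, hS.le.trans (le_max_left _ _), fun t ht x => ?_⟩
  have h1 := key t (by linarith [(le_max_right S T).trans ht]) x
  have h2 := hS2 t ((le_max_left S T).trans ht)
  linarith

lemma front_lip (P : FrontProblem g h c kap g0 L μ v v1 v2 u ut u1 u2) {σ : ℝ}
    (hσ : σ = 1 ∨ σ = -1) (a b z : ℝ) :
    σ * v (z + σ * a) ≤ σ * v (z + σ * b) + (|c| + 1) * kap * |a - b| := by
  refine signed_of_abs_le hσ ((P.front.abs_sub_le P.map _ _).trans_eq ?_)
  rw [show z + σ * a - (z + σ * b) = σ * (a - b) by ring, abs_mul]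
  rcases hσ with rfl | rfl <;> simp

lemma asympShift_improve (P : FrontProblem g h c kap g0 L μ v v1 v2 u ut u1 u2) {σ : ℝ}
    (hσ : σ = 1 ∨ σ = -1) {a : ℝ} (ha : 0 < a) (hsh : AsympShift c v u σ a) :
    ∃ b ≥ 0, b < a ∧ AsympShift c v u σ b := by
  have hkap := P.map.kap_pos
  obtain ⟨C, hC, T1, hT1, hnear⟩ := P.near
  obtain ⟨Z, hZ⟩ := P.absorb_signed hσ C (half_pos ha)
  obtain ⟨Y, hY⟩ := P.asympShift_of_left hσ ha.le
  have hmono := P.front.strictMono P.map P.delay_nonneg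
  have hvc := P.front.continuous
  obtain ⟨k, hk, hkv⟩ := exists_pos_le_of_compact
    (f := fun z => σ * v (z + σ * a) - σ * v (z + σ * (a / 2))) (by fun_prop)
    (show Z - 1 ≤ Z by linarith) (fun z _ => by
      rcases hσ with rfl | rfl
      · have := hmono (show z + 1 * (a / 2) < z + 1 * a by linarith)
        linarith
      · have := hmono (show z + -1 * a < z + -1 * (a / 2) by linarith)
        linarith)
  have hleft : ∀ t ≥ T1, ∀ x, x + c * t ≤ Z → σ * u t x ≤ σ * v (x + c * t + σ * (a / 2)) :=
    fun t ht x hx => (signed_of_abs_le hσ (hnear t ht x)).trans (hZ _ hx)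
  obtain ⟨θ, hθ, S, hS, hgap⟩ := P.gap_propagation hσ hsh hk hT1
    (fun t ht x hx => (hleft t ht x hx).trans (P.signed_mono hσ (by linarith) _))
    (fun t ht x hx => by linarith [hleft t ht x hx.2, hkv _ hx]) Y
  set Λ := (|c| + 1) * kap with hΛ
  have hΛ0 : 0 < Λ := by positivity
  set s := min (a / 2) (θ / Λ) with hs
  have hs0 : 0 < s := lt_min (half_pos ha) (by positivity)
  have hs1 : s ≤ a / 2 := min_le_left _ _
  have hs2 : s * Λ ≤ θ := by
    have : s ≤ θ / Λ := min_le_right _ _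
    rwa [le_div_iff₀ hΛ0] at this
  refine ⟨a - s, by linarith, by linarith, hY _ ⟨by linarith, by linarith⟩
    ⟨max S T1, hS.trans (le_max_left _ _), fun t ht x hx => ?_⟩⟩
  rcases le_total (x + c * t) Z with hxZ | hxZ
  · exact (hleft t ((le_max_right _ _).trans ht) x hxZ).trans
      (P.signed_mono hσ (by linarith) _)
  · have h1 := hgap t ((le_max_left _ _).trans ht) x ⟨hxZ, hx⟩
    have h2 := P.front_lip hσ a (a - s) (x + c * t)
    rw [sub_sub_cancel, abs_of_pos hs0, ← hΛ] at h2
    linarith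

lemma asympShift_zero (P : FrontProblem g h c kap g0 L μ v v1 v2 u ut u1 u2) {σ : ℝ}
    (hσ : σ = 1 ∨ σ = -1) : AsympShift c v u σ 0 := by
  have hkap := P.map.kap_pos
  set A : Set ℝ := {a | 0 ≤ a ∧ AsympShift c v u σ a} with hA
  have hne : A.Nonempty := by
    obtain ⟨a, ha, hsh⟩ := P.exists_asympShift hσ
    exact ⟨a, ha, hsh⟩
  have hbd : BddBelow A := ⟨0, fun a ha => ha.1⟩
  have h0 : 0 ≤ sInf A := le_csInf hne fun a ha => ha.1
  have hmem : AsympShift c v u σ (sInf A) := by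
    intro ε hε
    set Λ := (|c| + 1) * kap with hΛ
    have hΛ0 : 0 < Λ := by positivity
    obtain ⟨a, ha, hlt⟩ := exists_lt_of_csInf_lt hne
      (show sInf A < sInf A + ε / (2 * Λ) by linarith [show 0 < ε / (2 * Λ) by positivity])
    obtain ⟨T, hT, h1⟩ := ha.2 (ε / 2) (half_pos hε)
    refine ⟨T, hT, fun t ht x => ?_⟩
    have h2 := P.front_lip hσ a (sInf A) (x + c * t)
    rw [abs_of_nonneg (sub_nonneg.2 (csInf_le hbd ha)), ← hΛ] at h2
    have h3 : a - sInf A ≤ ε / (2 * Λ) := by linarith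
    rw [le_div_iff₀ (by positivity)] at h3
    linarith [h1 t ht x]
  rcases h0.eq_or_lt with h1 | h1
  · rwa [h1]
  · obtain ⟨b, hb, hlt, hsh⟩ := P.asympShift_improve hσ h1 hmem
    exact absurd (csInf_le hbd (show b ∈ A from ⟨hb, hsh⟩)) (not_le.2 hlt)

lemma uniform_convergence (P : FrontProblem g h c kap g0 L μ v v1 v2 u ut u1 u2) {ε : ℝ}
    (hε : 0 < ε) : ∃ T, ∀ t ≥ T, ∀ x, |u t x - v (x + c * t)| ≤ ε := by
  obtain ⟨T1, -, h1⟩ := P.asympShift_zero (Or.inl rfl) ε hε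
  obtain ⟨T2, -, h2⟩ := P.asympShift_zero (Or.inr rfl) ε hε
  refine ⟨max T1 T2, fun t ht x => abs_le_of_signed fun σ hσ => ?_⟩
  rcases hσ with rfl | rfl
  · simpa using h1 t ((le_max_left _ _).trans ht) x
  · simpa using h2 t ((le_max_right _ _).trans ht) x

lemma weighted_convergence (P : FrontProblem g h c kap g0 L μ v v1 v2 u ut u1 u2) {lam ε : ℝ}
    (hlam : 0 < lam) (hlμ : lam < μ) (hε : 0 < ε) :
    ∃ T, ∀ t ≥ T, ∀ x, |u t x - v (x + c * t)| ≤ ε * eta lam (x + c * t) := by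
  obtain ⟨C, hC, T1, -, hnear⟩ := P.near
  obtain ⟨S, hS, hS2⟩ := exists_exp_neg_mul_le C (sub_pos.2 hlμ) hε
  obtain ⟨T2, hT2⟩ := P.uniform_convergence
    (show 0 < ε * Real.exp (-(lam * S)) by positivity)
  refine ⟨max T1 T2, fun t ht x => ?_⟩
  set z := x + c * t with hz
  rcases le_total z (-S) with h1 | h1
  · refine (hnear t ((le_max_left _ _).trans ht) x).trans ?_
    rw [← hz, eta, min_eq_left (Real.exp_le_one_iff.2 (by nlinarith))]
    have h2 := mul_le_mul_of_nonneg_right (hS2 (-z) (by linarith)) (Real.exp_pos (lam * z)).le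
    rwa [mul_assoc, ← Real.exp_add,
      show -((μ - lam) * -z) + lam * z = μ * z by ring] at h2
  · refine (hT2 t ((le_max_right _ _).trans ht) x).trans (mul_le_mul_of_nonneg_left ?_ hε.le)
    refine le_min (Real.exp_le_exp.2 (by nlinarith)) (Real.exp_le_one_iff.2 ?_)
    have := mul_pos hlam hS
    linarith

end FrontProblem

/-- **Corollary 2 (global asymptotic stability without asymptotic phase).**
If `g` is strictly increasing, satisfies (H), `c > c_*`, and the initial perturbation
`φ(·+cs) − w₀(s,·)` has finite `|·|_μ` norm for some `μ > λ₁(c)`, then the solution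
converges to `φ(x+ct)` in the `η_{λ₁(c)}`-weighted uniform norm. -/
theorem global_stability_without_phase
    (g : ℝ → ℝ) (kap del0 Lg h c : ℝ)
    (hH : HypH g kap del0 Lg) (hmono : StrictMono g)
    (hh : 0 < h) (hc : 0 < c)
    -- c > c_* : χ₀(·;c) has two distinct positive real zeros λ₁ < λ₂ …
    (lam1 lam2 : ℝ) (hlam1_pos : 0 < lam1) (hlam_lt : lam1 < lam2)
    (hchi1 : chi (deriv g 0) c h lam1 = 0) (hchi2 : chi (deriv g 0) c h lam2 = 0)
    -- … and (*) admits wavefronts with speed c and with some speed c' < c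
    (φ : ℝ → ℝ) (hφ : IsWavefront g h c kap φ)
    (hlower : ∃ c' < c, ∃ φ' : ℝ → ℝ, IsWavefront g h c' kap φ')
    (w0 : ℝ → ℝ → ℝ) (hIC1 : IC1 h w0) (hIC2 : IC2 h w0) (hHol : LocHolder h w0)
    -- sup_{s∈[−h,0]} |φ(·+cs) − w₀(s,·)|_μ < ∞ for some μ > λ₁(c)
    (hpert : ∃ μ > lam1, ∃ M : ℝ, ∀ s ∈ Set.Icc (-h) 0, ∀ x : ℝ,
        |φ (x + c * s) - w0 s x| ≤ M * eta μ x)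
    -- u : a classical solution of (*) with initial datum w₀
    (u : ℝ → ℝ → ℝ) (hu : SolvesStar g h u)
    (hinit : ∀ s ∈ Set.Icc (-h) 0, ∀ x : ℝ, u s x = w0 s x) :
    -- lim_{t→∞} sup_{x∈ℝ} |φ(x+ct) − u(t,x)| / η_{λ₁(c)}(x+ct) = 0
    ∀ ε > (0:ℝ), ∃ T : ℝ, ∀ t ≥ T, ∀ x : ℝ,
      |φ (x + c * t) - u t x| ≤ ε * eta lam1 (x + c * t) := by
  obtain ⟨L, hg⟩ := hH.monostableMap hmono
  obtain ⟨c', hc', φ', hφ'⟩ := hlower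
  obtain ⟨ν, hν, M, hM⟩ := hpert
  obtain ⟨M0, hM0⟩ := hIC1
  obtain ⟨m, hm, X, hX⟩ := hIC2
  obtain ⟨μ, hμ1, hμ2⟩ := exists_between (lt_min hlam_lt hν)
  have hμ : μ ∈ Ioo lam1 lam2 := ⟨hμ1, hμ2.trans_le (min_le_left _ _)⟩
  have hμν : μ ≤ ν := hμ2.le.trans (min_le_right _ _)
  have hμ0 : 0 < μ := hlam1_pos.trans hμ1
  have P : FrontProblem g h c kap (deriv g 0) L μ φ (deriv φ) (deriv (deriv φ)) u
      (fun t x => deriv (fun τ => u τ x) t) (fun t => deriv (u t))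
      (fun t => deriv (deriv (u t))) :=
    { map := hg
      h_pos := hh
      c_pos := hc
      rate_pos := hμ0
      chi_neg := chi_neg_of_mem_Ioo (by linarith [hH.deriv0_gt]) hchi1 hchi2 hμ
      front := hφ.profile
      absorb := fun C b hb => hφ.profile.add_exp_le_shift hg hh hc hlam1_pos hlam_lt hchi1 hchi2
        hc' hφ'.profile hμ C hb
      sol := hu.classicalSol
      init_nonneg := fun t ht x => by rw [hinit t ht x]; exact (hM0 t ht x).1
      init_le := ⟨M0, fun t ht x => by rw [hinit t ht x]; exact (hM0 t ht x).2⟩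
      init_ge := ⟨m, hm, X, fun t ht x hx => by rw [hinit t ht x]; exact hX x hx t ht⟩
      init_near := by
        refine ⟨|M| * Real.exp (μ * (c * h)), by positivity, fun t ht x => ?_⟩
        rw [hinit t ht x, abs_sub_comm, mul_assoc, ← Real.exp_add]
        have h1 : eta ν x ≤ Real.exp (μ * x) := by
          rcases le_total x 0 with hx | hx
          · exact (min_le_left _ _).trans (Real.exp_le_exp.2 (by nlinarith))
          · exact (min_le_right _ _).trans (Real.one_le_exp (by positivity))
        have h2 : Real.exp (μ * x) ≤ Real.exp (μ * (c * h) + μ * (x + c * t)) :=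
          Real.exp_le_exp.2 (by
            have := mul_nonneg (mul_pos hμ0 hc).le (show 0 ≤ h + t by linarith [ht.1])
            linarith)
        have h3 : 0 ≤ eta ν x := le_min (Real.exp_pos _).le zero_le_one
        calc |φ (x + c * t) - w0 t x| ≤ M * eta ν x := hM t ht x
          _ ≤ |M| * eta ν x := mul_le_mul_of_nonneg_right (le_abs_self M) h3
          _ ≤ _ := mul_le_mul_of_nonneg_left (h1.trans h2) (abs_nonneg M) }
  intro ε hε
  obtain ⟨T, hT⟩ := P.weighted_convergence hlam1_pos hμ1 hε
  exact ⟨T, fun t ht x => by rw [abs_sub_comm]; exact hT t ht x⟩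
end
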